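/- arXiv:1308.3046 — 4 statements merged into one kernel-verified Lean document; each statement's English description precedes it below -/
import Mathlib

section
/- (Ohba) For all integers r ≥ 1 and t ≥ 0, the complete (r+t)-partite graph K_{3*r,1*t}, with r parts of size 3 and t parts of size 1, has choice number exactly max(r + t, ⌈(4r + 2t − 1)/3⌉). -/
/-- `G` has a proper coloring in which every vertex gets a color from its own list. -/
def ListColorable {V : Type*} (G : SimpleGraph V) (L : V → Finset ℕ) : Prop :=
  ∃ c : V → ℕ, (∀ v, c v ∈ L v) ∧ ∀ ⦃u w⦄, G.Adj u w → c u ≠ c w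

/-- `G` is `k`-choosable: `L`-colorable for every list assignment with all lists of size ≥ `k`. -/
def Choosable {V : Type*} (G : SimpleGraph V) (k : ℕ) : Prop :=
  ∀ L : V → Finset ℕ, (∀ v, k ≤ (L v).card) → ListColorable G L


namespace Ohba
open Finset

/-- Hall's theorem on a finset. -/
lemma hall_on {V : Type} [DecidableEq V] (W : Finset V) (L : V → Finset ℕ)
    (h : ∀ S ⊆ W, S.card ≤ (S.biUnion L).card) :
    ∃ f : V → ℕ, Set.InjOn f W ∧ ∀ v ∈ W, f v ∈ L v := by
  have := (Finset.all_card_le_biUnion_card_iff_exists_injective (fun v : W => L v)).1 (by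
    intro S
    have h1 := h (S.map (Function.Embedding.subtype _)) (by
      intro x hx
      simp only [mem_map, Function.Embedding.subtype_apply] at hx
      obtain ⟨y, _, rfl⟩ := hx
      exact y.2)
    rw [card_map] at h1
    refine h1.trans (card_le_card ?_)
    intro x hx
    simp only [mem_biUnion, mem_map, Function.Embedding.subtype_apply] at hx ⊢
    obtain ⟨v, ⟨y, hy, rfl⟩, hx⟩ := hx
    exact ⟨y, hy, hx⟩)
  obtain ⟨f, hf, hf2⟩ := this
  refine ⟨fun v => if hv : v ∈ W then f ⟨v, hv⟩ else 0, ?_, ?_⟩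
  · intro a ha b hb hab
    have ha' : a ∈ W := ha
    have hb' : b ∈ W := hb
    simp only [ha', hb', dif_pos] at hab
    exact congrArg Subtype.val (hf hab)
  · intro v hv
    simp only [hv, dif_pos]
    exact hf2 ⟨v, hv⟩

/-- Sequential choice of the pairs to be merged, together with distinct colours for them. -/
lemma choose_pairs {R : Type} [DecidableEq R] (M : R → Fin 3 → Finset ℕ) (m K : ℕ) (Q : Finset R)
    (hs : ∀ X ∈ Q, Q.card ≤ (univ.biUnion (M X)).card)
    (ha : ∀ X ∈ Q, ∃ i, K ≤ m + (M X i).card) :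
    ∃ (ρ : R → ℕ) (z : R → Fin 3) (c : R → ℕ), Set.InjOn ρ Q ∧ (∀ X ∈ Q, ρ X < Q.card) ∧
      Set.InjOn c Q ∧ (∀ X ∈ Q, c X ∈ M X (z X)) ∧
      ∀ X ∈ Q, K ≤ m + (M X (z X)).card + ρ X := by
  induction Q using Finset.induction_on with
  | empty => exact ⟨fun _ => 0, fun _ => 0, fun _ => 0, by simp⟩
  | insert X Q hX ih =>
    rw [card_insert_of_notMem hX] at hs
    obtain ⟨ρ, z, c, h1, h2, h3, h4, h5⟩ := ih
      (fun Y hY => by have := hs Y (mem_insert_of_mem hY); omega)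
      (fun Y hY => ha Y (mem_insert_of_mem hY))
    have key : ∃ i, ∃ d ∈ M X i, d ∉ Q.image c ∧ K ≤ m + (M X i).card + Q.card := by
      obtain ⟨i, hi⟩ := ha X (mem_insert_self _ _)
      have hc : (Q.image c).card ≤ Q.card := card_image_le
      by_cases hb : Q.card < (M X i).card
      · obtain ⟨d, hd, hd'⟩ := exists_mem_notMem_of_card_lt_card (lt_of_le_of_lt hc hb)
        exact ⟨i, d, hd, hd', by omega⟩
      · have := hs X (mem_insert_self _ _)
        obtain ⟨d, hd, hd'⟩ := exists_mem_notMem_of_card_lt_card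
          (show (Q.image c).card < (univ.biUnion (M X)).card by omega)
        simp only [mem_biUnion, mem_univ, true_and] at hd
        obtain ⟨j, hj⟩ := hd
        have : 0 < (M X j).card := card_pos.2 ⟨d, hj⟩
        exact ⟨j, d, hj, hd', by omega⟩
    obtain ⟨i, d, hd, hd', hK⟩ := key
    have hne : ∀ Y ∈ Q, Y ≠ X := fun Y hY h => hX (h ▸ hY)
    have hcard : (insert X Q).card = Q.card + 1 := card_insert_of_notMem hX
    have hd2 : ∀ Y ∈ Q, c Y ≠ d := fun Y hY h => hd' (mem_image.2 ⟨Y, hY, h⟩)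
    refine ⟨Function.update ρ X Q.card, Function.update z X i, Function.update c X d,
      ?_, ?_, ?_, ?_, ?_⟩
    · clear ha
      intro a ha b hb hab
      simp only [coe_insert, Set.mem_insert_iff, mem_coe] at ha hb
      rcases ha with rfl | ha <;> rcases hb with rfl | hb
      · rfl
      · have := h2 b hb
        simp [hne b hb] at hab; omega
      · have := h2 a ha
        simp [hne a ha] at hab; omega
      · simp [hne a ha, hne b hb] at hab
        exact h1 ha hb hab
    · intro Y hY
      rcases mem_insert.1 hY with rfl | hY
      · simp [hcard]
      · have := h2 Y hY
        simp [hne Y hY, hcard]; omega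
    · clear ha
      intro a ha b hb hab
      simp only [coe_insert, Set.mem_insert_iff, mem_coe] at ha hb
      rcases ha with rfl | ha <;> rcases hb with rfl | hb
      · rfl
      · simp [hne b hb] at hab; exact absurd hab.symm (hd2 b hb)
      · simp [hne a ha] at hab; exact absurd hab (hd2 a ha)
      · simp [hne a ha, hne b hb] at hab
        exact h3 ha hb hab
    · intro Y hY
      rcases mem_insert.1 hY with rfl | hY
      · simpa using hd
      · simpa [hne Y hY] using h4 Y hY
    · intro Y hY
      rcases mem_insert.1 hY with rfl | hY
      · simpa using hK
      · simpa [hne Y hY] using h5 Y hY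

/-- Which 3-parts are left unmerged. -/
lemma choose_unmerged {R : Type} [DecidableEq R] [Fintype R] (s a : R → ℕ) (m N : ℕ)
    (hm : 2 * N ≤ 3 * m + 1) (hsa : ∀ X, s X ≤ 3 * a X) :
    ∃ U : Finset R, (∀ X ∈ U, s X + N + U.card ≤ 3 * m ∧ a X + m < N) ∧
      ∀ X ∉ U, N ≤ m + a X + U.card := by
  let F : ℕ → Finset R := fun u => univ.filter (fun X => a X + m < N ∧ s X + N + u ≤ 3 * m)
  have hmem : ∀ u X, X ∈ F u ↔ a X + m < N ∧ s X + N + u ≤ 3 * m := by simp [F]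
  let P : ℕ → Prop := fun u => u ≤ (F u).card
  classical
  let u := Nat.findGreatest P (Fintype.card R)
  have hu : P u := Nat.findGreatest_spec (P := P) (m := 0) (Nat.zero_le _) (Nat.zero_le _)
  have hu' : ¬ P (u + 1) := by
    intro h
    have h1 : u + 1 ≤ Fintype.card R := le_trans h (card_le_univ _)
    have := Nat.le_findGreatest h1 h
    omega
  have hsub : F (u + 1) ⊆ F u := by
    intro X hX
    rw [hmem] at hX ⊢
    omega
  obtain ⟨U, hU1, hU2, hU3⟩ := exists_subsuperset_card_eq (n := u) hsub
    (by simp only [P] at hu'; omega) hu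
  refine ⟨U, ?_, ?_⟩
  · intro X hX
    have := (hmem _ _).1 (hU2 hX)
    omega
  · intro X hX
    have h1 : X ∉ F (u + 1) := fun h => hX (hU1 h)
    rw [hmem] at h1
    have := hsa X
    by_cases h : a X + m < N
    · have : ¬ (s X + N + (u + 1) ≤ 3 * m) := fun h' => h1 ⟨h, h'⟩
      omega
    · omega

lemma three_sets (A B C : Finset ℕ) (h : ∀ c, ¬ (c ∈ A ∧ c ∈ B ∧ c ∈ C)) :
    (A ∪ (B ∪ C)).card + ((B ∩ C).card + (C ∩ A).card + (A ∩ B).card) =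
      A.card + B.card + C.card := by
  have h1 := card_union_add_card_inter A (B ∪ C)
  have h2 := card_union_add_card_inter B C
  have h3 : (A ∩ (B ∪ C)).card = (C ∩ A).card + (A ∩ B).card := by
    rw [← card_union_of_disjoint]
    · congr 1; ext; simp; tauto
    · rw [disjoint_left]
      intro c hc hc'
      simp at hc hc'
      exact h c ⟨hc.2, hc'.2, hc.1⟩
  omega


/-- The part of a vertex. -/
def part {R T : Type} : (R × Fin 3) ⊕ T → R ⊕ T := Sum.map Prod.fst id

lemma card_le_sum {R T : Type} [Fintype R] [Fintype T] [DecidableEq R] [DecidableEq T]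
    (S : Finset ((R × Fin 3) ⊕ T)) (g : R → ℕ)
    (h : ∀ X, (univ.filter (fun j => Sum.inl (X, j) ∈ S)).card ≤ g X) :
    S.card ≤ ∑ X, g X + Fintype.card T := by
  have h1 : S.card = S.toLeft.card + S.toRight.card := (card_toLeft_add_card_toRight).symm
  have h2 : S.toRight.card ≤ Fintype.card T := card_le_univ _
  have h3 : S.toLeft.card = ∑ X, (S.toLeft.filter (fun p => p.1 = X)).card :=
    card_eq_sum_card_fiberwise (fun _ _ => by simp)
  have h4 : ∀ X, (S.toLeft.filter (fun p => p.1 = X)).card ≤ g X := by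
    intro X
    refine le_trans ?_ (h X)
    refine card_le_card_of_injOn Prod.snd ?_ ?_
    · rintro ⟨Y, j⟩ hp
      simp at hp ⊢
      obtain ⟨hp, rfl⟩ := hp
      exact hp
    · rintro ⟨Y, j⟩ hp ⟨Z, k⟩ hq hpq
      simp at hp hq hpq
      rw [hp.2, hq.2, hpq]
  have h5 : ∑ X, (S.toLeft.filter (fun p => p.1 = X)).card ≤ ∑ X, g X :=
    sum_le_sum fun X _ => h4 X
  omega

lemma fin3_cases : ∀ j i : Fin 3, j = i ∨ j = i + 1 ∨ j = i + 2 := by decide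

lemma card_le_two_of_missing (F : Finset (Fin 3)) (j : Fin 3) (h : j ∉ F) : F.card ≤ 2 := by
  have : F ⊆ univ.erase j := fun x hx => mem_erase.2 ⟨fun e => h (e ▸ hx), mem_univ _⟩
  have := card_le_card this
  simpa using this

lemma card_le_one_of_no_pair : ∀ (F : Finset (Fin 3)), (∀ i, ¬ (i + 1 ∈ F ∧ i + 2 ∈ F)) →
    F.card ≤ 1 := by decide

lemma card_le_one_of_merged : ∀ (F : Finset (Fin 3)) (z : Fin 3), z + 2 ∉ F →
    ¬ (z ∈ F ∧ z + 1 ∈ F) → F.card ≤ 1 := by decide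

lemma core {R T : Type} [Fintype R] [Fintype T] [DecidableEq R] [DecidableEq T] (m : ℕ)
    (L : (R × Fin 3) ⊕ T → Finset ℕ) (hL : ∀ v, (L v).card = m)
    (htrip : ∀ X c, ¬ (∀ j, c ∈ L (Sum.inl (X, j))))
    (hC : (univ.biUnion L).card < 3 * Fintype.card R + Fintype.card T)
    (hk : Fintype.card R + Fintype.card T ≤ m)
    (hm : 4 * Fintype.card R + 2 * Fintype.card T ≤ 3 * m + 1) :
    ∃ c : (R × Fin 3) ⊕ T → ℕ, (∀ v, c v ∈ L v) ∧ ∀ v w, c v = c w → part v = part w := by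
  set r := Fintype.card R with hr
  set t := Fintype.card T with ht
  let A : R → Fin 3 → Finset ℕ := fun X j => L (Sum.inl (X, j))
  have hA : ∀ X j, (A X j).card = m := fun X j => hL _
  let M : R → Fin 3 → Finset ℕ := fun X i => A X (i + 1) ∩ A X (i + 2)
  have htrip' : ∀ X c, ¬ (c ∈ A X 0 ∧ c ∈ A X 1 ∧ c ∈ A X 2) := by
    intro X c h
    refine htrip X c fun j => ?_
    fin_cases j
    exacts [h.1, h.2.1, h.2.2]
  let s : R → ℕ := fun X => (M X 0).card + (M X 1).card + (M X 2).card
  have F1 : ∀ X, (A X 0 ∪ (A X 1 ∪ A X 2)).card + s X = 3 * m := by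
    intro X
    have := three_sets (A X 0) (A X 1) (A X 2) (htrip' X)
    rw [hA, hA, hA] at this
    have e : s X = (A X 1 ∩ A X 2).card + (A X 2 ∩ A X 0).card + (A X 0 ∩ A X 1).card := rfl
    omega
  have F2 : ∀ X i, (A X (i + 1) ∪ A X (i + 2)).card + (M X i).card = 2 * m := by
    intro X i
    have := card_union_add_card_inter (A X (i + 1)) (A X (i + 2))
    rw [hA, hA] at this
    simp only [M]; omega
  have F3 : ∀ X i, (A X i ∪ M X i).card = m + (M X i).card := by
    intro X i
    rw [card_union_of_disjoint, hA]
    rw [disjoint_left]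
    intro c hc hc'
    simp only [M, mem_inter] at hc'
    refine htrip X c fun j => ?_
    rcases fin3_cases j i with rfl | rfl | rfl
    exacts [hc, hc'.1, hc'.2]
  have F4 : ∀ X, (univ.biUnion (M X)).card = s X := by
    intro X
    rw [card_biUnion]
    · simp [s, Fin.sum_univ_three]
    · intro i _ j _ hij
      rw [Function.onFun, disjoint_left]
      intro c hc hc'
      simp only [M, mem_inter] at hc hc'
      obtain ⟨h1, h2⟩ := hc
      obtain ⟨h3, h4⟩ := hc'
      refine htrip X c fun l => ?_
      have : ∀ i j l : Fin 3, i ≠ j → l = i + 1 ∨ l = i + 2 ∨ l = j + 1 ∨ l = j + 2 := by decide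
      rcases this i j l hij with rfl | rfl | rfl | rfl <;> assumption
  have F5 : ∀ X, r + t ≤ s X := by
    intro X
    have h1 := F1 X
    have h2 : (A X 0 ∪ (A X 1 ∪ A X 2)).card ≤ (univ.biUnion L).card := by
      refine card_le_card (union_subset ?_ (union_subset ?_ ?_)) <;>
      exact subset_biUnion_of_mem L (mem_univ _)
    omega
  have hmax : ∀ X, ∃ i, ∀ j, (M X j).card ≤ (M X i).card := by
    intro X
    obtain ⟨i, _, hi⟩ := exists_max_image univ (fun i => (M X i).card) univ_nonempty
    exact ⟨i, fun j => hi j (mem_univ _)⟩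
  choose i0 hi0 using hmax
  obtain ⟨U, hU, hU'⟩ := choose_unmerged s (fun X => (M X (i0 X)).card) m (2 * r + t)
    (by omega) (fun X => by
      have h0 := hi0 X 0
      have h1 := hi0 X 1
      have h2 := hi0 X 2
      simp only [s]; omega)
  have hUr : Uᶜ.card + U.card = r := by rw [card_compl]; have := card_le_univ U; omega
  obtain ⟨ρ, z, c, hρ, hρ2, hc, hcM, hK⟩ := choose_pairs M m (r + t + Uᶜ.card) Uᶜ
    (fun X _ => by rw [F4]; have := F5 X; omega)
    (fun X hX => ⟨i0 X, by have := hU' X (mem_compl.1 hX); omega⟩)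
  let L' : (R × Fin 3) ⊕ T → Finset ℕ := fun v => match v with
    | Sum.inl (X, j) => if X ∉ U ∧ j = z X + 1 then M X (z X) else A X j
    | Sum.inr τ => L (Sum.inr τ)
  let W : Finset ((R × Fin 3) ⊕ T) :=
    univ.filter (fun v => ∀ X j, v = Sum.inl (X, j) → X ∈ U ∨ j ≠ z X + 2)
  have hL'U : ∀ X ∈ U, ∀ j, L' (Sum.inl (X, j)) = A X j := by
    intro X hX j; simp [L', hX]
  have hL'M : ∀ X ∉ U, L' (Sum.inl (X, z X + 1)) = M X (z X) := by
    intro X hX; simp [L', hX]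
  have hL'z : ∀ X j, j ≠ z X + 1 → L' (Sum.inl (X, j)) = A X j := by
    intro X j hj; simp [L', hj]
  have hL'T : ∀ τ, L' (Sum.inr τ) = L (Sum.inr τ) := fun τ => rfl
  have hne1 : ∀ i : Fin 3, i ≠ i + 1 := by decide
  have hne2 : ∀ i : Fin 3, i + 1 ≠ i + 2 := by decide
  have hall : ∀ S ⊆ W, S.card ≤ (S.biUnion L').card := by
    intro S hS
    have hSW : ∀ X j, Sum.inl (X, j) ∈ S → X ∈ U ∨ j ≠ z X + 2 := by
      intro X j h
      have := hS h
      simp only [W, mem_filter, mem_univ, true_and] at this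
      exact this X j rfl
    have hSW' : ∀ X ∉ U, Sum.inl (X, z X + 2) ∉ S := by
      intro X hX h
      rcases hSW X _ h with h | h
      exacts [hX h, h rfl]
    have hsub : ∀ v ∈ S, L' v ⊆ S.biUnion L' := fun v hv => subset_biUnion_of_mem L' hv
    by_cases c1 : ∃ X ∈ U, ∀ j, Sum.inl (X, j) ∈ S
    · obtain ⟨X, hX, hXS⟩ := c1
      have h1 := card_le_sum S (fun Y => if Y ∈ U then 3 else 2) (by
        intro Y
        by_cases hY : Y ∈ U
        · simp only [hY, if_true]
          exact card_le_univ _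
        · simp only [hY, if_false]
          exact card_le_two_of_missing _ (z Y + 2) (by simp [hSW' Y hY]))
      have h2 : ∑ Y, (if Y ∈ U then 3 else 2) = 2 * r + U.card := by
        have : ∀ Y, (if Y ∈ U then 3 else 2) = 2 + (if Y ∈ U then 1 else 0) := by
          intro Y; split_ifs <;> rfl
        simp only [this, sum_add_distrib]
        simp [hr, mul_comm]
      have h3 : (A X 0 ∪ (A X 1 ∪ A X 2)).card ≤ (S.biUnion L').card := by
        refine card_le_card (union_subset ?_ (union_subset ?_ ?_)) <;>
        · rw [← hL'U X hX]; exact hsub _ (hXS _)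
      have := F1 X
      have := (hU X hX).1
      omega
    have fibU : ∀ Y, (univ.filter (fun j => Sum.inl (Y, j) ∈ S)).card ≤ 2 := by
      intro Y
      by_cases hY : Y ∈ U
      · have : ¬ ∀ j, Sum.inl (Y, j) ∈ S := fun h => c1 ⟨Y, hY, h⟩
        push Not at this
        obtain ⟨j, hj⟩ := this
        exact card_le_two_of_missing _ j (by simp [hj])
      · exact card_le_two_of_missing _ (z Y + 2) (by simp [hSW' Y hY])
    by_cases c2 : ∃ X ∈ U, ∃ i, Sum.inl (X, i + 1) ∈ S ∧ Sum.inl (X, i + 2) ∈ S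
    · obtain ⟨X, hX, i, hi1, hi2⟩ := c2
      have h1 := card_le_sum S (fun _ => 2) fibU
      have h2 : ∑ _Y : R, 2 = 2 * r := by simp [hr, mul_comm]
      have h3 : (A X (i + 1) ∪ A X (i + 2)).card ≤ (S.biUnion L').card := by
        refine card_le_card (union_subset ?_ ?_)
        · rw [← hL'U X hX]; exact hsub _ hi1
        · rw [← hL'U X hX]; exact hsub _ hi2
      have := F2 X i
      have := (hU X hX).2
      have := hi0 X i
      omega
    have fibU1 : ∀ Y ∈ U, (univ.filter (fun j => Sum.inl (Y, j) ∈ S)).card ≤ 1 := by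
      intro Y hY
      refine card_le_one_of_no_pair _ ?_
      intro i hi
      simp only [mem_filter, mem_univ, true_and] at hi
      exact c2 ⟨Y, hY, i, hi⟩
    have fibQ1 : ∀ Y ∉ U, ¬ (Sum.inl (Y, z Y) ∈ S ∧ Sum.inl (Y, z Y + 1) ∈ S) →
        (univ.filter (fun j => Sum.inl (Y, j) ∈ S)).card ≤ 1 := by
      intro Y hY h
      refine card_le_one_of_merged _ (z Y) ?_ ?_
      · simp [hSW' Y hY]
      · simpa using h
    let full : Finset R := Uᶜ.filter (fun Y => Sum.inl (Y, z Y) ∈ S ∧ Sum.inl (Y, z Y + 1) ∈ S)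
    by_cases c3 : full.Nonempty
    · obtain ⟨X, hX, hXmin⟩ := exists_min_image full ρ c3
      have h1 := card_le_sum S (fun Y => 1 + if Y ∈ full then 1 else 0) (by
        intro Y
        by_cases hY : Y ∈ full
        · simp only [hY, if_true]
          exact fibU Y
        · simp only [hY, if_false]
          by_cases hYU : Y ∈ U
          · exact fibU1 Y hYU
          · refine fibQ1 Y hYU fun h => hY ?_
            simp only [full, mem_filter, mem_compl]
            exact ⟨hYU, h⟩)
      have h2 : ∑ Y, (1 + if Y ∈ full then 1 else 0) = r + full.card := by
        rw [sum_add_distrib]; simp [hr]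
      have hfs : full ⊆ Uᶜ := filter_subset _ _
      have h3 : full.card ≤ (Ico (ρ X) Uᶜ.card).card := by
        refine card_le_card_of_injOn ρ ?_ ?_
        · intro Y hY
          simp only [coe_Ico, Set.mem_Ico]
          exact ⟨hXmin Y hY, hρ2 Y (hfs hY)⟩
        · exact hρ.mono (by exact_mod_cast hfs)
      rw [Nat.card_Ico] at h3
      have hXU := hfs hX
      have h4 := hρ2 X hXU
      have h5 := hK X hXU
      have hX' := (mem_filter.1 hX).2
      have h6 : (A X (z X) ∪ M X (z X)).card ≤ (S.biUnion L').card := by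
        refine card_le_card (union_subset ?_ ?_)
        · rw [← hL'z X (z X) (hne1 _)]; exact hsub _ hX'.1
        · rw [← hL'M X (mem_compl.1 hXU)]; exact hsub _ hX'.2
      rw [F3] at h6
      omega
    have h1 := card_le_sum S (fun _ => 1) (by
      intro Y
      by_cases hYU : Y ∈ U
      · exact fibU1 Y hYU
      · refine fibQ1 Y hYU fun h => c3 ⟨Y, ?_⟩
        simp only [full, mem_filter, mem_compl]
        exact ⟨hYU, h⟩)
    have h2 : ∑ _Y : R, 1 = r := by simp [hr]
    by_cases c4 : ∃ v ∈ S, (L' v).card = m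
    · obtain ⟨v, hv, hvm⟩ := c4
      have := card_le_card (hsub v hv)
      omega
    · push Not at c4
      have hS5 : ∀ v ∈ S, ∃ X ∉ U, v = Sum.inl (X, z X + 1) := by
        intro v hv
        rcases v with ⟨X, j⟩ | τ
        · by_cases h : X ∉ U ∧ j = z X + 1
          · exact ⟨X, h.1, by rw [h.2]⟩
          · exfalso
            apply c4 _ hv
            simp only [L', h, if_false]
            exact hA X j
        · exact absurd (hL _) (c4 _ hv)
      let g : (R × Fin 3) ⊕ T → ℕ := fun v => match v with
        | Sum.inl (X, _) => c X
        | Sum.inr _ => 0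
      refine card_le_card_of_injOn g ?_ ?_
      · intro v hv
        obtain ⟨X, hX, rfl⟩ := hS5 v hv
        apply hsub _ hv
        rw [hL'M X hX]
        exact hcM X (mem_compl.2 hX)
      · intro v hv w hw hvw
        obtain ⟨X, hX, rfl⟩ := hS5 v hv
        obtain ⟨Y, hY, rfl⟩ := hS5 w hw
        have : X = Y := hc (by simpa using hX) (by simpa using hY) hvw
        rw [this]
  obtain ⟨f, hf, hfL⟩ := hall_on W L' hall
  have hrep : ∀ v, ∃ w ∈ W, part w = part v ∧ L' w ⊆ L v := by
    intro v
    rcases v with ⟨X, j⟩ | τ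
    · by_cases hX : X ∈ U
      · refine ⟨Sum.inl (X, j), ?_, rfl, ?_⟩
        · simp only [W, mem_filter, mem_univ, true_and]
          intro Y l h
          simp at h
          left; rw [← h.1]; exact hX
        · rw [hL'U X hX]
      · have hMW : Sum.inl (X, z X + 1) ∈ W := by
          simp only [W, mem_filter, mem_univ, true_and]
          intro Y l h
          simp at h
          right; rw [← h.2, ← h.1]; exact hne2 _
        rcases fin3_cases j (z X) with rfl | rfl | rfl
        · refine ⟨Sum.inl (X, z X), ?_, rfl, ?_⟩
          · simp only [W, mem_filter, mem_univ, true_and]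
            intro Y l h
            simp at h
            right; rw [← h.2, ← h.1]
            have : ∀ i : Fin 3, i ≠ i + 2 := by decide
            exact this _
          · rw [hL'z X (z X) (hne1 _)]
        · refine ⟨_, hMW, rfl, ?_⟩
          rw [hL'M X hX]; exact inter_subset_left
        · refine ⟨_, hMW, rfl, ?_⟩
          rw [hL'M X hX]; exact inter_subset_right
    · refine ⟨Sum.inr τ, ?_, rfl, ?_⟩
      · simp [W]
      · rw [hL'T]
  choose rep hrW hrp hrL using hrep
  refine ⟨fun v => f (rep v), fun v => hrL v (hfL _ (hrW v)), fun v w h => ?_⟩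
  have := hf (hrW v) (hrW w) h
  rw [← hrp v, ← hrp w, this]

/-- Reduction to few colours. -/
lemma few_colors {V P : Type} [Fintype V] [DecidableEq V] (p : V → P) (m : ℕ)
    (H : ∀ L : V → Finset ℕ, (∀ v, (L v).card = m) → (univ.biUnion L).card < Fintype.card V →
      ∃ c : V → ℕ, (∀ v, c v ∈ L v) ∧ ∀ v w, c v = c w → p v = p w)
    (L0 : V → Finset ℕ) (hL0 : ∀ v, m ≤ (L0 v).card) :
    ∃ c : V → ℕ, (∀ v, c v ∈ L0 v) ∧ ∀ v w, c v = c w → p v = p w := by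
  have := fun v => exists_subset_card_eq (hL0 v)
  choose L hLsub hL using this
  suffices ∃ c : V → ℕ, (∀ v, c v ∈ L v) ∧ ∀ v w, c v = c w → p v = p w by
    obtain ⟨c, h1, h2⟩ := this
    exact ⟨c, fun v => hLsub v (h1 v), h2⟩
  by_cases hall : ∀ S ⊆ (univ : Finset V), S.card ≤ (S.biUnion L).card
  · obtain ⟨f, hf, hf2⟩ := hall_on univ L hall
    exact ⟨f, fun v => hf2 v (mem_univ _),
      fun v w h => by rw [hf (by simp) (by simp) h]⟩
  push Not at hall
  obtain ⟨S0, _, hS0⟩ := hall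
  obtain ⟨S, hS, hSmax⟩ := exists_max_image
    (univ.filter (fun S : Finset V => (S.biUnion L).card < S.card)) card ⟨S0, by simpa using hS0⟩
  simp only [mem_filter, mem_univ, true_and] at hS hSmax
  have hSne : S.Nonempty := by
    rw [← card_pos]; omega
  obtain ⟨s0, hs0⟩ := hSne
  obtain ⟨f, hf, hf2⟩ := hall_on Sᶜ (fun v => L v \ S.biUnion L) (by
    intro Q hQ
    by_contra hcon
    push Not at hcon
    have hd : Disjoint S Q := by
      rw [disjoint_left]; intro a ha hb; exact (mem_compl.1 (hQ hb)) ha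
    have h1 : ((S ∪ Q).biUnion L) ⊆ S.biUnion L ∪ Q.biUnion (fun v => L v \ S.biUnion L) := by
      intro x hx
      simp only [mem_union, mem_biUnion, mem_sdiff] at hx ⊢
      by_cases h : ∃ a ∈ S, x ∈ L a
      · exact Or.inl h
      · obtain ⟨a, ha | ha, hxa⟩ := hx
        · exact absurd ⟨a, ha, hxa⟩ h
        · exact Or.inr ⟨a, ha, hxa, h⟩
    have h2 := (card_le_card h1).trans (card_union_le _ _)
    have h3 := card_union_of_disjoint hd
    have h4 := hSmax (S ∪ Q) (by omega)
    omega)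
  have hL'sub : ∀ v, (if v ∈ S then L v else L s0) ⊆ S.biUnion L := by
    intro v
    split_ifs with h
    · exact subset_biUnion_of_mem L h
    · exact subset_biUnion_of_mem L hs0
  obtain ⟨c, hc, hc2⟩ := H (fun v => if v ∈ S then L v else L s0)
    (fun v => by split_ifs <;> exact hL _) (by
      have : univ.biUnion (fun v => if v ∈ S then L v else L s0) ⊆ S.biUnion L :=
        biUnion_subset.2 fun v _ => hL'sub v
      have := card_le_card this
      have := card_le_univ S
      omega)
  have hcS : ∀ v, c v ∈ S.biUnion L := fun v => hL'sub v (hc v)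
  have hfS : ∀ v ∉ S, f v ∈ L v ∧ f v ∉ S.biUnion L := fun v hv =>
    mem_sdiff.1 (hf2 v (mem_compl.2 hv))
  refine ⟨fun v => if v ∈ S then c v else f v, fun v => ?_, fun v w h => ?_⟩
  · by_cases hv : v ∈ S
    · have := hc v
      simpa [hv] using this
    · simpa [hv] using (hfS v hv).1
  · by_cases hv : v ∈ S <;> by_cases hw : w ∈ S <;> simp only [hv, hw, if_true, if_false] at h
    · exact hc2 v w h
    · exact absurd (h ▸ hcS v) (hfS w hw).2
    · exact absurd (h ▸ hcS w) (hfS v hv).2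
    · rw [hf (by simpa using hv) (by simpa using hw) h]

lemma upper {T : Type} [Fintype T] [DecidableEq T] (r : ℕ) :
    ∀ (R : Type) [Fintype R] [DecidableEq R], Fintype.card R = r → ∀ (m : ℕ)
    (L : (R × Fin 3) ⊕ T → Finset ℕ), (∀ v, m ≤ (L v).card) → r + Fintype.card T ≤ m →
    4 * r + 2 * Fintype.card T ≤ 3 * m + 1 →
    ∃ c : (R × Fin 3) ⊕ T → ℕ, (∀ v, c v ∈ L v) ∧ ∀ v w, c v = c w → part v = part w := by
  induction r with
  | zero =>
    intro R _ _ hR m L hL hk hm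
    refine few_colors part m ?_ L hL
    intro L hL hC
    have : IsEmpty R := Fintype.card_eq_zero_iff.1 hR
    refine core m L hL (fun X => isEmptyElim X) ?_ (by omega) (by omega)
    simpa [mul_comm] using hC
  | succ r ih =>
    intro R _ _ hR m L hL hk hm
    refine few_colors part m ?_ L hL
    clear hL L
    intro L hL hC
    by_cases htrip : ∀ X c, ¬ (∀ j, c ∈ L (Sum.inl (X, j)))
    · refine core m L hL htrip ?_ (by omega) (by omega)
      simpa [mul_comm] using hC
    push Not at htrip
    obtain ⟨X, d, hd⟩ := htrip
    let e : ({Y : R // Y ≠ X} × Fin 3) ⊕ T → (R × Fin 3) ⊕ T :=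
      Sum.map (Prod.map Subtype.val id) id
    obtain ⟨c, hc, hc2⟩ := ih {Y : R // Y ≠ X} (by
        rw [Fintype.card_subtype_compl]; simp [hR]) (m - 1) (fun v => (L (e v)).erase d)
      (fun v => by have := pred_card_le_card_erase (s := L (e v)) (a := d); rw [hL] at this; exact this)
      (by omega) (by omega)
    have hcd : ∀ v, c v ≠ d := fun v => (mem_erase.1 (hc v)).1
    have hcL : ∀ v, c v ∈ L (e v) := fun v => (mem_erase.1 (hc v)).2
    have hcase : ∀ v, (∃ j, v = Sum.inl (X, j)) ∨ ∃ w, v = e w := by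
      intro v
      rcases v with ⟨Y, j⟩ | τ
      · by_cases h : Y = X
        · left; exact ⟨j, by rw [h]⟩
        · right; exact ⟨Sum.inl (⟨Y, h⟩, j), rfl⟩
      · right; exact ⟨Sum.inr τ, rfl⟩
    have hcol : ∀ v, ∃ x, x ∈ L v ∧ ((part v = Sum.inl X ∧ x = d) ∨
        ∃ w, v = e w ∧ x = c w) := by
      intro v
      rcases hcase v with ⟨j, rfl⟩ | ⟨w, rfl⟩
      · exact ⟨d, hd j, Or.inl ⟨rfl, rfl⟩⟩
      · exact ⟨c w, hcL w, Or.inr ⟨w, rfl, rfl⟩⟩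
    choose C hC1 hC2 using hcol
    refine ⟨C, hC1, fun v w h => ?_⟩
    rcases hC2 v with ⟨h1, h2⟩ | ⟨v', rfl, h2⟩ <;> rcases hC2 w with ⟨h3, h4⟩ | ⟨w', rfl, h4⟩
    · rw [h1, h3]
    · exact absurd (by rw [← h4, ← h, h2]) (hcd w')
    · exact absurd (by rw [← h2, h, h4]) (hcd v')
    · have := hc2 v' w' (by rw [← h2, ← h4, h])
      have hp : ∀ u, part (e u) = Sum.map Subtype.val id (part u) := by
        rintro (⟨Y, j⟩ | τ) <;> rfl
      rw [hp, hp, this]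


/-- Total number of colours used, counted part by part. -/
lemma count_colors {r t : ℕ} (c : (Σ i : Fin (r + t), Fin (if i.val < r then 3 else 1)) → ℕ)
    (hc : ∀ u w, u.1 ≠ w.1 → c u ≠ c w) (N a : ℕ) (hN : ∀ v, c v < N)
    (ha : ∀ i : Fin (r + t), i.val < r → a ≤ (univ.image (fun j => c ⟨i, j⟩)).card) :
    a * r + t ≤ N := by
  let E : Fin (r + t) → Finset ℕ := fun i => univ.image (fun j => c ⟨i, j⟩)
  have h1 : (univ.biUnion E).card = ∑ i, (E i).card := by
    refine card_biUnion ?_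
    intro i _ j _ hij
    rw [Function.onFun, disjoint_left]
    intro x hx hx'
    simp only [E, mem_image, mem_univ, true_and] at hx hx'
    obtain ⟨u, hu⟩ := hx
    obtain ⟨w, hw⟩ := hx'
    exact hc ⟨i, u⟩ ⟨j, w⟩ hij (hu.trans hw.symm)
  have h2 : (univ.biUnion E).card ≤ N := by
    rw [← card_range N]
    refine card_le_card ?_
    intro x hx
    simp only [E, mem_biUnion, mem_image, mem_univ, true_and] at hx
    obtain ⟨i, j, rfl⟩ := hx
    exact mem_range.2 (hN _)
  rw [Fin.sum_univ_add] at h1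
  have h3 : ∑ _i : Fin r, a ≤ ∑ i : Fin r, (E (Fin.castAdd t i)).card :=
    sum_le_sum fun i _ => ha _ (by simp)
  have h4 : ∑ _i : Fin t, 1 ≤ ∑ i : Fin t, (E (Fin.natAdd r i)).card := by
    refine sum_le_sum fun i _ => ?_
    rw [Nat.succ_le_iff, card_pos]
    refine ⟨c ⟨Fin.natAdd r i, ⟨0, by split_ifs <;> omega⟩⟩, ?_⟩
    exact mem_image_of_mem _ (mem_univ _)
  simp at h3 h4
  rw [mul_comm a r]
  omega

/-- The lists of the lower bound construction. -/
def badList (h g : ℕ) : ℕ → Finset ℕ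
  | 0 => range (2 * h)
  | 1 => Ico h (2 * h + g)
  | _ => range h ∪ Ico (2 * h) (2 * h + g)

end Ohba

open Finset in
/-- Ohba: `Ch(K_{3*r,1*t}) = max(r + t, ⌈(4r + 2t − 1)/3⌉)`. -/
theorem choiceNumber_K3xr_1xt (r t : ℕ) (hr : 1 ≤ r) :
    IsLeast {n | Choosable (SimpleGraph.completeMultipartiteGraph
      (fun i : Fin (r + t) => Fin (if i.val < r then 3 else 1))) n}
      (max (r + t) ((4 * r + 2 * t - 1 + 2) / 3)) := by
  constructor
  · intro L0 hL0
    generalize hmm : max (r + t) ((4 * r + 2 * t - 1 + 2) / 3) = m at hL0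
    let ψ : (Fin r × Fin 3) ⊕ Fin t → Σ i : Fin (r + t), Fin (if i.val < r then 3 else 1) :=
      fun v => match v with
      | Sum.inl (X, j) => ⟨Fin.castAdd t X, ⟨j.val, by simp⟩⟩
      | Sum.inr τ => ⟨Fin.natAdd r τ, ⟨0, by simp⟩⟩
    have hψ : ∀ v, (ψ v).1 = Sum.elim (Fin.castAdd t) (Fin.natAdd r) (Ohba.part v) := by
      rintro (⟨X, j⟩ | τ) <;> rfl
    have hsurj : Function.Surjective ψ := by
      rintro ⟨i, j⟩
      induction i using Fin.addCases with
      | left X =>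
        refine ⟨Sum.inl (X, ⟨j.val, lt_of_lt_of_le j.2 (by split_ifs <;> omega)⟩), rfl⟩
      | right τ =>
        refine ⟨Sum.inr τ, ?_⟩
        have h1 : j.val < 1 := lt_of_lt_of_le j.2 (by simp)
        simp only [ψ]
        congr 1
        apply Fin.ext
        show 0 = j.val
        omega
    obtain ⟨c, hc, hc2⟩ := Ohba.upper (T := Fin t) r (Fin r) (by simp) m (fun v => L0 (ψ v))
      (fun v => hL0 _) (by simp; omega) (by simp; omega)
    refine ⟨fun v => c (Function.surjInv hsurj v), fun v => ?_, fun u w huw h => ?_⟩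
    · have := hc (Function.surjInv hsurj v)
      rwa [Function.surjInv_eq hsurj v] at this
    · have h1 := hc2 _ _ h
      have h2 := hψ (Function.surjInv hsurj u)
      have h3 := hψ (Function.surjInv hsurj w)
      rw [Function.surjInv_eq hsurj] at h2 h3
      apply huw
      rw [h2, h3, h1]
  · intro n hn
    have hadj : ∀ u w, u.1 ≠ w.1 → (SimpleGraph.completeMultipartiteGraph
      (fun i : Fin (r + t) => Fin (if i.val < r then 3 else 1))).Adj u w := fun u w h => h
    refine max_le ?_ ?_
    · obtain ⟨c, hc, hc2⟩ := hn (fun _ => range n) (by simp)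
      have := Ohba.count_colors c (fun u w h => hc2 (hadj u w h)) n 1
        (fun v => mem_range.1 (hc v)) (fun i _ => by
          rw [Nat.succ_le_iff, card_pos]
          exact ⟨c ⟨i, ⟨0, by split_ifs <;> omega⟩⟩, mem_image_of_mem _ (mem_univ _)⟩)
      omega
    · obtain ⟨c, hc, hc2⟩ := hn (fun v => Ohba.badList ((n + 1) / 2) (n / 2) v.2.val) (by
        rintro ⟨i, j⟩
        simp only
        match j.val with
        | 0 => simp [Ohba.badList]; omega
        | 1 => simp [Ohba.badList]; omega
        | k + 2 =>
          simp only [Ohba.badList]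
          rw [card_union_of_disjoint]
          · simp; omega
          · rw [disjoint_left]
            intro x hx hx'
            simp at hx hx'
            omega)
      have hlt : ∀ h g k x, x ∈ Ohba.badList h g k → x < 2 * h + g := by
        intro h g k x hx
        match k with
        | 0 => simp [Ohba.badList] at hx; omega
        | 1 => simp [Ohba.badList] at hx; omega
        | k + 2 => simp [Ohba.badList] at hx; omega
      have := Ohba.count_colors c (fun u w h => hc2 (hadj u w h))
        (2 * ((n + 1) / 2) + n / 2) 2 (fun v => hlt _ _ _ _ (hc v)) (fun i hi => by
          by_contra hcon
          have hle : (univ.image (fun j => c ⟨i, j⟩)).card ≤ 1 := by omega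
          rw [card_le_one] at hle
          have e : ∀ j j', c ⟨i, j⟩ = c ⟨i, j'⟩ := fun j j' =>
            hle _ (mem_image_of_mem _ (mem_univ _)) _ (mem_image_of_mem _ (mem_univ _))
          have h0 := hc ⟨i, ⟨0, by simp [hi]⟩⟩
          have h1 := hc ⟨i, ⟨1, by simp [hi]⟩⟩
          have h2 := hc ⟨i, ⟨2, by simp [hi]⟩⟩
          rw [e _ ⟨0, by simp [hi]⟩] at h1 h2
          simp [Ohba.badList] at h0 h1 h2
          omega)
      rcases Nat.even_or_odd' n with ⟨k, hk | hk⟩ <;> omega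
end

section
/- (Gravier, Maffray) For every integer k ≥ 3, the complete k-partite graph K_{3*2,2*(k-2)}, with two parts of size 3 and k−2 parts of size 2, has choice number exactly k. -/
section
open Finset

/-- Proper colouring from lists where vertices in different parts get different colours. -/
def PC {V J : Type} (π : V → J) (L : V → Finset ℕ) : Prop :=
  ∃ c : V → ℕ, (∀ v, c v ∈ L v) ∧ ∀ u w, π u ≠ π w → c u ≠ c w

/-- It suffices to treat list assignments using fewer colours than vertices. -/
lemma PC_reduce {V J : Type} [Fintype V] [DecidableEq V] (π : V → J) (k : ℕ)
    (h : ∀ L : V → Finset ℕ, (∀ v, (L v).card = k) →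
      (univ.biUnion L).card < Fintype.card V → PC π L)
    (L : V → Finset ℕ) (hL : ∀ v, (L v).card = k) : PC π L := by
  by_cases hall : ∀ S : Finset V, S.card ≤ (S.biUnion L).card
  · obtain ⟨f, hf, hm⟩ := (Finset.all_card_le_biUnion_card_iff_exists_injective L).1 hall
    exact ⟨f, hm, fun u w huw e => huw (by rw [hf e])⟩
  push Not at hall
  obtain ⟨S0, hS0⟩ := hall
  obtain ⟨S, hS, hmax⟩ := Finset.exists_max_image
    (univ.filter fun S : Finset V => (S.biUnion L).card < S.card) Finset.card ⟨S0, by simpa using hS0⟩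
  simp only [mem_filter, mem_univ, true_and] at hS hmax
  have hne : S.Nonempty := by
    rw [← Finset.card_pos]; omega
  obtain ⟨v0, hv0⟩ := hne
  have hsub : univ.biUnion (fun v => if v ∈ S then L v else L v0) ⊆ S.biUnion L := by
    intro x hx
    simp only [mem_biUnion, mem_univ, true_and] at hx ⊢
    obtain ⟨v, hv⟩ := hx
    split_ifs at hv with h1
    · exact ⟨v, h1, hv⟩
    · exact ⟨v0, hv0, hv⟩
  obtain ⟨c, hc, hc2⟩ := h (fun v => if v ∈ S then L v else L v0)
    (fun v => by split_ifs <;> exact hL _)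
    (lt_of_le_of_lt (card_le_card hsub) (lt_of_lt_of_le hS (card_le_univ S)))
  have hall2 : ∀ T : Finset {v // v ∉ S},
      T.card ≤ (T.biUnion (fun v => L v.1 \ S.biUnion L)).card := by
    intro T
    set T' : Finset V := T.map (Function.Embedding.subtype _) with hT'
    have hT'c : T'.card = T.card := by simp [hT']
    have hdis : Disjoint S T' := by
      rw [Finset.disjoint_left]
      intro x hx hx'
      simp only [hT', mem_map, Function.Embedding.coe_subtype] at hx'
      obtain ⟨y, _, rfl⟩ := hx'
      exact y.2 hx
    have hU : (S ∪ T').biUnion L = S.biUnion L ∪ T.biUnion (fun v => L v.1 \ S.biUnion L) := by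
      ext x
      simp only [mem_biUnion, mem_union, hT', mem_map, Function.Embedding.coe_subtype, mem_sdiff]
      constructor
      · rintro ⟨v, hv | ⟨w, hw, rfl⟩, hx⟩
        · exact Or.inl ⟨v, hv, hx⟩
        · by_cases hh : ∃ a ∈ S, x ∈ L a
          · exact Or.inl hh
          · exact Or.inr ⟨w, hw, hx, hh⟩
      · rintro (⟨v, hv, hx⟩ | ⟨w, hw, hx, -⟩)
        · exact ⟨v, Or.inl hv, hx⟩
        · exact ⟨w, Or.inr ⟨w, hw, rfl⟩, hx⟩
    have h1 := card_union_of_disjoint hdis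
    have h2 : ((S ∪ T').biUnion L).card ≤ (S.biUnion L).card +
        (T.biUnion (fun v => L v.1 \ S.biUnion L)).card := by
      rw [hU]; exact card_union_le _ _
    by_cases hv : ((S ∪ T').biUnion L).card < (S ∪ T').card
    · have := hmax _ hv
      omega
    · omega
  obtain ⟨g, hg, hgm⟩ := (Finset.all_card_le_biUnion_card_iff_exists_injective _).1 hall2
  have hcS : ∀ v ∈ S, c v ∈ L v := fun v hv => by simpa [hv] using hc v
  have hgS : ∀ v, g v ∈ L v.1 ∧ g v ∉ S.biUnion L := fun v => by
    simpa only [mem_sdiff] using hgm v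
  refine ⟨fun v => if h : v ∈ S then c v else g ⟨v, h⟩, fun v => ?_, fun u w huw => ?_⟩
  · dsimp only
    split_ifs with hv
    · exact hcS v hv
    · exact (hgS _).1
  · dsimp only
    split_ifs with hu hw hw
    · exact hc2 u w huw
    · intro e
      exact (hgS ⟨w, hw⟩).2 (mem_biUnion.2 ⟨u, hu, e ▸ hcS u hu⟩)
    · intro e
      exact (hgS ⟨u, hu⟩).2 (mem_biUnion.2 ⟨w, hw, e ▸ hcS w hw⟩)
    · intro e
      have := hg e
      simp only [Subtype.mk.injEq] at this
      exact huw (by rw [this])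

/-- The Hall step after merging one pair in both triples. -/
lemma merged_sdr {K : Type} [Fintype K] [DecidableEq K] (k : ℕ) (hk : Fintype.card K = k)
    (α β : K) (hαβ : α ≠ β) (M : K × Bool → Finset ℕ)
    (hd : ∀ j, Disjoint (M (j, false)) (M (j, true)))
    (hc : ∀ v, v ≠ (α, false) → v ≠ (β, false) → k ≤ (M v).card)
    (hα : (M (α, false)).Nonempty) (hβ : (M (β, false)).Nonempty)
    (h2 : 2 ≤ (M (α, false) ∪ M (β, false)).card)
    (h4 : k + 2 ≤ (M (α, false) ∪ M (α, true) ∪ (M (β, false) ∪ M (β, true))).card) :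
    ∃ f : K × Bool → ℕ, Function.Injective f ∧ ∀ v, f v ∈ M v := by
  apply (Finset.all_card_le_biUnion_card_iff_exists_injective M).1
  intro S
  have hsub : ∀ v ∈ S, M v ⊆ S.biUnion M := fun v hv => subset_biUnion_of_mem M hv
  have hle : ∀ v ∈ S, (M v).card ≤ (S.biUnion M).card := fun v hv => card_le_card (hsub v hv)
  have hle2 : ∀ j, (j, false) ∈ S → (j, true) ∈ S →
      (M (j, false)).card + (M (j, true)).card ≤ (S.biUnion M).card := by
    intro j h1 h2
    rw [← card_union_of_disjoint (hd j)]
    exact card_le_card (union_subset (hsub _ h1) (hsub _ h2))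
  have hinj : ∀ T : Finset (K × Bool), (∀ j, ¬ ((j, false) ∈ T ∧ (j, true) ∈ T)) → T.card ≤ k := by
    intro T hT
    rw [← hk]
    apply (card_le_card_of_injOn (t := univ) Prod.fst (fun _ _ => mem_coe.2 (mem_univ _)) ?_)
    rintro ⟨a, s⟩ ha ⟨b, t⟩ hb hab
    simp only at hab
    subst hab
    have := hT a
    simp only [mem_coe] at ha hb
    cases s <;> cases t <;> simp_all
  have hα' := card_pos.2 hα
  have hβ' := card_pos.2 hβ
  by_cases hfull : ∃ j, j ≠ α ∧ j ≠ β ∧ (j, false) ∈ S ∧ (j, true) ∈ S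
  · obtain ⟨j, h1, h2, h3, h5⟩ := hfull
    have e1 := hc (j, false) (by simp [h1]) (by simp [h2])
    have e2 := hc (j, true) (by simp) (by simp)
    have e3 := hle2 j h3 h5
    have e4 := card_le_univ S
    simp only [Fintype.card_prod, Fintype.card_bool, hk] at e4
    omega
  have e1 := hc (α, true) (by simp) (by simp)
  have e2 := hc (β, true) (by simp) (by simp)
  by_cases pα : (α, false) ∈ S ∧ (α, true) ∈ S
  · have f1 := hle2 α pα.1 pα.2
    by_cases pβ : (β, false) ∈ S ∧ (β, true) ∈ S
    · have f2 : ((S.erase (α, false)).erase (β, false)).card ≤ k := by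
        apply hinj
        rintro j ⟨h1, h3⟩
        simp only [mem_erase] at h1 h3
        exact hfull ⟨j, by grind, by grind, h1.2.2, h3.2.2⟩
      rw [card_erase_of_mem (by simp [pβ.1, Ne.symm hαβ]), card_erase_of_mem pα.1] at f2
      have f3 : (M (α, false) ∪ M (α, true) ∪ (M (β, false) ∪ M (β, true))).card
          ≤ (S.biUnion M).card :=
        card_le_card (union_subset (union_subset (hsub _ pα.1) (hsub _ pα.2))
          (union_subset (hsub _ pβ.1) (hsub _ pβ.2)))
      omega
    · have f2 : (S.erase (α, false)).card ≤ k := by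
        apply hinj
        rintro j ⟨h1, h3⟩
        simp only [mem_erase] at h1 h3
        exact hfull ⟨j, by grind, by grind, h1.2, h3.2⟩
      rw [card_erase_of_mem pα.1] at f2
      omega
  by_cases pβ : (β, false) ∈ S ∧ (β, true) ∈ S
  · have f1 := hle2 β pβ.1 pβ.2
    have f2 : (S.erase (β, false)).card ≤ k := by
      apply hinj
      rintro j ⟨h1, h3⟩
      simp only [mem_erase] at h1 h3
      exact hfull ⟨j, by grind, by grind, h1.2, h3.2⟩
    rw [card_erase_of_mem pβ.1] at f2
    omega
  have f2 : S.card ≤ k := hinj S (by grind)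
  by_cases hbig : ∃ v ∈ S, v ≠ (α, false) ∧ v ≠ (β, false)
  · obtain ⟨v, hv, h1, h3⟩ := hbig
    have := hc v h1 h3
    have := hle v hv
    omega
  have hS : S ⊆ {(α, false), (β, false)} := by
    intro v hv
    simp only [mem_insert, mem_singleton]
    by_contra hh
    push Not at hh
    exact hbig ⟨v, hv, hh⟩
  by_cases qα : (α, false) ∈ S
  · by_cases qβ : (β, false) ∈ S
    · have g1 := card_le_card hS
      have g2 : (M (α, false) ∪ M (β, false)).card ≤ (S.biUnion M).card :=
        card_le_card (union_subset (hsub _ qα) (hsub _ qβ))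
      have g3 : ({(α, false), (β, false)} : Finset (K × Bool)).card ≤ 2 := card_le_two
      omega
    · have : S ⊆ {(α, false)} := by grind
      have g1 := card_le_card this
      rw [card_singleton] at g1
      have := hle _ qα
      omega
  · have : S ⊆ {(β, false)} := by grind
    have g1 := card_le_card this
    rw [card_singleton] at g1
    by_cases qβ : (β, false) ∈ S
    · have := hle _ qβ
      omega
    · have : S = ∅ := by grind
      simp [this]

/-- The intersection of the two lists of a triple other than the `i`-th one. -/
def XX (A : Fin 3 → Finset ℕ) (i : Fin 3) : Finset ℕ := A (i + 1) ∩ A (i + 2)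

lemma XX_eq (A : Fin 3 → Finset ℕ) (i j l : Fin 3) (h1 : i ≠ j) (h2 : i ≠ l) (h3 : j ≠ l) :
    XX A i = A j ∩ A l := by
  have : (j = i + 1 ∧ l = i + 2) ∨ (l = i + 1 ∧ j = i + 2) := by
    revert i j l; decide
  rcases this with ⟨rfl, rfl⟩ | ⟨rfl, rfl⟩
  · rfl
  · exact inter_comm _ _

lemma fin3_cover (i j l : Fin 3) (h1 : i ≠ j) (h2 : i ≠ l) (h3 : j ≠ l) (x : Fin 3) :
    x = i ∨ x = j ∨ x = l := by
  revert i j l x; decide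

lemma XX_disj (A : Fin 3 → Finset ℕ) (hno : ∀ c, ¬ ∀ i, c ∈ A i) (i : Fin 3) :
    Disjoint (XX A i) (A i) := by
  rw [Finset.disjoint_left]
  intro c hc hc'
  refine hno c fun x => ?_
  simp only [XX, mem_inter] at hc
  have : x = i ∨ x = i + 1 ∨ x = i + 2 := by
    clear hc hc'
    revert i x; decide
  rcases this with rfl | rfl | rfl
  · exact hc'
  · exact hc.1
  · exact hc.2

lemma XX_sum (A : Fin 3 → Finset ℕ) (k : ℕ) (hA : ∀ i, (A i).card = k)
    (hno : ∀ c, ¬ ∀ i, c ∈ A i) :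
    (XX A 0).card + (XX A 1).card + (XX A 2).card + (univ.biUnion A).card = 3 * k := by
  have e : univ.biUnion A = (A 0 ∪ A 1) ∪ A 2 := by
    ext x; simp [Fin.exists_fin_succ]
  have x0 : XX A 0 = A 1 ∩ A 2 := XX_eq A 0 1 2 (by decide) (by decide) (by decide)
  have x1 : XX A 1 = A 0 ∩ A 2 := XX_eq A 1 0 2 (by decide) (by decide) (by decide)
  have x2 : XX A 2 = A 0 ∩ A 1 := XX_eq A 2 0 1 (by decide) (by decide) (by decide)
  have h1 := card_union_add_card_inter (A 0) (A 1)
  have h2 := card_union_add_card_inter (A 0 ∪ A 1) (A 2)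
  have h3 : (A 0 ∪ A 1) ∩ A 2 = XX A 1 ∪ XX A 0 := by
    rw [x0, x1, union_inter_distrib_right]
  have h4 : Disjoint (XX A 1) (XX A 0) := by
    apply (XX_disj A hno 1).mono_right
    rw [x0]; exact inter_subset_left
  rw [h3, card_union_of_disjoint h4] at h2
  rw [e]
  rw [← x2] at h1
  have := hA 0
  have := hA 1
  have := hA 2
  omega

/-- A pair `(i, j)` of merging choices that satisfies the requirements of `merged_sdr`. -/
def Valid (k : ℕ) (A B : Fin 3 → Finset ℕ) (i j : Fin 3) : Prop :=
  (XX A i).Nonempty ∧ (XX B j).Nonempty ∧ 2 ≤ (XX A i ∪ XX B j).card ∧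
    k + 2 ≤ (XX A i ∪ A i ∪ (XX B j ∪ B j)).card

/-- The exceptional configuration. -/
def Special (A B : Fin 3 → Finset ℕ) : Prop :=
  ∃ i1 i2 i3 j1 j2 j3 : Fin 3, i1 ≠ i2 ∧ i1 ≠ i3 ∧ i2 ≠ i3 ∧ j1 ≠ j2 ∧ j1 ≠ j3 ∧ j2 ≠ j3 ∧
    ∃ a b : ℕ, XX A i1 = {a} ∧ XX A i2 = {b} ∧ XX A i3 = ∅ ∧
      XX B j1 = {a} ∧ XX B j2 = {b} ∧ XX B j3 = ∅ ∧
      {a} ∪ A i1 = {b} ∪ B j2 ∧ {b} ∪ A i2 = {a} ∪ B j1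

lemma two_nonempty (A : Fin 3 → Finset ℕ) (h1 : ∀ i, (XX A i).card ≤ 1)
    (h : 2 ≤ (XX A 0).card + (XX A 1).card + (XX A 2).card) :
    ∃ i1 i2 i3 : Fin 3, i1 ≠ i2 ∧ i1 ≠ i3 ∧ i2 ≠ i3 ∧ (XX A i1).card = 1 ∧ (XX A i2).card = 1 ∧
      ((XX A 0).card + (XX A 1).card + (XX A 2).card = 2 + (XX A i3).card) := by
  have a0 := h1 0
  have a1 := h1 1
  have a2 := h1 2
  by_cases c0 : (XX A 0).card = 1
  · by_cases c1 : (XX A 1).card = 1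
    · exact ⟨0, 1, 2, by decide, by decide, by decide, by omega, by omega, by omega⟩
    · exact ⟨0, 2, 1, by decide, by decide, by decide, by omega, by omega, by omega⟩
  · exact ⟨1, 2, 0, by decide, by decide, by decide, by omega, by omega, by omega⟩

lemma XX_inj (A : Fin 3 → Finset ℕ) (hno : ∀ c, ¬ ∀ i, c ∈ A i) (i j : Fin 3)
    (hi : (XX A i).card = 1) (h : XX A i = XX A j) : i = j := by
  by_contra hne
  obtain ⟨c, hc⟩ := card_pos.1 (by omega : 0 < (XX A i).card)
  have d1 := XX_disj A hno i
  rw [Finset.disjoint_left] at d1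
  apply d1 hc
  rw [h] at hc
  have : i = j + 1 ∨ i = j + 2 := by
    clear hi h hc d1
    revert i j; decide
  simp only [XX, mem_inter] at hc
  rcases this with rfl | rfl
  · exact hc.1
  · exact hc.2

lemma UU_card (A : Fin 3 → Finset ℕ) (k : ℕ) (hA : ∀ i, (A i).card = k)
    (hno : ∀ c, ¬ ∀ i, c ∈ A i) (i : Fin 3) : (XX A i ∪ A i).card = (XX A i).card + k := by
  rw [card_union_of_disjoint (XX_disj A hno i), hA]

lemma UU_inj (A : Fin 3 → Finset ℕ) (k : ℕ) (hk : 3 ≤ k) (hA : ∀ i, (A i).card = k)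
    (hno : ∀ c, ¬ ∀ i, c ∈ A i) (h1 : ∀ i, (XX A i).card ≤ 1) (i j : Fin 3)
    (h : XX A i ∪ A i = XX A j ∪ A j) : i = j := by
  by_contra hne
  have hl : ∃ l, l ≠ i ∧ l ≠ j := by
    clear h hne
    revert i j; decide
  obtain ⟨l, hl1, hl2⟩ := hl
  have e := XX_eq A l i j hl1 hl2 hne
  have e1 := h1 l
  rw [e] at e1
  have e2 := card_union_add_card_inter (A i) (A j)
  have e3 : A i ∪ A j ⊆ XX A i ∪ A i :=
    union_subset subset_union_right (h ▸ subset_union_right)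
  have e4 := card_le_card e3
  rw [UU_card A k hA hno] at e4
  have := h1 i
  rw [hA, hA] at e2
  omega

lemma choice_lemma (k : ℕ) (hk : 3 ≤ k) (A B : Fin 3 → Finset ℕ)
    (hA : ∀ i, (A i).card = k) (hB : ∀ i, (B i).card = k)
    (hnA : ∀ c, ¬ ∀ i, c ∈ A i) (hnB : ∀ c, ¬ ∀ i, c ∈ B i)
    (hcA : (univ.biUnion A).card ≤ 2 * k + 1) (hcB : (univ.biUnion B).card ≤ 2 * k + 1) :
    (∃ i j, Valid k A B i j) ∨ (k = 3 ∧ Special A B) := by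
  have sA := XX_sum A k hA hnA
  have sB := XX_sum B k hB hnB
  have exA : ∃ i, (XX A i).Nonempty := by
    by_contra hh
    push Not at hh
    simp [hh] at sA
    omega
  have exB : ∃ i, (XX B i).Nonempty := by
    by_contra hh
    push Not at hh
    simp [hh] at sB
    omega
  by_cases bA : ∃ i, 2 ≤ (XX A i).card
  · obtain ⟨i, hi⟩ := bA
    obtain ⟨j, hj⟩ := exB
    refine Or.inl ⟨i, j, card_pos.1 (by omega), hj, hi.trans (card_le_card subset_union_left), ?_⟩
    have := card_le_card (subset_union_left : XX A i ∪ A i ⊆ XX A i ∪ A i ∪ (XX B j ∪ B j))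
    rw [UU_card A k hA hnA] at this
    omega
  by_cases bB : ∃ i, 2 ≤ (XX B i).card
  · obtain ⟨j, hj⟩ := bB
    obtain ⟨i, hi⟩ := exA
    refine Or.inl ⟨i, j, hi, card_pos.1 (by omega), hj.trans (card_le_card subset_union_right), ?_⟩
    have := card_le_card (subset_union_right : XX B j ∪ B j ⊆ XX A i ∪ A i ∪ (XX B j ∪ B j))
    rw [UU_card B k hB hnB] at this
    omega
  push Not at bA bB
  have bA' : ∀ i, (XX A i).card ≤ 1 := fun i => by have := bA i; omega
  have bB' : ∀ i, (XX B i).card ≤ 1 := fun i => by have := bB i; omega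
  by_cases hv : ∃ i j, Valid k A B i j
  · exact Or.inl hv
  right
  have key : ∀ i j, (XX A i).card = 1 → (XX B j).card = 1 →
      XX A i = XX B j ∨ XX A i ∪ A i = XX B j ∪ B j := by
    intro i j hi hj
    by_contra hh
    push Not at hh
    apply hv
    refine ⟨i, j, card_pos.1 (by omega), card_pos.1 (by omega), ?_, ?_⟩
    · by_contra hlt
      apply hh.1
      have e1 : XX A i = XX A i ∪ XX B j := eq_of_subset_of_card_le subset_union_left (by omega)
      have e2 : XX B j = XX A i ∪ XX B j := eq_of_subset_of_card_le subset_union_right (by omega)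
      exact e1.trans e2.symm
    · by_contra hlt
      apply hh.2
      have u1 := UU_card A k hA hnA i
      have u2 := UU_card B k hB hnB j
      have e1 : XX A i ∪ A i = XX A i ∪ A i ∪ (XX B j ∪ B j) :=
        eq_of_subset_of_card_le subset_union_left (by omega)
      have e2 : XX B j ∪ B j = XX A i ∪ A i ∪ (XX B j ∪ B j) :=
        eq_of_subset_of_card_le subset_union_right (by omega)
      exact e1.trans e2.symm
  have iXA := XX_inj A hnA
  have iXB := XX_inj B hnB
  have iUA := UU_inj A k hk hA hnA bA'
  have iUB := UU_inj B k hk hB hnB bB'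
  obtain ⟨i1, i2, i3, n12, n13, n23, c1, c2, c3⟩ := two_nonempty A bA' (by omega)
  obtain ⟨j1, j2, j3, m12, m13, m23, d1, d2, d3⟩ := two_nonempty B bB' (by omega)
  have z1 : (XX A i3).card ≠ 1 := by
    intro c4
    have k1 := key i1 j1 c1 d1
    have k2 := key i2 j1 c2 d1
    have k3 := key i3 j1 c4 d1
    grind
  have z2 : (XX B j3).card ≠ 1 := by
    intro c4
    have k1 := key i1 j1 c1 d1
    have k2 := key i1 j2 c1 d2
    have k3 := key i1 j3 c1 c4
    grind
  have y1 := bA' i3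
  have y2 := bB' j3
  have w1 : XX A i3 = ∅ := card_eq_zero.1 (by omega)
  have w2 : XX B j3 = ∅ := card_eq_zero.1 (by omega)
  refine ⟨by omega, ?_⟩
  obtain ⟨a, ha⟩ := card_eq_one.1 c1
  obtain ⟨b, hb⟩ := card_eq_one.1 c2
  have k11 := key i1 j1 c1 d1
  have k12 := key i1 j2 c1 d2
  have k21 := key i2 j1 c2 d1
  have k22 := key i2 j2 c2 d2
  by_cases t : XX A i1 = XX B j1
  · have t2 : XX A i1 ≠ XX B j2 := by grind
    have t3 := k12.resolve_left t2
    have t4 : XX A i2 ≠ XX B j1 := by grind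
    have t5 := k21.resolve_left t4
    have t6 : XX A i2 ∪ A i2 ≠ XX B j2 ∪ B j2 := by grind
    have t7 := k22.resolve_right t6
    refine ⟨i1, i2, i3, j1, j2, j3, n12, n13, n23, m12, m13, m23, a, b, ha, hb, w1, ?_, ?_, w2, ?_, ?_⟩
    · rw [← t, ha]
    · rw [← t7, hb]
    · rw [← ha, t3, ← t7, hb]
    · rw [← hb, t5, ← t, ha]
  · have t2 := k11.resolve_left t
    have t3 : XX A i1 ∪ A i1 ≠ XX B j2 ∪ B j2 := by grind
    have t4 := k12.resolve_right t3
    have t5 : XX A i2 ∪ A i2 ≠ XX B j1 ∪ B j1 := by grind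
    have t6 := k21.resolve_right t5
    have t7 : XX A i2 ≠ XX B j2 := by grind
    have t8 := k22.resolve_left t7
    refine ⟨i1, i2, i3, j2, j1, j3, n12, n13, n23, m12.symm, m23, m13, a, b, ha, hb, w1, ?_, ?_, w2, ?_, ?_⟩
    · rw [← t4, ha]
    · rw [← t6, hb]
    · rw [← ha, t2, ← t6, hb]
    · rw [← hb, t8, ← t4, ha]

/-- `K_{2,3}` is 2-choosable. -/
lemma K23 (b : Fin 3 → Finset ℕ) (p q : Finset ℕ) (hb : ∀ i, 2 ≤ (b i).card)
    (hp : 2 ≤ p.card) (hq : 2 ≤ q.card) :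
    ∃ p0 ∈ p, ∃ q0 ∈ q, ∀ i, ∃ x ∈ b i, x ≠ p0 ∧ x ≠ q0 := by
  by_cases hd : Disjoint p q
  · by_contra hcon
    push Not at hcon
    obtain ⟨p', hp', hpc⟩ := exists_subset_card_eq hp
    obtain ⟨q', hq', hqc⟩ := exists_subset_card_eq hq
    have h1 : ∀ x : p' × q', ∃ i, b i = {x.1.1, x.2.1} := by
      rintro ⟨⟨x, hx⟩, ⟨y, hy⟩⟩
      obtain ⟨i, hi⟩ := hcon x (hp' hx) y (hq' hy)
      refine ⟨i, eq_of_subset_of_card_le ?_ (card_le_two.trans (hb i))⟩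
      intro z hz
      have := hi z hz
      simp only [mem_insert, mem_singleton]
      tauto
    choose F hF using h1
    obtain ⟨x, y, hxy, he⟩ := Fintype.exists_ne_map_eq_of_card_lt F (by simp [hpc, hqc])
    have h2 := (hF x).symm.trans ((congrArg b he).trans (hF y))
    obtain ⟨⟨x1, hx1⟩, ⟨x2, hx2⟩⟩ := x
    obtain ⟨⟨y1, hy1⟩, ⟨y2, hy2⟩⟩ := y
    have d1 : ∀ a ∈ p', ∀ b ∈ q', a ≠ b := fun a ha b hb e =>
      Finset.disjoint_left.1 hd (hp' ha) (e ▸ hq' hb)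
    have a1 : x1 ∈ ({y1, y2} : Finset ℕ) := by rw [← h2]; simp
    have a2 : x2 ∈ ({y1, y2} : Finset ℕ) := by rw [← h2]; simp
    simp only [mem_insert, mem_singleton] at a1 a2
    have b1 := d1 x1 hx1 y2 hy2
    have b2 := d1 y1 hy1 x2 hx2
    apply hxy
    simp only [Prod.mk.injEq, Subtype.mk.injEq]
    exact ⟨by tauto, by rcases a2 with h | h; exact absurd h.symm b2; exact h⟩
  · rw [Finset.not_disjoint_iff] at hd
    obtain ⟨c, h1, h2⟩ := hd
    refine ⟨c, h1, c, h2, fun i => ?_⟩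
    obtain ⟨x, hx, hne⟩ := exists_mem_ne (by have := hb i; omega : 1 < (b i).card) c
    exact ⟨x, hx, hne, hne⟩

/-- `K_{3,3}` with lists of sizes 2, 2, 3 on both sides, first subcase. -/
lemma K33_aux (a1 a2 a3 b1 b2 b3 : Finset ℕ) (h1 : a1.card = 2) (h2 : a2.card = 2)
    (h3 : a3.card = 3) (g1 : b1.card = 2) (g2 : b2.card = 2) (g3 : b3.card = 3)
    (hn : ∀ c ∈ a1, c ∈ a2 → c ∉ a3) (hnd : ¬ Disjoint a1 a2) :
    ∃ T : Finset ℕ, (a1 ∩ T).Nonempty ∧ (a2 ∩ T).Nonempty ∧ (a3 ∩ T).Nonempty ∧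
      ¬ b1 ⊆ T ∧ ¬ b2 ⊆ T ∧ ¬ b3 ⊆ T := by
  rw [Finset.not_disjoint_iff] at hnd
  obtain ⟨c, hc1, hc2⟩ := hnd
  have hc3 := hn c hc1 hc2
  have hex : ∃ t ∈ a3, ({c, t} : Finset ℕ) ≠ b1 ∧ ({c, t} : Finset ℕ) ≠ b2 := by
    by_contra hcon
    push Not at hcon
    have : ∀ t : a3, ∃ s : Bool, ({c, t.1} : Finset ℕ) = if s then b1 else b2 := by
      intro t
      by_cases h : ({c, t.1} : Finset ℕ) = b1
      · exact ⟨true, by simpa using h⟩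
      · exact ⟨false, by simpa using hcon t t.2 h⟩
    choose F hF using this
    obtain ⟨x, y, hxy, he⟩ := Fintype.exists_ne_map_eq_of_card_lt F (by simp [h3])
    have e := hF x
    rw [he, ← hF y] at e
    apply hxy
    have hx : x.1 ∈ ({c, y.1} : Finset ℕ) := by rw [← e]; simp
    simp only [mem_insert, mem_singleton] at hx
    rcases hx with hx | hx
    · exact absurd (hx ▸ x.2) hc3
    · exact Subtype.ext hx
  obtain ⟨t, ht, n1, n2⟩ := hex
  have hle : ({c, t} : Finset ℕ).card ≤ 2 := card_le_two
  refine ⟨{c, t}, ⟨c, by simp [hc1]⟩, ⟨c, by simp [hc2]⟩, ⟨t, by simp [ht]⟩, ?_, ?_, ?_⟩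
  · intro h; exact n1 (eq_of_subset_of_card_le h (by omega)).symm
  · intro h; exact n2 (eq_of_subset_of_card_le h (by omega)).symm
  · intro h; have := card_le_card h; omega

lemma K33_aux2 (a1 a2 a3 b1 b2 b3 : Finset ℕ) (h2 : a2.card = 2)
    (g1 : b1.card = 2) (g2 : b2.card = 2) (g3 : b3.card = 3)
    (hnb : Disjoint b1 b2) (c : ℕ) (hc1 : c ∈ a1) (hc3 : c ∈ a3) (hc2 : c ∉ a2) :
    ∃ T : Finset ℕ, (a1 ∩ T).Nonempty ∧ (a2 ∩ T).Nonempty ∧ (a3 ∩ T).Nonempty ∧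
      ¬ b1 ⊆ T ∧ ¬ b2 ⊆ T ∧ ¬ b3 ⊆ T := by
  have hex : ∃ t ∈ a2, ({c, t} : Finset ℕ) ≠ b1 ∧ ({c, t} : Finset ℕ) ≠ b2 := by
    by_contra hcon
    push Not at hcon
    obtain ⟨x, y, hxy, rfl⟩ := card_eq_two.1 h2
    have e1 := hcon x (by simp)
    have e2 := hcon y (by simp)
    have : ({c, x} : Finset ℕ) ≠ {c, y} := by
      intro h
      have hx : x ∈ ({c, y} : Finset ℕ) := by rw [← h]; simp
      simp at hx hc2
      omega
    have hb : ∀ z, z ∈ b1 → z ∉ b2 := fun z h => Finset.disjoint_left.1 hnb h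
    by_cases k1 : ({c, x} : Finset ℕ) = b1
    · have k2 := e2 (fun h => this (k1.trans h.symm))
      exact hb c (by rw [← k1]; simp) (by rw [← k2]; simp)
    · have k2 := e1 k1
      by_cases k3 : ({c, y} : Finset ℕ) = b1
      · exact hb c (by rw [← k3]; simp) (by rw [← k2]; simp)
      · exact this (k2.trans (e2 k3).symm)
  obtain ⟨t, ht, n1, n2⟩ := hex
  have hle : ({c, t} : Finset ℕ).card ≤ 2 := card_le_two
  refine ⟨{c, t}, ⟨c, by simp [hc1]⟩, ⟨t, by simp [ht]⟩, ⟨c, by simp [hc3]⟩, ?_, ?_, ?_⟩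
  · intro h; exact n1 (eq_of_subset_of_card_le h (by omega)).symm
  · intro h; exact n2 (eq_of_subset_of_card_le h (by omega)).symm
  · intro h; have := card_le_card h; omega

lemma K33_aux3 (a1 a2 a3 : Finset ℕ) (b : Fin 3 → Finset ℕ) (h1 : a1.card = 2) (h2 : a2.card = 2)
    (h3 : a3.card = 3) (g1 : (b 0).card = 2) (g2 : (b 1).card = 2) (g3 : (b 2).card = 3)
    (d12 : Disjoint a1 a2) (d13 : Disjoint a1 a3) (d23 : Disjoint a2 a3) :
    ∃ T : Finset ℕ, (a1 ∩ T).Nonempty ∧ (a2 ∩ T).Nonempty ∧ (a3 ∩ T).Nonempty ∧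
      ¬ b 0 ⊆ T ∧ ¬ b 1 ⊆ T ∧ ¬ b 2 ⊆ T := by
  rw [Finset.disjoint_left] at d12 d13 d23
  -- a pair of colours not equal to the trace of any `b i`
  have hex : ∃ x ∈ a1, ∃ y ∈ a2, ∀ i, b i ∩ (a1 ∪ a2) ≠ {x, y} := by
    by_contra hcon
    push Not at hcon
    have : ∀ x : a1 × a2, ∃ i, b i ∩ (a1 ∪ a2) = {x.1.1, x.2.1} :=
      fun x => hcon _ x.1.2 _ x.2.2
    choose F hF using this
    obtain ⟨x, y, hxy, he⟩ := Fintype.exists_ne_map_eq_of_card_lt F (by simp [h1, h2])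
    have e := hF x
    rw [he, hF y] at e
    replace e := e.symm
    obtain ⟨⟨x1, hx1⟩, ⟨x2, hx2⟩⟩ := x
    obtain ⟨⟨y1, hy1⟩, ⟨y2, hy2⟩⟩ := y
    have k1 : x1 ∈ ({y1, y2} : Finset ℕ) := by rw [← e]; simp
    have k2 : x2 ∈ ({y1, y2} : Finset ℕ) := by rw [← e]; simp
    simp only [mem_insert, mem_singleton] at k1 k2
    apply hxy
    simp only [Prod.mk.injEq, Subtype.mk.injEq]
    constructor
    · rcases k1 with h | h
      · exact h
      · exact absurd (h ▸ hx1) (fun hh => d12 hh hy2)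
    · rcases k2 with h | h
      · exact absurd (h ▸ hx2) (d12 hy1)
      · exact h
  obtain ⟨x, hx, y, hy, hxy⟩ := hex
  -- if `b i ⊆ {x, y, t}` then `b i` has two elements and contains `t`
  have hk : ∀ t ∈ a3, ∀ i, b i ⊆ {x, y, t} → t ∈ b i ∧ (b i).card ≤ 2 := by
    intro t ht i hi
    have tx : t ∉ a1 ∪ a2 := by
      simp only [mem_union, not_or]
      exact ⟨fun h => d13 h ht, fun h => d23 h ht⟩
    have e1 : ¬ ({x, y} ⊆ b i) := by
      intro hh
      apply hxy i
      ext z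
      simp only [mem_inter, mem_insert, mem_singleton]
      constructor
      · rintro ⟨hz, hz2⟩
        have := hi hz
        simp only [mem_insert, mem_singleton] at this
        rcases this with h | h | h
        · exact Or.inl h
        · exact Or.inr h
        · exact absurd (h ▸ hz2) tx
      · intro hz
        refine ⟨hh (by simpa using hz), ?_⟩
        rcases hz with rfl | rfl
        · exact mem_union_left _ hx
        · exact mem_union_right _ hy
    have hc : 2 ≤ (b i).card := by
      have : i = 0 ∨ i = 1 ∨ i = 2 := by
        clear hi e1
        revert i; decide
      rcases this with rfl | rfl | rfl <;> omega
    have : ∃ w, (w = x ∨ w = y) ∧ w ∉ b i := by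
      by_contra hcc
      push Not at hcc
      apply e1
      intro z hz
      exact hcc z (by simpa using hz)
    obtain ⟨w, hw, hwb⟩ := this
    have hs : ∃ w', b i ⊆ {w', t} := by
      rcases hw with rfl | rfl
      · refine ⟨y, fun z hz => ?_⟩
        have := hi hz
        simp only [mem_insert, mem_singleton] at this ⊢
        rcases this with h | h | h
        · exact absurd (h ▸ hz) hwb
        · exact Or.inl h
        · exact Or.inr h
      · refine ⟨x, fun z hz => ?_⟩
        have := hi hz
        simp only [mem_insert, mem_singleton] at this ⊢
        rcases this with h | h | h
        · exact Or.inl h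
        · exact absurd (h ▸ hz) hwb
        · exact Or.inr h
    obtain ⟨w', hw'⟩ := hs
    have hle : ({w', t} : Finset ℕ).card ≤ 2 := card_le_two
    have heq := eq_of_subset_of_card_le hw' (by omega)
    exact ⟨by rw [heq]; simp, by rw [heq]; exact hle⟩
  by_contra hcon
  have hall : ∀ t : a3, ∃ s : Bool, (b (if s then 0 else 1)) ⊆ {x, y, t.1} := by
    intro t
    by_contra hh
    push Not at hh
    apply hcon
    refine ⟨{x, y, t.1}, ⟨x, by simp [hx]⟩, ⟨y, by simp [hy]⟩, ⟨t.1, by simp⟩,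
      by simpa using hh true, by simpa using hh false, fun h => ?_⟩
    have := (hk t.1 t.2 2 h).2
    omega
  choose F hF using hall
  obtain ⟨s, t, hst, he⟩ := Fintype.exists_ne_map_eq_of_card_lt F (by simp [h3])
  have m1 := (hk _ s.2 _ (hF s)).1
  rw [he] at m1
  have m2 := hF t m1
  simp only [mem_insert, mem_singleton] at m2
  rcases m2 with h | h | h
  · exact d13 hx (h ▸ s.2)
  · exact d23 hy (h ▸ s.2)
  · exact hst (Subtype.ext h)

lemma K33_core (a b : Fin 3 → Finset ℕ) (h1 : (a 0).card = 2) (h2 : (a 1).card = 2)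
    (h3 : (a 2).card = 3) (g1 : (b 0).card = 2) (g2 : (b 1).card = 2) (g3 : (b 2).card = 3)
    (hna : ∀ c, ¬ ∀ i, c ∈ a i) (hnb : ∀ c, ¬ ∀ i, c ∈ b i) :
    ∃ T : Finset ℕ, (∀ i, ∃ x ∈ a i, x ∈ T) ∧ (∀ i, ∃ x ∈ b i, x ∉ T) := by
  have hna' : ∀ c, c ∈ a 0 → c ∈ a 1 → c ∉ a 2 := by
    intro c c0 c1 c2
    refine hna c fun i => ?_
    fin_cases i <;> assumption
  have hnb' : ∀ c, c ∈ b 0 → c ∈ b 1 → c ∉ b 2 := by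
    intro c c0 c1 c2
    refine hnb c fun i => ?_
    fin_cases i <;> assumption
  by_cases dB : Disjoint (b 0) (b 1)
  · have : ∃ T : Finset ℕ, (a 0 ∩ T).Nonempty ∧ (a 1 ∩ T).Nonempty ∧ (a 2 ∩ T).Nonempty ∧
        ¬ b 0 ⊆ T ∧ ¬ b 1 ⊆ T ∧ ¬ b 2 ⊆ T := by
      by_cases dA : Disjoint (a 0) (a 1)
      · have dA' := Finset.disjoint_left.1 dA
        by_cases d13 : Disjoint (a 0) (a 2)
        · by_cases d23 : Disjoint (a 1) (a 2)
          · exact K33_aux3 _ _ _ b h1 h2 h3 g1 g2 g3 dA d13 d23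
          · obtain ⟨c, hc1, hc3⟩ := Finset.not_disjoint_iff.1 d23
            obtain ⟨T, t1, t2, t3⟩ := K33_aux2 (a 1) (a 0) (a 2) _ _ _ h1 g1 g2 g3 dB c hc1 hc3
              (fun h => dA' h hc1)
            exact ⟨T, t2, t1, t3⟩
        · obtain ⟨c, hc1, hc3⟩ := Finset.not_disjoint_iff.1 d13
          exact K33_aux2 (a 0) (a 1) (a 2) _ _ _ h2 g1 g2 g3 dB c hc1 hc3 (dA' hc1)
      · exact K33_aux _ _ _ _ _ _ h1 h2 h3 g1 g2 g3 hna' dA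
    obtain ⟨T, t0, t1, t2, s0, s1, s2⟩ := this
    refine ⟨T, fun i => ?_, fun i => ?_⟩
    · have : (a i ∩ T).Nonempty := by fin_cases i <;> assumption
      obtain ⟨x, hx⟩ := this
      exact ⟨x, (mem_inter.1 hx).1, (mem_inter.1 hx).2⟩
    · have : ¬ b i ⊆ T := by fin_cases i <;> assumption
      exact not_subset.1 this
  · obtain ⟨T, t0, t1, t2, s0, s1, s2⟩ := K33_aux _ _ _ (a 0) (a 1) (a 2) g1 g2 g3 h1 h2 h3 hnb' dB
    have u0 := not_subset.1 s0
    have u1 := not_subset.1 s1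
    have u2 := not_subset.1 s2
    refine ⟨univ.biUnion a \ T, fun i => ?_, fun i => ?_⟩
    · have : ¬ a i ⊆ T := by fin_cases i <;> assumption
      obtain ⟨x, hx, hxT⟩ := not_subset.1 this
      exact ⟨x, hx, mem_sdiff.2 ⟨mem_biUnion.2 ⟨i, mem_univ _, hx⟩, hxT⟩⟩
    · have : (b i ∩ T).Nonempty := by fin_cases i <;> assumption
      obtain ⟨x, hx⟩ := this
      exact ⟨x, (mem_inter.1 hx).1, fun h => (mem_sdiff.1 h).2 (mem_inter.1 hx).2⟩

lemma shrink_list (a : Fin 3 → Finset ℕ) (i0 : Fin 3) (h : ∀ i, 2 ≤ (a i).card)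
    (h0 : 3 ≤ (a i0).card) :
    ∃ (σ : Equiv.Perm (Fin 3)) (a' : Fin 3 → Finset ℕ), (∀ i, a' i ⊆ a (σ i)) ∧
      (a' 0).card = 2 ∧ (a' 1).card = 2 ∧ (a' 2).card = 3 := by
  obtain ⟨s0, t0, u0⟩ := exists_subset_card_eq (h (Equiv.swap 2 i0 0))
  obtain ⟨s1, t1, u1⟩ := exists_subset_card_eq (h (Equiv.swap 2 i0 1))
  obtain ⟨s2, t2, u2⟩ := exists_subset_card_eq h0
  refine ⟨Equiv.swap 2 i0, ![s0, s1, s2], fun i => ?_, u0, u1, u2⟩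
  fin_cases i
  · exact t0
  · exact t1
  · simpa using t2

lemma K33 (a b : Fin 3 → Finset ℕ) (i0 j0 : Fin 3) (h : ∀ i, 2 ≤ (a i).card)
    (h0 : 3 ≤ (a i0).card) (g : ∀ i, 2 ≤ (b i).card) (g0 : 3 ≤ (b j0).card)
    (hna : ∀ c, ¬ ∀ i, c ∈ a i) (hnb : ∀ c, ¬ ∀ i, c ∈ b i) :
    ∃ T : Finset ℕ, (∀ i, ∃ x ∈ a i, x ∈ T) ∧ (∀ i, ∃ x ∈ b i, x ∉ T) := by
  obtain ⟨σ, a', ha, ha0, ha1, ha2⟩ := shrink_list a i0 h h0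
  obtain ⟨τ, b', hb, hb0, hb1, hb2⟩ := shrink_list b j0 g g0
  obtain ⟨T, t1, t2⟩ := K33_core a' b' ha0 ha1 ha2 hb0 hb1 hb2
    (fun c hc => hna c fun i => by simpa using ha (σ.symm i) (hc _))
    (fun c hc => hnb c fun i => by simpa using hb (τ.symm i) (hc _))
  refine ⟨T, fun i => ?_, fun i => ?_⟩
  · obtain ⟨x, hx, hxT⟩ := t1 (σ.symm i)
    exact ⟨x, by simpa using ha _ hx, hxT⟩
  · obtain ⟨x, hx, hxT⟩ := t2 (τ.symm i)
    exact ⟨x, by simpa using hb _ hx, hxT⟩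

/-- After leaving out `s` and `t`, the two triples can be coloured from disjoint colour sets. -/
def Leave (A1 A2 A3 B1 B2 B3 : Finset ℕ) (s t : ℕ) : Prop :=
  ∃ P Q : Finset ℕ, Disjoint P Q ∧ s ∉ P ∧ s ∉ Q ∧ t ∉ P ∧ t ∉ Q ∧
    (∃ x ∈ A1, x ∈ P) ∧ (∃ x ∈ A2, x ∈ P) ∧ (∃ x ∈ A3, x ∈ P) ∧
    (∃ x ∈ B1, x ∈ Q) ∧ (∃ x ∈ B2, x ∈ Q) ∧ (∃ x ∈ B3, x ∈ Q)

lemma Leave.symm' {A1 A2 A3 B1 B2 B3 : Finset ℕ} {s t : ℕ} (h : Leave A1 A2 A3 B1 B2 B3 s t) :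
    Leave A1 A2 A3 B1 B2 B3 t s := by
  obtain ⟨P, Q, h1, h2, h3, h4, h5, h6⟩ := h
  exact ⟨P, Q, h1, h4, h5, h2, h3, h6⟩

lemma leave_explicit (a b e y y' z z' : ℕ) (hnd : [a, b, e, y, y', z, z'].Nodup)
    (A1 A2 A3 B1 B2 B3 : Finset ℕ)
    (hA1 : A1 = {b, z, z'}) (hA2 : A2 = {a, y, y'}) (hA3 : A3 = {a, b, e})
    (hB1 : B1 = {b, y, y'}) (hB2 : B2 = {a, z, z'}) (hB3 : B3 = {a, b, e}) :
    Leave A1 A2 A3 B1 B2 B3 y z ∧ Leave A1 A2 A3 B1 B2 B3 b z ∧ Leave A1 A2 A3 B1 B2 B3 a z ∧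
    Leave A1 A2 A3 B1 B2 B3 b y ∧ Leave A1 A2 A3 B1 B2 B3 a y := by
  subst hA1 hA2 hA3 hB1 hB2 hB3
  simp only [List.nodup_cons, List.mem_cons, List.not_mem_nil, or_false, not_or,
    not_false_eq_true, List.nodup_nil, and_true] at hnd
  refine ⟨
    ⟨{a, b}, {e, z', y'}, ?_, ?_, ?_, ?_, ?_, ⟨b, ?_, ?_⟩, ⟨a, ?_, ?_⟩, ⟨a, ?_, ?_⟩,
      ⟨y', ?_, ?_⟩, ⟨z', ?_, ?_⟩, ⟨e, ?_, ?_⟩⟩,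
    ⟨{e, y, z'}, {a, y'}, ?_, ?_, ?_, ?_, ?_, ⟨z', ?_, ?_⟩, ⟨y, ?_, ?_⟩, ⟨e, ?_, ?_⟩,
      ⟨y', ?_, ?_⟩, ⟨a, ?_, ?_⟩, ⟨a, ?_, ?_⟩⟩,
    ⟨{b, y}, {e, z', y'}, ?_, ?_, ?_, ?_, ?_, ⟨b, ?_, ?_⟩, ⟨y, ?_, ?_⟩, ⟨b, ?_, ?_⟩,
      ⟨y', ?_, ?_⟩, ⟨z', ?_, ?_⟩, ⟨e, ?_, ?_⟩⟩,
    ⟨{a, z}, {e, y', z'}, ?_, ?_, ?_, ?_, ?_, ⟨z, ?_, ?_⟩, ⟨a, ?_, ?_⟩, ⟨a, ?_, ?_⟩,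
      ⟨y', ?_, ?_⟩, ⟨z', ?_, ?_⟩, ⟨e, ?_, ?_⟩⟩,
    ⟨{e, y', z}, {b, z'}, ?_, ?_, ?_, ?_, ?_, ⟨z, ?_, ?_⟩, ⟨y', ?_, ?_⟩, ⟨e, ?_, ?_⟩,
      ⟨b, ?_, ?_⟩, ⟨z', ?_, ?_⟩, ⟨b, ?_, ?_⟩⟩⟩ <;>
  · simp only [Finset.disjoint_left, mem_insert, mem_singleton]
    clear * - hnd
    grind

lemma special_lemma (A1 A2 A3 B1 B2 B3 p q C : Finset ℕ) (a b : ℕ)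
    (cA1 : A1.card = 3) (cA2 : A2.card = 3) (cA3 : A3.card = 3)
    (cB3 : B3.card = 3)
    (cp : p.card = 3) (cq : q.card = 3)
    (a23 : A2 ∩ A3 = {a}) (a13 : A1 ∩ A3 = {b}) (a12 : A1 ∩ A2 = ∅)
    (b23 : B2 ∩ B3 = {a}) (b13 : B1 ∩ B3 = {b}) (b12 : B1 ∩ B2 = ∅)
    (u1 : {a} ∪ A1 = {b} ∪ B2) (u2 : {b} ∪ A2 = {a} ∪ B1)
    (hC : C.card ≤ 7) (sA1 : A1 ⊆ C) (sA2 : A2 ⊆ C) (sA3 : A3 ⊆ C)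
    (sB3 : B3 ⊆ C) (sp : p ⊆ C) (sq : q ⊆ C) (hpq : Disjoint p q) :
    ∃ s ∈ p, ∃ t ∈ q, Leave A1 A2 A3 B1 B2 B3 s t := by
  simp only [Finset.ext_iff, mem_inter, mem_singleton, mem_union, notMem_empty, iff_false]
    at a23 a13 a12 b23 b13 b12 u1 u2
  have ha2 : a ∈ A2 := ((a23 a).2 rfl).1
  have ha3 : a ∈ A3 := ((a23 a).2 rfl).2
  have hb1 : b ∈ A1 := ((a13 b).2 rfl).1
  have hb3 : b ∈ A3 := ((a13 b).2 rfl).2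
  have hab : a ≠ b := by grind
  obtain ⟨z, z', hzz, hZ⟩ := card_eq_two.1 (by rw [card_erase_of_mem hb1, cA1] : (A1.erase b).card = 2)
  obtain ⟨y, y', hyy, hY⟩ := card_eq_two.1 (by rw [card_erase_of_mem ha2, cA2] : (A2.erase a).card = 2)
  obtain ⟨e, he⟩ := card_eq_one.1 (by
    rw [card_erase_of_mem (by simp [hb3, hab.symm]), card_erase_of_mem ha3, cA3] :
      ((A3.erase a).erase b).card = 1)
  have hA1 : A1 = {b, z, z'} := by rw [← hZ, insert_erase hb1]
  have hA2 : A2 = {a, y, y'} := by rw [← hY, insert_erase ha2]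
  have hA3 : A3 = {a, b, e} := by
    rw [← he, insert_erase (by simp [hb3, hab.symm]), insert_erase ha3]
  have mz : z ≠ b ∧ z ∈ A1 := by rw [← mem_erase, hZ]; simp
  have mz' : z' ≠ b ∧ z' ∈ A1 := by rw [← mem_erase, hZ]; simp
  have my : y ≠ a ∧ y ∈ A2 := by rw [← mem_erase, hY]; simp
  have my' : y' ≠ a ∧ y' ∈ A2 := by rw [← mem_erase, hY]; simp
  have me : e ≠ b ∧ e ≠ a ∧ e ∈ A3 := by rw [← mem_erase, ← mem_erase, he]; simp
  have hnd : [a, b, e, y, y', z, z'].Nodup := by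
    simp only [List.nodup_cons, List.mem_cons, List.not_mem_nil, or_false, not_or,
      not_false_eq_true, List.nodup_nil, and_true]
    grind
  have hCC : C = {a, b, e, y, y', z, z'} := by
    symm
    apply eq_of_subset_of_card_le
    · intro x hx
      simp only [mem_insert, mem_singleton] at hx
      rcases hx with rfl | rfl | rfl | rfl | rfl | rfl | rfl
      · exact sA2 ha2
      · exact sA1 hb1
      · exact sA3 me.2.2
      · exact sA2 my.2
      · exact sA2 my'.2
      · exact sA1 mz.2
      · exact sA1 mz'.2
    · have : ({a, b, e, y, y', z, z'} : Finset ℕ) = [a, b, e, y, y', z, z'].toFinset := by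
        ext; simp
      rw [this, List.toFinset_card_of_nodup hnd]
      exact hC
  have hB2 : B2 = {a, z, z'} := by
    ext x
    have := u1 x
    have := b23 x
    have := b13 x
    have := b12 x
    simp only [mem_insert, mem_singleton]
    grind
  have hB1 : B1 = {b, y, y'} := by
    ext x
    have := u2 x
    have := b23 x
    have := b13 x
    have := b12 x
    simp only [mem_insert, mem_singleton]
    grind
  have hB3 : B3 = {a, b, e} := by
    apply eq_of_subset_of_card_le
    · intro x hx
      have h1 := sB3 hx
      rw [hCC] at h1
      have := b23 x
      have := b13 x
      simp only [mem_insert, mem_singleton] at h1 ⊢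
      grind
    · rw [← hA3, cA3, cB3]
  clear a23 a13 a12 b23 b13 b12 u1 u2 hZ hY he
  have L1 := leave_explicit a b e y y' z z' hnd A1 A2 A3 B1 B2 B3 hA1 hA2 hA3 hB1 hB2 hB3
  have pz : ({b, z, z'} : Finset ℕ) = {b, z', z} := by rw [pair_comm z z']
  have pz2 : ({a, z, z'} : Finset ℕ) = {a, z', z} := by rw [pair_comm z z']
  have py : ({a, y, y'} : Finset ℕ) = {a, y', y} := by rw [pair_comm y y']
  have py2 : ({b, y, y'} : Finset ℕ) = {b, y', y} := by rw [pair_comm y y']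
  have sw1 : [a, b, e, y', y, z, z'].Nodup := by
    clear * - hnd
    simp only [List.nodup_cons, List.mem_cons, List.not_mem_nil, or_false, not_or,
      not_false_eq_true, List.nodup_nil, and_true] at hnd ⊢
    grind
  have sw2 : [a, b, e, y, y', z', z].Nodup := by
    clear * - hnd
    simp only [List.nodup_cons, List.mem_cons, List.not_mem_nil, or_false, not_or,
      not_false_eq_true, List.nodup_nil, and_true] at hnd ⊢
    grind
  have sw3 : [a, b, e, y', y, z', z].Nodup := by
    clear * - hnd
    simp only [List.nodup_cons, List.mem_cons, List.not_mem_nil, or_false, not_or,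
      not_false_eq_true, List.nodup_nil, and_true] at hnd ⊢
    grind
  have L2 := leave_explicit a b e y' y z z' sw1 A1 A2 A3 B1 B2 B3 hA1 (hA2.trans py) hA3
    (hB1.trans py2) hB2 hB3
  have L3 := leave_explicit a b e y y' z' z sw2 A1 A2 A3 B1 B2 B3 (hA1.trans pz) hA2 hA3
    hB1 (hB2.trans pz2) hB3
  have L4 := leave_explicit a b e y' y z' z sw3 A1 A2 A3 B1 B2 B3 (hA1.trans pz)
    (hA2.trans py) hA3 (hB1.trans py2) (hB2.trans pz2) hB3
  -- classes of colours
  let cls : ℕ → Finset ℕ := fun x =>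
    if x = a ∨ x = b then {a, b} else if x = y ∨ x = y' then {y, y'} else {z, z'}
  have hcls : ∀ x, (cls x).card ≤ 2 := by
    intro x
    simp only [cls]
    split_ifs <;> exact card_le_two
  have hmem : ∀ x ∈ C, x ≠ e → x ∈ cls x := by
    intro x hx hxe
    rw [hCC] at hx
    simp only [mem_insert, mem_singleton] at hx
    simp only [cls]
    split_ifs <;> simp only [mem_insert, mem_singleton] <;> tauto
  have hex : ∃ s ∈ p.erase e, ∃ t ∈ q.erase e, cls s ≠ cls t := by
    by_contra hcon
    push Not at hcon
    have c1 : 2 ≤ (p.erase e).card := by have := pred_card_le_card_erase (s := p) (a := e); omega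
    have c2 : 2 ≤ (q.erase e).card := by have := pred_card_le_card_erase (s := q) (a := e); omega
    obtain ⟨s0, hs0⟩ := card_pos.1 (by omega : 0 < (p.erase e).card)
    obtain ⟨t0, ht0⟩ := card_pos.1 (by omega : 0 < (q.erase e).card)
    have hsub : p.erase e ∪ q.erase e ⊆ cls s0 := by
      intro x hx
      rcases mem_union.1 hx with h | h
      · rw [hcon s0 hs0 t0 ht0, ← hcon x h t0 ht0]
        exact hmem x (sp (mem_of_mem_erase h)) (ne_of_mem_erase h)
      · rw [hcon s0 hs0 x h]
        exact hmem x (sq (mem_of_mem_erase h)) (ne_of_mem_erase h)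
    have h1 := card_le_card hsub
    rw [card_union_of_disjoint
      (hpq.mono (erase_subset _ _) (erase_subset _ _))] at h1
    have := hcls s0
    omega
  obtain ⟨s, hs, t, ht, hst⟩ := hex
  refine ⟨s, mem_of_mem_erase hs, t, mem_of_mem_erase ht, ?_⟩
  have s1 := sp (mem_of_mem_erase hs)
  have s2 := ne_of_mem_erase hs
  have t1 := sq (mem_of_mem_erase ht)
  have t2 := ne_of_mem_erase ht
  rw [hCC] at s1 t1
  simp only [mem_insert, mem_singleton] at s1 t1
  obtain ⟨l1, l2, l3, l4, l5⟩ := L1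
  obtain ⟨m1, m2, m3, m4, m5⟩ := L2
  obtain ⟨n1, n2, n3, n4, n5⟩ := L3
  obtain ⟨o1, o2, o3, o4, o5⟩ := L4
  simp only [List.nodup_cons, List.mem_cons, List.not_mem_nil, or_false, not_or,
    not_false_eq_true, List.nodup_nil, and_true] at hnd
  have ka : cls a = {a, b} := by simp [cls]
  have kb : cls b = {a, b} := by simp [cls]
  have ky : cls y = {y, y'} := by
    have c1 : ¬ (y = a ∨ y = b) := by clear * - hnd; grind
    simp [cls, c1]
  have ky' : cls y' = {y, y'} := by
    have c1 : ¬ (y' = a ∨ y' = b) := by clear * - hnd; grind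
    simp [cls, c1]
  have kz : cls z = {z, z'} := by
    have c1 : ¬ (z = a ∨ z = b) := by clear * - hnd; grind
    have c2 : ¬ (z = y ∨ z = y') := by clear * - hnd; grind
    simp only [cls, c1, c2, if_false]
  have kz' : cls z' = {z, z'} := by
    have c1 : ¬ (z' = a ∨ z' = b) := by clear * - hnd; grind
    have c2 : ¬ (z' = y ∨ z' = y') := by clear * - hnd; grind
    simp only [cls, c1, c2, if_false]
  clear_value cls
  rcases s1 with h | h | h | h | h | h | h <;>
  rcases t1 with h' | h' | h' | h' | h' | h' | h' <;>
  first
  | exact absurd h s2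
  | exact absurd h' t2
  | (rw [h, h']; assumption)
  | (rw [h, h']; apply Leave.symm'; assumption)
  | (exact absurd (by simp only [h, h', ka, kb, ky, ky', kz, kz']) hst)

/-- Vertices: two triples, and a pair for each element of `ι`. -/
abbrev VV (ι : Type) : Type := (Bool × Fin 3) ⊕ (ι × Bool)

/-- The part of a vertex. -/
def pp {ι : Type} : VV ι → Bool ⊕ ι := Sum.map Prod.fst Prod.fst

lemma PC_mk {ι : Type} (L : VV ι → Finset ℕ) (f : Bool → Fin 3 → ℕ) (g : ι → Bool → ℕ)
    (hf : ∀ s i, f s i ∈ L (Sum.inl (s, i))) (hg : ∀ j t, g j t ∈ L (Sum.inr (j, t)))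
    (h1 : ∀ i i', f true i ≠ f false i') (h2 : ∀ s i j t, f s i ≠ g j t)
    (h3 : ∀ j j' t t', j ≠ j' → g j t ≠ g j' t') : PC pp L := by
  refine ⟨Sum.elim (fun x => f x.1 x.2) (fun x => g x.1 x.2), ?_, ?_⟩
  · rintro (⟨s, i⟩ | ⟨j, t⟩)
    · exact hf s i
    · exact hg j t
  · rintro (⟨s, i⟩ | ⟨j, t⟩) (⟨s', i'⟩ | ⟨j', t'⟩) h
    · simp only [pp, Sum.map_inl, ne_eq, Sum.inl.injEq] at h
      cases s <;> cases s'
      · exact absurd rfl h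
      · exact (h1 i' i).symm
      · exact h1 i i'
      · exact absurd rfl h
    · exact h2 s i j' t'
    · exact (h2 s' i' j t).symm
    · simp only [pp, Sum.map_inr, ne_eq, Sum.inr.injEq] at h
      exact h3 j j' t t' h

lemma PC_extend {V J V' J' : Type} {π : V → J} {π' : V' → J'} (L : V → Finset ℕ) (c : ℕ)
    (R : V → Prop) (hR : ∀ v, R v → c ∈ L v) (hR2 : ∀ u v, R u → R v → π u = π v)
    (φ : V' → V) (ψ : V → V') (hφ : ∀ v, ¬ R v → φ (ψ v) = v)
    (hπ : ∀ u w, ¬ R u → ¬ R w → π u ≠ π w → π' (ψ u) ≠ π' (ψ w))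
    (h : PC π' (fun v' => (L (φ v')).erase c)) : PC π L := by
  classical
  obtain ⟨d, hd, hd2⟩ := h
  have hd' : ∀ v, ¬ R v → d (ψ v) ≠ c ∧ d (ψ v) ∈ L v := by
    intro v hv
    have this : d (ψ v) ∈ (L (φ (ψ v))).erase c := hd (ψ v)
    rw [hφ v hv] at this
    exact mem_erase.1 this
  refine ⟨fun v => if R v then c else d (ψ v), fun v => ?_, fun u w huw => ?_⟩
  · dsimp only
    split_ifs with hv
    · exact hR v hv
    · exact (hd' v hv).2
  · dsimp only
    split_ifs with hu hw hw
    · exact absurd (hR2 u w hu hw) huw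
    · exact (hd' w hw).1.symm
    · exact (hd' u hu).1
    · exact hd2 _ _ (hπ u w hu hw huw)

/-- The induction hypothesis for `n` pairs. -/
def IH (n : ℕ) : Prop := ∀ (ι : Type) [Fintype ι] [DecidableEq ι], Fintype.card ι = n →
  ∀ L : VV ι → Finset ℕ, (∀ v, n + 2 ≤ (L v).card) → PC pp L

lemma step_pair {ι : Type} [Fintype ι] [DecidableEq ι] (n : ℕ) (hn : Fintype.card ι = n + 1)
    (ih : IH n) (L : VV ι → Finset ℕ) (hL : ∀ v, (L v).card = n + 3)
    (j0 : ι) (c : ℕ) (hc : ∀ t, c ∈ L (Sum.inr (j0, t))) : PC pp L := by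
  refine PC_extend (π' := (pp : VV {j // j ≠ j0} → _)) L c (fun v => ∃ t, v = Sum.inr (j0, t))
    ?_ ?_ (Sum.map id (Prod.map Subtype.val id))
    (Sum.elim (fun x => Sum.inl x) (fun x => if h : x.1 ≠ j0 then Sum.inr (⟨x.1, h⟩, x.2)
      else Sum.inl (true, 0))) ?_ ?_ ?_
  · rintro v ⟨t, rfl⟩
    exact hc t
  · rintro u v ⟨t, rfl⟩ ⟨t', rfl⟩
    rfl
  · rintro (⟨s, i⟩ | ⟨j, t⟩) hv
    · rfl
    · have hj : j ≠ j0 := by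
        rintro rfl
        exact hv ⟨t, rfl⟩
      simp [hj]
  · rintro (⟨s, i⟩ | ⟨j, t⟩) (⟨s', i'⟩ | ⟨j', t'⟩) hu hw h
    · exact fun e => h (by simpa [pp] using e)
    · have hj : j' ≠ j0 := by
        rintro rfl
        exact hw ⟨t', rfl⟩
      simp [pp, hj]
    · have hj : j ≠ j0 := by
        rintro rfl
        exact hu ⟨t, rfl⟩
      simp [pp, hj]
    · have hj : j ≠ j0 := by
        rintro rfl
        exact hu ⟨t, rfl⟩
      have hj' : j' ≠ j0 := by
        rintro rfl
        exact hw ⟨t', rfl⟩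
      exact fun e => h (by simpa [pp, hj, hj'] using e)
  · apply ih
    · rw [Fintype.card_subtype_compl, Fintype.card_subtype_eq]
      omega
    · intro v
      have := pred_card_le_card_erase (s := L (Sum.map id (Prod.map Subtype.val id) v)) (a := c)
      rw [hL] at this
      omega

lemma step_triple {ι : Type} [Fintype ι] [DecidableEq ι] (n : ℕ) (hn : Fintype.card ι = n + 1)
    (ih : IH n) (L : VV ι → Finset ℕ) (hL : ∀ v, (L v).card = n + 3)
    (s0 : Bool) (c : ℕ) (hc : ∀ i, c ∈ L (Sum.inl (s0, i))) : PC pp L := by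
  have hne : Nonempty ι := Fintype.card_pos_iff.1 (by omega)
  obtain ⟨j0⟩ := hne
  refine PC_extend (π' := (pp : VV {j // j ≠ j0} → _)) L c (fun v => ∃ i, v = Sum.inl (s0, i))
    ?_ ?_
    (Sum.elim (fun x => if x.1 = s0 then Sum.inr (j0, decide (x.2 ≠ 0)) else Sum.inl x)
      (fun x => Sum.inr (x.1.1, x.2)))
    (Sum.elim (fun x => Sum.inl x) (fun x => if h : x.1 ≠ j0 then Sum.inr (⟨x.1, h⟩, x.2)
      else Sum.inl (s0, if x.2 then 1 else 0))) ?_ ?_ ?_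
  · rintro v ⟨t, rfl⟩
    exact hc t
  · rintro u v ⟨t, rfl⟩ ⟨t', rfl⟩
    rfl
  · rintro (⟨s, i⟩ | ⟨j, t⟩) hv
    · have hs : s ≠ s0 := by
        rintro rfl
        exact hv ⟨i, rfl⟩
      simp [hs]
    · by_cases hj : j = j0
      · subst hj
        cases t <;> simp
      · simp [hj]
  · have key : ∀ (s : Bool) (i : Fin 3), (¬ ∃ i', (Sum.inl (s, i) : VV ι) = Sum.inl (s0, i')) →
        s ≠ s0 := by
      rintro s i h rfl
      exact h ⟨i, rfl⟩
    rintro (⟨s, i⟩ | ⟨j, t⟩) (⟨s', i'⟩ | ⟨j', t'⟩) hu hw h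
    · exact fun e => h (by simpa [pp] using e)
    · have hs := key s i hu
      by_cases hj : j' = j0
      · simpa [pp, hj] using hs
      · simp [pp, hj]
    · have hs := key s' i' hw
      by_cases hj : j = j0
      · simpa [pp, hj] using hs.symm
      · simp [pp, hj]
    · have hjj : j ≠ j' := by
        rintro rfl
        exact h rfl
      by_cases hj : j = j0 <;> by_cases hj' : j' = j0
      · exact absurd (hj.trans hj'.symm) hjj
      · simp [pp, hj, hj']
      · simp [pp, hj, hj']
      · simp [pp, hj, hj', hjj]
  · apply ih
    · rw [Fintype.card_subtype_compl, Fintype.card_subtype_eq]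
      omega
    · intro v
      have := pred_card_le_card_erase (s := L (Sum.elim
        (fun x => if x.1 = s0 then Sum.inr (j0, decide (x.2 ≠ 0)) else Sum.inl x)
        (fun x => Sum.inr (x.1.1, x.2)) v)) (a := c)
      rw [hL] at this
      omega

/-- With one pair: colour the two triples from disjoint sets. -/
lemma PC_one {ι : Type} (d : ι) (hd : ∀ j, j = d) (L : VV ι → Finset ℕ) (T : Bool → Finset ℕ)
    (r : Bool → ℕ) (hr : ∀ t, r t ∈ L (Sum.inr (d, t)))
    (hT : ∀ s i, ∃ x ∈ L (Sum.inl (s, i)), x ∈ T s) (hdis : Disjoint (T true) (T false))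
    (hrT : ∀ s t, r t ∉ T s) : PC pp L := by
  choose f hf hfT using hT
  refine PC_mk L f (fun _ => r) hf ?_ ?_ ?_ ?_
  · intro j t
    rw [hd j]
    exact hr t
  · intro i i' e
    exact Finset.disjoint_left.1 hdis (hfT true i) (e ▸ hfT false i')
  · intro s i j t e
    exact hrT s t (e ▸ hfT s i)
  · intro j j' _ _ h
    exact absurd ((hd j).trans (hd j').symm) h

lemma one_triple {ι : Type} (d : ι) (hd : ∀ j, j = d) (L : VV ι → Finset ℕ)
    (hL : ∀ v, (L v).card = 3) (s0 : Bool) (c : ℕ) (hc : ∀ i, c ∈ L (Sum.inl (s0, i))) :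
    PC pp L := by
  have he : ∀ v, 2 ≤ ((L v).erase c).card := by
    intro v
    have := pred_card_le_card_erase (s := L v) (a := c)
    rw [hL] at this
    omega
  obtain ⟨p0, hp, q0, hq, h⟩ := K23 (fun i => (L (Sum.inl (!s0, i))).erase c)
    ((L (Sum.inr (d, true))).erase c) ((L (Sum.inr (d, false))).erase c)
    (fun i => he _) (he _) (he _)
  choose x hx hx2 using h
  rw [mem_erase] at hp hq
  have hx' : ∀ i, x i ≠ c ∧ x i ∈ L (Sum.inl (!s0, i)) := fun i => mem_erase.1 (hx i)
  refine PC_one d hd L (fun s => if s = s0 then {c} else univ.image x)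
    (fun t => if t then p0 else q0) ?_ ?_ ?_ ?_
  · intro t
    cases t
    · exact hq.2
    · exact hp.2
  · intro s i
    by_cases hs : s = s0
    · subst hs
      exact ⟨c, hc i, by simp⟩
    · have hs' : s = !s0 := by cases s <;> cases s0 <;> simp_all
      subst hs'
      exact ⟨x i, (hx' i).2, by simp⟩
  · cases s0 <;> simp [fun i => (hx' i).1]
  · intro s t
    by_cases hs : s = s0
    · cases t <;> simp [hs, hp.1, hq.1]
    · cases t
      · simpa [hs] using fun i => (hx2 i).2
      · simpa [hs] using fun i => (hx2 i).1

lemma one_pair {ι : Type} (d : ι) (hd : ∀ j, j = d) (L : VV ι → Finset ℕ)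
    (hL : ∀ v, (L v).card = 3) (hno : ∀ s c, ¬ ∀ i, c ∈ L (Sum.inl (s, i)))
    (c : ℕ) (hc : ∀ t, c ∈ L (Sum.inr (d, t))) : PC pp L := by
  have he : ∀ v, 2 ≤ ((L v).erase c).card := by
    intro v
    have := pred_card_le_card_erase (s := L v) (a := c)
    rw [hL] at this
    omega
  have h3 : ∀ s, ∃ i, 3 ≤ ((L (Sum.inl (s, i))).erase c).card := by
    intro s
    have := hno s c
    push Not at this
    obtain ⟨i, hi⟩ := this
    exact ⟨i, by rw [erase_eq_of_notMem hi, hL]⟩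
  obtain ⟨i0, hi0⟩ := h3 true
  obtain ⟨j0, hj0⟩ := h3 false
  obtain ⟨T, t1, t2⟩ := K33 (fun i => (L (Sum.inl (true, i))).erase c)
    (fun i => (L (Sum.inl (false, i))).erase c) i0 j0 (fun _ => he _) hi0 (fun _ => he _) hj0
    (fun x hx => hno true x fun i => mem_of_mem_erase (hx i))
    (fun x hx => hno false x fun i => mem_of_mem_erase (hx i))
  choose x hx hxT using t1
  choose y hy hyT using t2
  have hx' : ∀ i, x i ≠ c ∧ x i ∈ L (Sum.inl (true, i)) := fun i => mem_erase.1 (hx i)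
  have hy' : ∀ i, y i ≠ c ∧ y i ∈ L (Sum.inl (false, i)) := fun i => mem_erase.1 (hy i)
  refine PC_one d hd L (fun s => if s then univ.image x else univ.image y) (fun _ => c) hc ?_ ?_ ?_
  · intro s i
    cases s
    · exact ⟨y i, (hy' i).2, by simp⟩
    · exact ⟨x i, (hx' i).2, by simp⟩
  · rw [Finset.disjoint_left]
    intro a ha hb
    simp only [if_true, mem_image, mem_univ, true_and, Bool.false_eq_true, if_false] at ha hb
    obtain ⟨i, rfl⟩ := ha
    obtain ⟨j, hj⟩ := hb
    exact hyT j (hj ▸ hxT i)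
  · intro s t
    cases s
    · simpa using fun i => (hy' i).1
    · simpa using fun i => (hx' i).1

lemma XX_mem_other (A : Fin 3 → Finset ℕ) (i x : Fin 3) (c : ℕ) (hc : c ∈ XX A i) (hx : x ≠ i) :
    c ∈ A x := by
  have : x = i + 1 ∨ x = i + 2 := by
    clear hc
    revert i x
    decide
  simp only [XX, mem_inter] at hc
  rcases this with rfl | rfl
  · exact hc.1
  · exact hc.2

lemma from_valid {ι : Type} [Fintype ι] [DecidableEq ι] (k : ℕ) (hk : Fintype.card ι + 2 = k)
    (L : VV ι → Finset ℕ) (hL : ∀ v, (L v).card = k)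
    (hno : ∀ s c, ¬ ∀ i, c ∈ L (Sum.inl (s, i)))
    (hd : ∀ j, Disjoint (L (Sum.inr (j, false))) (L (Sum.inr (j, true)))) (i j : Fin 3)
    (hv : Valid k (fun i => L (Sum.inl (true, i))) (fun i => L (Sum.inl (false, i))) i j) :
    PC pp L := by
  obtain ⟨v1, v2, v3, v4⟩ := hv
  set A : Fin 3 → Finset ℕ := fun i => L (Sum.inl (true, i)) with hA
  set B : Fin 3 → Finset ℕ := fun i => L (Sum.inl (false, i)) with hB
  let M : (ι ⊕ Bool) × Bool → Finset ℕ := fun x => match x with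
    | (Sum.inl j, t) => L (Sum.inr (j, t))
    | (Sum.inr true, false) => XX A i
    | (Sum.inr true, true) => A i
    | (Sum.inr false, false) => XX B j
    | (Sum.inr false, true) => B j
  obtain ⟨f, hf, hm⟩ := merged_sdr (K := ι ⊕ Bool) k (by simp [hk]) (Sum.inr true) (Sum.inr false)
    (by simp) M
    (by
      rintro (x | (_ | _))
      · exact hd x
      · exact XX_disj B (hno false) j
      · exact XX_disj A (hno true) i)
    (by
      rintro ⟨(x | (_ | _)), (_ | _)⟩ h1 h2
      · exact (hL _).ge
      · exact (hL _).ge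
      · exact absurd rfl h2
      · exact (hL _).ge
      · exact absurd rfl h1
      · exact (hL _).ge) v1 v2 v3 v4
  have m1 : f (Sum.inr true, false) ∈ XX A i := hm (Sum.inr true, false)
  have m2 : f (Sum.inr true, true) ∈ A i := hm (Sum.inr true, true)
  have m3 : f (Sum.inr false, false) ∈ XX B j := hm (Sum.inr false, false)
  have m4 : f (Sum.inr false, true) ∈ B j := hm (Sum.inr false, true)
  refine PC_mk L (fun s x => f (Sum.inr s, decide (x = if s then i else j)))
    (fun j t => f (Sum.inl j, t)) ?_ ?_ ?_ ?_ ?_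
  · intro s x
    cases s
    · by_cases hx : x = j
      · simpa [hx] using m4
      · simpa [hx] using XX_mem_other B j x _ m3 hx
    · by_cases hx : x = i
      · simpa [hx] using m2
      · simpa [hx] using XX_mem_other A i x _ m1 hx
  · intro j t
    exact hm (Sum.inl j, t)
  · intro x x' e
    simpa using hf e
  · intro s x j t e
    simpa using hf e
  · intro j j' t t' h e
    have := hf e
    simp only [Prod.mk.injEq, Sum.inl.injEq] at this
    exact h this.1

lemma from_special {ι : Type} [Fintype ι] [DecidableEq ι] (d : ι) (hd1 : ∀ j, j = d)
    (L : VV ι → Finset ℕ) (hL : ∀ v, (L v).card = 3)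
    (hd : ∀ j, Disjoint (L (Sum.inr (j, false))) (L (Sum.inr (j, true))))
    (hC : (univ.biUnion L).card ≤ 7)
    (hv : Special (fun i => L (Sum.inl (true, i))) (fun i => L (Sum.inl (false, i)))) :
    PC pp L := by
  obtain ⟨i1, i2, i3, j1, j2, j3, n12, n13, n23, m12, m13, m23, a, b, x1, x2, x3, y1, y2, y3,
    u1, u2⟩ := hv
  rw [XX_eq _ i1 i2 i3 n12 n13 n23] at x1
  rw [XX_eq _ i2 i1 i3 n12.symm n23 n13] at x2
  rw [XX_eq _ i3 i1 i2 n13.symm n23.symm n12] at x3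
  rw [XX_eq _ j1 j2 j3 m12 m13 m23] at y1
  rw [XX_eq _ j2 j1 j3 m12.symm m23 m13] at y2
  rw [XX_eq _ j3 j1 j2 m13.symm m23.symm m12] at y3
  have hs : ∀ v, L v ⊆ univ.biUnion L := fun v => subset_biUnion_of_mem L (mem_univ v)
  obtain ⟨s, hs1, t, ht1, P, Q, hPQ, k1, k2, k3, k4, p1, p2, p3, q1, q2, q3⟩ :=
    special_lemma _ _ _ _ _ _ (L (Sum.inr (d, false))) (L (Sum.inr (d, true)))
    (univ.biUnion L) a b (hL _) (hL _) (hL _) (hL _) (hL _) (hL _) x1 x2 x3 y1 y2 y3 u1 u2 hC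
    (hs _) (hs _) (hs _) (hs _) (hs _) (hs _) (hd d)
  refine PC_one d hd1 L (fun s => if s then P else Q) (fun r => if r then t else s) ?_ ?_ ?_ ?_
  · intro r
    cases r
    · exact hs1
    · exact ht1
  · intro r i
    cases r
    · rcases fin3_cover j1 j2 j3 m12 m13 m23 i with rfl | rfl | rfl
      · exact q1
      · exact q2
      · exact q3
    · rcases fin3_cover i1 i2 i3 n12 n13 n23 i with rfl | rfl | rfl
      · exact p1
      · exact p2
      · exact p3
  · exact hPQ
  · intro s t
    cases s <;> cases t <;> assumption

lemma main_step {ι : Type} [Fintype ι] [DecidableEq ι] (n : ℕ) (hn : Fintype.card ι = n + 1)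
    (ih : n ≠ 0 → IH n) (L : VV ι → Finset ℕ) (hL : ∀ v, (L v).card = n + 3)
    (hC : (univ.biUnion L).card < Fintype.card (VV ι)) : PC pp L := by
  have hcard : Fintype.card (VV ι) = 2 * (n + 3) + 2 := by
    simp [hn]; ring
  rw [hcard] at hC
  by_cases hno : ∀ s c, ¬ ∀ i, c ∈ L (Sum.inl (s, i))
  swap
  · push Not at hno
    obtain ⟨s0, c, hc⟩ := hno
    by_cases h0 : n = 0
    · subst h0
      obtain ⟨d, hd⟩ := Fintype.card_eq_one_iff.1 hn
      exact one_triple d hd L hL s0 c hc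
    · exact step_triple n hn (ih h0) L hL s0 c hc
  by_cases hd : ∀ j, Disjoint (L (Sum.inr (j, false))) (L (Sum.inr (j, true)))
  swap
  · push Not at hd
    obtain ⟨j0, hj⟩ := hd
    obtain ⟨c, c1, c2⟩ := Finset.not_disjoint_iff.1 hj
    have hc : ∀ t, c ∈ L (Sum.inr (j0, t)) := by
      intro t
      cases t <;> assumption
    by_cases h0 : n = 0
    · subst h0
      obtain ⟨d, hd⟩ := Fintype.card_eq_one_iff.1 hn
      exact one_pair d hd L hL hno c (hd j0 ▸ hc)
    · exact step_pair n hn (ih h0) L hL j0 c hc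
  have hsub : ∀ s, (univ.biUnion (fun i => L (Sum.inl (s, i)))).card ≤ 2 * (n + 3) + 1 := by
    intro s
    have : univ.biUnion (fun i => L (Sum.inl (s, i))) ⊆ univ.biUnion L := by
      intro x hx
      simp only [mem_biUnion, mem_univ, true_and] at hx ⊢
      obtain ⟨i, hi⟩ := hx
      exact ⟨_, hi⟩
    have := card_le_card this
    omega
  rcases choice_lemma (n + 3) (by omega) (fun i => L (Sum.inl (true, i)))
    (fun i => L (Sum.inl (false, i))) (fun _ => hL _) (fun _ => hL _) (hno true) (hno false)
    (hsub true) (hsub false) with ⟨i, j, hv⟩ | ⟨h3, hs⟩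
  · exact from_valid (n + 3) (by omega) L hL hno hd i j hv
  · have h0 : n = 0 := by omega
    subst h0
    obtain ⟨d, hd1⟩ := Fintype.card_eq_one_iff.1 hn
    exact from_special d hd1 L hL hd (by omega) hs

lemma main_all (n : ℕ) : IH (n + 1) := by
  induction n with
  | zero =>
    intro ι _ _ hn L hL
    choose L' hL' hc using fun v => exists_subset_card_eq (hL v)
    obtain ⟨c, h1, h2⟩ := PC_reduce pp 3
      (fun L hL hC => main_step 0 hn (fun h => absurd rfl h) L hL hC) L' hc
    exact ⟨c, fun v => hL' v (h1 v), h2⟩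
  | succ n ih =>
    intro ι _ _ hn L hL
    choose L' hL' hc using fun v => exists_subset_card_eq (hL v)
    obtain ⟨c, h1, h2⟩ := PC_reduce pp (n + 1 + 3)
      (fun L hL hC => main_step (n + 1) hn (fun _ => ih) L hL hC) L' hc
    exact ⟨c, fun v => hL' v (h1 v), h2⟩

lemma choosable_upper (m : ℕ) (hm : 1 ≤ m) : Choosable (SimpleGraph.completeMultipartiteGraph
      (fun i : Fin (m + 2) => Fin (if i.val < 2 then 3 else 2))) (m + 2) := by
  intro L hL
  obtain ⟨n, rfl⟩ : ∃ n, m = n + 1 := ⟨m - 1, by omega⟩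
  -- the map from the abstract vertex set to the given one
  let φ : VV (Fin (n + 1)) → (Σ i : Fin (n + 1 + 2), Fin (if i.val < 2 then 3 else 2)) :=
    Sum.elim (fun x => ⟨⟨if x.1 then 0 else 1, by split_ifs <;> omega⟩,
        Fin.cast (by cases x.1 <;> simp) x.2⟩)
      (fun x => ⟨⟨x.1.val + 2, by omega⟩, Fin.cast (by simp) (if x.2 then (1 : Fin 2) else 0)⟩)
  obtain ⟨c, h1, h2⟩ := main_all n (Fin (n + 1)) (by simp) (fun v => L (φ v)) (fun v => hL _)
  have hsurj : ∀ v, ∃ w, φ w = v ∧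
      (v.1.val = Sum.elim (fun s : Bool => if s then 0 else 1) (fun j => j.val + 2) (pp w)) := by
    rintro ⟨⟨i, hi⟩, x⟩
    rcases i with _ | _ | i
    · refine ⟨Sum.inl (true, Fin.cast (by simp) x), ?_, by simp [pp]⟩
      rfl
    · refine ⟨Sum.inl (false, Fin.cast (by simp) x), ?_, by simp [pp]⟩
      rfl
    · refine ⟨Sum.inr (⟨i, by omega⟩, decide (x.val = 1)), ?_, by simp [pp]⟩
      have hx : x.val < 2 := by
        have := x.2
        simpa using this
      simp only [φ, Sum.elim_inr, Sigma.mk.injEq, heq_eq_eq, true_and]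
      apply Fin.ext
      have hx' : x.val = 0 ∨ x.val = 1 := by omega
      rcases hx' with h | h <;> simp [Fin.ext_iff, h]
  choose ψ hψ hψ2 using hsurj
  refine ⟨fun v => c (ψ v), fun v => ?_, fun u w huw => ?_⟩
  · have this : c (ψ v) ∈ L (φ (ψ v)) := h1 (ψ v)
    rw [hψ v] at this
    exact this
  · apply h2
    intro e
    have a1 := hψ2 u
    have a2 := hψ2 w
    rw [e, ← a2] at a1
    simp only [SimpleGraph.completeMultipartiteGraph, SimpleGraph.comap_adj, SimpleGraph.top_adj] at huw
    exact huw (Fin.ext a1)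

end

/-- Gravier–Maffray: `Ch(K_{3*2,2*(k-2)}) = k` for `k ≥ 3`. -/
theorem choiceNumber_K3x2_2xk2 (k : ℕ) (hk : 3 ≤ k) :
    IsLeast {n | Choosable (SimpleGraph.completeMultipartiteGraph
      (fun i : Fin k => Fin (if i.val < 2 then 3 else 2))) n} k := by
  constructor
  · obtain ⟨m, rfl⟩ : ∃ m, k = m + 2 := ⟨k - 2, by omega⟩
    exact choosable_upper m (by omega)
  · intro n hn
    obtain ⟨c, h1, h2⟩ := hn (fun _ => Finset.range n) (fun _ => by simp)
    let g : Fin k → Fin n := fun i =>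
      ⟨c ⟨i, ⟨0, by split_ifs <;> omega⟩⟩, Finset.mem_range.1 (h1 _)⟩
    have hg : Function.Injective g := by
      intro i j hij
      by_contra hne
      refine h2 (u := ⟨i, ⟨0, by split_ifs <;> omega⟩⟩) (w := ⟨j, ⟨0, by split_ifs <;> omega⟩⟩) ?_ ?_
      · simpa [SimpleGraph.completeMultipartiteGraph] using hne
      · simpa [g] using hij
    simpa using Fintype.card_le_of_injective g hg
end

section
/- (Enomoto, Ohba, Ota, Sakamoto) Let k, m, s be integers with s ≥ 0, k ≥ s + 1, m ≥ 1, and m ≤ 2s + 1. Then the complete k-partite graph K_{m,2*(k-s-1),1*s}, with one part of size m, k−s−1 parts of size 2, and s parts of size 1, has choice number exactly k. -/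
open Finset

/-- Kierstead's reduction: it suffices to consider lists with fewer colors than vertices. -/
lemma kierstead_reduction {V : Type} [Fintype V] [DecidableEq V] (G : SimpleGraph V) (k : ℕ)
    (L : V → Finset ℕ) (hL : ∀ v, k ≤ (L v).card)
    (H : ∀ L' : V → Finset ℕ, (∀ v, k ≤ (L' v).card) →
      (univ.biUnion L').card < Fintype.card V → ListColorable G L') : ListColorable G L := by
  obtain ⟨S, -, hS⟩ := Finset.exists_max_image (univ : Finset (Finset V))
    (fun S => (S.card : ℤ) - (S.biUnion L).card) ⟨∅, mem_univ _⟩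
  by_cases hpos : (S.card : ℤ) - (S.biUnion L).card ≤ 0
  · have hall : ∀ X : Finset V, X.card ≤ (X.biUnion L).card := by
      intro X
      have := hS X (mem_univ _)
      omega
    obtain ⟨f, hf, hfL⟩ := (Finset.all_card_le_biUnion_card_iff_exists_injective L).1 hall
    exact ⟨f, hfL, fun u w huw h => huw.ne (hf h)⟩
  · push Not at hpos
    have hne : S.Nonempty := by
      rw [Finset.nonempty_iff_ne_empty]
      rintro rfl
      simp at hpos
    obtain ⟨u0, hu0⟩ := hne
    have hcol := H (fun v => if v ∈ S then L v else L u0)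
      (by intro v; split_ifs <;> exact hL _)
      (by
        have hsub : univ.biUnion (fun v => if v ∈ S then L v else L u0) ⊆ S.biUnion L := by
          intro x hx
          simp only [mem_biUnion, mem_univ, true_and] at hx
          obtain ⟨v, hv⟩ := hx
          split_ifs at hv with h
          · exact mem_biUnion.2 ⟨v, h, hv⟩
          · exact mem_biUnion.2 ⟨u0, hu0, hv⟩
        have h1 := Finset.card_le_card hsub
        have h2 := Finset.card_le_univ S
        omega)
    obtain ⟨c, hc, hcG⟩ := hcol
    have hall : ∀ X : Finset {v // v ∉ S},
        X.card ≤ (X.biUnion (fun v => L v.1 \ S.biUnion L)).card := by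
      intro X
      have h1 := hS (S ∪ X.map (Function.Embedding.subtype _)) (mem_univ _)
      have hd : Disjoint S (X.map (Function.Embedding.subtype _)) := by
        rw [Finset.disjoint_left]
        intro a ha hb
        simp at hb
        obtain ⟨h, _⟩ := hb
        exact h ha
      rw [Finset.card_union_of_disjoint hd, Finset.card_map] at h1
      have hsub : (S ∪ X.map (Function.Embedding.subtype _)).biUnion L ⊆
          S.biUnion L ∪ X.biUnion (fun v => L v.1 \ S.biUnion L) := by
        intro x hx
        by_cases hxS : x ∈ S.biUnion L
        · exact mem_union_left _ hxS
        · apply mem_union_right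
          obtain ⟨v, hv, hxv⟩ := mem_biUnion.1 hx
          rcases mem_union.1 hv with h | h
          · exact absurd (mem_biUnion.2 ⟨v, h, hxv⟩) hxS
          · obtain ⟨w, hw, rfl⟩ := mem_map.1 h
            exact mem_biUnion.2 ⟨w, hw, mem_sdiff.2 ⟨hxv, hxS⟩⟩
      have h2 := Finset.card_le_card hsub
      have h3 := Finset.card_union_le (S.biUnion L) (X.biUnion (fun v => L v.1 \ S.biUnion L))
      push_cast at h1
      omega
    obtain ⟨g, hg, hgL⟩ := (Finset.all_card_le_biUnion_card_iff_exists_injective _).1 hall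
    have hcS : ∀ v, v ∈ S → c v ∈ L v := by
      intro v hv
      have := hc v
      simpa [hv] using this
    refine ⟨fun v => if h : v ∈ S then c v else g ⟨v, h⟩, ?_, ?_⟩
    · intro v
      dsimp only
      split_ifs with h
      · exact hcS v h
      · exact (mem_sdiff.1 (hgL ⟨v, h⟩)).1
    · intro u w huw
      dsimp only
      split_ifs with h1 h2 h2
      · exact hcG huw
      · intro h
        exact (mem_sdiff.1 (hgL ⟨w, h2⟩)).2 (h ▸ mem_biUnion.2 ⟨u, h1, hcS u h1⟩)
      · intro h
        exact (mem_sdiff.1 (hgL ⟨u, h1⟩)).2 (h ▸ mem_biUnion.2 ⟨w, h2, hcS w h2⟩)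
      · intro h
        have := hg h
        simp at this
        exact huw.ne this

/-- Hall's condition for the vertices of `W`, after the colors in `C` have been removed. -/
def HallOn {V : Type} (W : Finset V) (L : V → Finset ℕ) (C : Finset ℕ) : Prop :=
  ∀ S : Finset V, S ⊆ W → S.card ≤ (S.biUnion L \ C).card

/-- The standing assumptions on the set `W` (all vertices outside the large part): sets of size
larger than `k - 1` see at least `2k` colors. -/
def WideOn {V : Type} (W : Finset V) (L : V → Finset ℕ) (k : ℕ) : Prop :=
  ∀ S : Finset V, S ⊆ W → S.card + 1 ≤ k ∨ 2 * k ≤ (S.biUnion L).card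

lemma hallOn_singleton {V : Type} (W : Finset V) (L : V → Finset ℕ) (k s c : ℕ)
    (hL : ∀ v, k ≤ (L v).card) (hW : W.card + s + 2 ≤ 2 * k) (hwide : WideOn W L k) :
    HallOn W L {c} := by
  intro S hS
  have h0 := Finset.le_card_sdiff {c} (S.biUnion L)
  have h1 := Finset.card_le_card hS
  rw [Finset.card_singleton] at h0
  rcases hwide S hS with h | h
  · rcases S.eq_empty_or_nonempty with rfl | ⟨v, hv⟩
    · simp
    · have h2 := Finset.card_le_card (Finset.subset_biUnion_of_mem L hv)
      have := hL v
      omega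
  · omega

lemma hall_step {V : Type} [DecidableEq V] (W : Finset V) (L : V → Finset ℕ) (k s : ℕ)
    (hW : W.card + s + 2 ≤ 2 * k) (hwide : WideOn W L k) (C : Finset ℕ)
    (hC : HallOn W L C) (hCs : C.card ≤ s + 1) :
    ∃ T : Finset ℕ, T ⊆ W.biUnion L ∧ T.card + 1 ≤ k ∧
      ∀ x, x ∉ T → HallOn W L (insert x C) := by
  obtain ⟨S, hS, hmax⟩ := Finset.exists_max_image
    (W.powerset.filter (fun S => S.card = (S.biUnion L \ C).card)) Finset.card
    ⟨∅, by simp⟩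
  simp only [mem_filter, mem_powerset] at hS hmax
  obtain ⟨hSW, hSt⟩ := hS
  refine ⟨S.biUnion L \ C, ?_, ?_, ?_⟩
  · exact Finset.sdiff_subset.trans (Finset.biUnion_subset_biUnion_of_subset_left _ hSW)
  · rw [← hSt]
    rcases hwide S hSW with h | h
    · exact h
    · have h0 := Finset.le_card_sdiff C (S.biUnion L)
      have h1 := Finset.card_le_card hSW
      omega
  · intro x hx S' hS'
    by_contra hlt
    push Not at hlt
    have hHall := hC S' hS'
    have hins : S'.biUnion L \ insert x C = (S'.biUnion L \ C).erase x := by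
      ext y; simp; tauto
    rw [hins] at hlt
    have hxm : x ∈ S'.biUnion L \ C := by
      by_contra hxm
      rw [Finset.erase_eq_of_notMem hxm] at hlt
      omega
    rw [Finset.card_erase_of_mem hxm] at hlt
    have hSt' : S'.card = (S'.biUnion L \ C).card := by omega
    have hU := hC (S ∪ S') (union_subset hSW hS')
    have hI := hC (S ∩ S') (inter_subset_left.trans hSW)
    have e1 : (S ∪ S').biUnion L \ C = (S.biUnion L \ C) ∪ (S'.biUnion L \ C) := by
      rw [Finset.union_biUnion, Finset.union_sdiff_distrib]
    have e2 : (S ∩ S').biUnion L \ C ⊆ (S.biUnion L \ C) ∩ (S'.biUnion L \ C) := by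
      intro y hy
      simp only [mem_sdiff, mem_biUnion, mem_inter] at hy ⊢
      obtain ⟨⟨v, ⟨h1, h2⟩, h3⟩, h4⟩ := hy
      exact ⟨⟨⟨v, h1, h3⟩, h4⟩, ⟨v, h2, h3⟩, h4⟩
    have h2 := Finset.card_le_card e2
    have h3 := Finset.card_union_add_card_inter (S.biUnion L \ C) (S'.biUnion L \ C)
    have h4 := Finset.card_union_add_card_inter S S'
    rw [← e1] at h3
    have h5 : (S ∪ S').card ≤ S.card := hmax _ ⟨union_subset hSW hS', by omega⟩
    have h6 : S = S ∪ S' := Finset.eq_of_subset_of_card_le subset_union_left h5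
    apply hx
    have h7 : S' ⊆ S := by rw [h6]; exact subset_union_right
    rw [mem_sdiff] at hxm ⊢
    exact ⟨Finset.biUnion_subset_biUnion_of_subset_left _ h7 hxm.1, hxm.2⟩

/-- The vertices of `A` whose list is not yet hit by `C`. -/
def unhit {V : Type} (A : Finset V) (L : V → Finset ℕ) (C : Finset ℕ) : Finset V :=
  A.filter (fun a => Disjoint (L a) C)

lemma unhit_insert {V : Type} [DecidableEq V] (A : Finset V) (L : V → Finset ℕ) (C : Finset ℕ)
    (x : ℕ) : (unhit A L (insert x C)).card + ((unhit A L C).filter (fun a => x ∈ L a)).card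
      = (unhit A L C).card := by
  have : unhit A L (insert x C) = (unhit A L C).filter (fun a => ¬ x ∈ L a) := by
    ext a
    simp only [unhit, mem_filter, Finset.disjoint_insert_right]
    tauto
  rw [this, add_comm]
  exact Finset.card_filter_add_card_filter_not _

lemma finish_hit {V : Type} [DecidableEq V] (W A : Finset V) (L : V → Finset ℕ) (k s : ℕ)
    (hL : ∀ v, k ≤ (L v).card)
    (hW : W.card + s + 2 ≤ 2 * k) (hk : 1 ≤ k) (hwide : WideOn W L k) (n : ℕ) :
    ∀ C : Finset ℕ, HallOn W L C → (unhit A L C).card ≤ n → C.card + n ≤ s + 2 →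
      ∃ C', HallOn W L C' ∧ unhit A L C' = ∅ := by
  induction n with
  | zero =>
    intro C hC h0 _
    exact ⟨C, hC, by simpa using h0⟩
  | succ n ih =>
    intro C hC hn hs
    rcases (unhit A L C).eq_empty_or_nonempty with h | ⟨a, ha⟩
    · exact ⟨C, hC, h⟩
    · obtain ⟨T, -, hT, hx⟩ := hall_step W L k s hW hwide C hC (by omega)
      obtain ⟨x, hxa, hxT⟩ : ∃ x ∈ L a, x ∉ T := by
        apply Finset.exists_mem_notMem_of_card_lt_card
        have := hL a
        omega
      have h1 := unhit_insert A L C x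
      have h2 : 0 < ((unhit A L C).filter (fun a => x ∈ L a)).card :=
        Finset.card_pos.2 ⟨a, mem_filter.2 ⟨ha, hxa⟩⟩
      have h3 := Finset.card_insert_le x C
      exact ih (insert x C) (hx x hxT) (by omega) (by omega)

lemma loop_hit {V : Type} [DecidableEq V] (W A : Finset V) (L : V → Finset ℕ) (k s h : ℕ)
    (U : Finset ℕ) (hLU : ∀ v, L v ⊆ U) (hU : U.card + 2 ≤ 2 * k + s) (hks : s + 1 ≤ k)
    (hL : ∀ v, k ≤ (L v).card)
    (hW : W.card + s + 2 ≤ 2 * k) (hwide : WideOn W L k)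
    (hh1 : 1 ≤ h) (hh : ∀ x, (A.filter (fun a => x ∈ L a)).card ≤ h) (n : ℕ) :
    ∀ C : Finset ℕ, HallOn W L C → 1 ≤ C.card → (unhit A L C).card ≤ n →
      (unhit A L C).card + h + 2 * C.card ≤ 2 * s + 3 →
      ∃ C', HallOn W L C' ∧ unhit A L C' = ∅ := by
  induction n with
  | zero =>
    intro C hC _ h0 _
    exact ⟨C, hC, by simpa using h0⟩
  | succ n ih =>
    intro C hC hC1 hn hs
    by_cases hfin : C.card + (unhit A L C).card ≤ s + 2
    · exact finish_hit W A L k s hL hW (by omega) hwide _ C hC le_rfl hfin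
    push Not at hfin
    obtain ⟨T, hTU, hT, hx⟩ := hall_step W L k s hW hwide C hC (by omega)
    by_cases hex : ∃ x, x ∉ T ∧ 2 ≤ ((unhit A L C).filter (fun a => x ∈ L a)).card
    · obtain ⟨x, hxT, hx2⟩ := hex
      have h1 := unhit_insert A L C x
      have h3 := Finset.card_insert_le x C
      have h4 := Finset.card_le_card (Finset.subset_insert x C)
      exact ih (insert x C) (hx x hxT) (by omega) (by omega) (by omega)
    · exfalso
      push Not at hex
      set R := unhit A L C with hR
      have hTU' : T ⊆ U := hTU.trans (Finset.biUnion_subset.2 fun v _ => hLU v)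
      have hcount : ∀ x, (R.filter (fun a => x ∈ L a)).card ≤ R.card - 2 := by
        intro x
        have h1 : (R.filter (fun a => x ∈ L a)).card ≤ (A.filter (fun a => x ∈ L a)).card :=
          Finset.card_le_card (Finset.filter_subset_filter _ (Finset.filter_subset _ _))
        have h2 := hh x
        omega
      have hdc : ∑ a ∈ R, (L a).card = ∑ x ∈ U, (R.filter (fun a => x ∈ L a)).card := by
        have := Finset.sum_card_bipartiteAbove_eq_sum_card_bipartiteBelow
          (s := R) (t := U) (fun a x => x ∈ L a)
        rw [← Finset.sum_congr rfl fun x _ => rfl] at this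
        simp only [Finset.bipartiteAbove, Finset.bipartiteBelow] at this
        rw [← this]
        apply Finset.sum_congr rfl
        intro a _
        congr 1
        ext x
        simp only [mem_filter]
        exact ⟨fun h => ⟨hLU a h, h⟩, fun h => h.2⟩
      have hlow : R.card * k ≤ ∑ a ∈ R, (L a).card := by
        have := Finset.card_nsmul_le_sum R (fun a => (L a).card) k (fun a _ => hL a)
        simpa using this
      rw [← Finset.sum_sdiff hTU'] at hdc
      have hb1 : ∑ x ∈ U \ T, (R.filter (fun a => x ∈ L a)).card ≤ (U \ T).card * 1 := by
        have := Finset.sum_le_card_nsmul (U \ T) (fun x => (R.filter (fun a => x ∈ L a)).card) 1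
          (fun x hx => Nat.le_of_lt_succ (hex x (mem_sdiff.1 hx).2))
        simpa using this
      have hb2 : ∑ x ∈ T, (R.filter (fun a => x ∈ L a)).card ≤ T.card * (R.card - 2) := by
        have := Finset.sum_le_card_nsmul T (fun x => (R.filter (fun a => x ∈ L a)).card)
          (R.card - 2) (fun x _ => hcount x)
        simpa using this
      have hc := Finset.card_sdiff_add_card_eq_card hTU'
      have hr3 : 3 ≤ R.card := by omega
      obtain ⟨r, hr⟩ := Nat.exists_eq_add_of_le hr3
      have hr2 : R.card - 2 = r + 1 := by omega
      rw [hr2] at hb2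
      rw [hr] at hlow
      obtain ⟨k', rfl⟩ : ∃ k', k = k' + 1 := ⟨k - 1, by omega⟩
      have hTr : T.card * r ≤ k' * r := Nat.mul_le_mul_right _ (by omega)
      nlinarith

/-- The coloring statement when parts of size two have disjoint lists. -/
lemma disjoint_case {V : Type} [Fintype V] [DecidableEq V] (pt : V → ℕ) (i0 k s : ℕ)
    (h1 : ((univ.filter (fun v => pt v ≠ i0)).image pt).card + 1 = k)
    (h3 : (univ.filter (fun v => pt v ≠ i0)).card + s + 2 ≤ 2 * k)
    (h4 : (univ.filter (fun v => pt v = i0)).card ≤ 2 * s + 1)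
    (L : V → Finset ℕ) (hL : ∀ v, k ≤ (L v).card)
    (hU : (univ.biUnion L).card < Fintype.card V)
    (hdisj : ∀ u v, pt u ≠ i0 → pt u = pt v → u ≠ v → Disjoint (L u) (L v)) :
    ∃ c : V → ℕ, (∀ v, c v ∈ L v) ∧ ∀ u w, pt u ≠ pt w → c u ≠ c w := by
  set W := univ.filter (fun v => pt v ≠ i0) with hWdef
  set A := univ.filter (fun v => pt v = i0) with hAdef
  have hVcard : A.card + W.card = Fintype.card V := by
    rw [← Finset.card_univ]
    exact Finset.card_filter_add_card_filter_not _
  have himg : (W.image pt).card ≤ W.card := Finset.card_image_le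
  have hwide : WideOn W L k := by
    intro S hS
    by_cases hinj : Set.InjOn pt S
    · left
      have e := Finset.card_image_of_injOn hinj
      have e2 := Finset.card_le_card (Finset.image_subset_image (f := pt) hS)
      omega
    · right
      unfold Set.InjOn at hinj
      push Not at hinj
      obtain ⟨u, hu, v, hv, huv, hne⟩ := hinj
      have hd := hdisj u v (mem_filter.1 (hS hu)).2 huv hne
      have e : L u ∪ L v ⊆ S.biUnion L := union_subset
        (Finset.subset_biUnion_of_mem L hu) (Finset.subset_biUnion_of_mem L hv)
      have e2 := Finset.card_le_card e
      rw [Finset.card_union_of_disjoint hd] at e2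
      have := hL u
      have := hL v
      omega
  have hC : ∃ C', HallOn W L C' ∧ unhit A L C' = ∅ := by
    rcases A.eq_empty_or_nonempty with hA | ⟨a, ha⟩
    · exact ⟨{0}, hallOn_singleton W L k s 0 hL h3 hwide, by simp [unhit, hA]⟩
    · have hne : (univ.biUnion L).Nonempty := by
        have : (L a).Nonempty := Finset.card_pos.1 (by have := hL a; omega)
        obtain ⟨x, hx⟩ := this
        exact ⟨x, mem_biUnion.2 ⟨a, mem_univ _, hx⟩⟩
      obtain ⟨c, hcU, hcmax⟩ := Finset.exists_max_image (univ.biUnion L)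
        (fun x => (A.filter (fun a => x ∈ L a)).card) hne
      have hh : ∀ x, (A.filter (fun a => x ∈ L a)).card ≤ (A.filter (fun a => c ∈ L a)).card := by
        intro x
        by_cases hx : x ∈ univ.biUnion L
        · exact hcmax x hx
        · have : A.filter (fun a => x ∈ L a) = ∅ := by
            apply Finset.filter_eq_empty_iff.2
            intro b _ hb
            exact hx (mem_biUnion.2 ⟨b, mem_univ _, hb⟩)
          simp [this]
      have hh1 : 1 ≤ (A.filter (fun a => c ∈ L a)).card := by
        have : (L a).Nonempty := Finset.card_pos.1 (by have := hL a; omega)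
        obtain ⟨x, hx⟩ := this
        refine le_trans ?_ (hh x)
        exact Finset.card_pos.2 ⟨a, mem_filter.2 ⟨ha, hx⟩⟩
      have e := unhit_insert A L ∅ c
      have e0 : unhit A L ∅ = A := by simp [unhit]
      rw [e0] at e
      have e1 : insert c (∅ : Finset ℕ) = {c} := rfl
      rw [e1] at e
      have e2 : ({c} : Finset ℕ).card = 1 := Finset.card_singleton c
      exact loop_hit W A L k s _ (univ.biUnion L)
        (fun v => Finset.subset_biUnion_of_mem L (mem_univ v)) (by omega) (by omega) hL h3 hwide
        hh1 hh _ {c} (hallOn_singleton W L k s c hL h3 hwide) (by omega) le_rfl (by omega)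
  obtain ⟨C, hCH, hCA⟩ := hC
  have hall : ∀ X : Finset {v // pt v ≠ i0},
      X.card ≤ (X.biUnion (fun v => L v.1 \ C)).card := by
    intro X
    have e := hCH (X.map (Function.Embedding.subtype _)) (by
      intro v hv
      obtain ⟨w, _, rfl⟩ := mem_map.1 hv
      exact mem_filter.2 ⟨mem_univ _, w.2⟩)
    rw [Finset.card_map] at e
    refine e.trans (Finset.card_le_card ?_)
    intro x hx
    obtain ⟨hx1, hx2⟩ := mem_sdiff.1 hx
    obtain ⟨v, hv, hxv⟩ := mem_biUnion.1 hx1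
    obtain ⟨w, hw, rfl⟩ := mem_map.1 hv
    exact mem_biUnion.2 ⟨w, hw, mem_sdiff.2 ⟨hxv, hx2⟩⟩
  obtain ⟨g, hg, hgL⟩ := (Finset.all_card_le_biUnion_card_iff_exists_injective _).1 hall
  have hf : ∀ v, pt v = i0 → ∃ x, x ∈ L v ∧ x ∈ C := by
    intro v hv
    have : v ∉ unhit A L C := by simp [hCA]
    have hd : ¬ Disjoint (L v) C := fun hd =>
      this (mem_filter.2 ⟨mem_filter.2 ⟨mem_univ _, hv⟩, hd⟩)
    exact Finset.not_disjoint_iff.1 hd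
  choose f hfL hfC using hf
  refine ⟨fun v => if h : pt v = i0 then f v h else g ⟨v, h⟩, ?_, ?_⟩
  · intro v
    dsimp only
    split_ifs with h
    · exact hfL v h
    · exact (mem_sdiff.1 (hgL ⟨v, h⟩)).1
  · intro u w huw
    dsimp only
    split_ifs with a b b
    · exact absurd (a.trans b.symm) huw
    · intro h
      exact (mem_sdiff.1 (hgL ⟨w, b⟩)).2 (h ▸ hfC u a)
    · intro h
      exact (mem_sdiff.1 (hgL ⟨u, a⟩)).2 (h ▸ hfC w b)
    · intro h
      have := hg h
      simp at this
      exact huw (by rw [this])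

/-- The complete multipartite graph with parts the fibres of `pt`. -/
def fibreGraph {V : Type} (pt : V → ℕ) : SimpleGraph V where
  Adj u v := pt u ≠ pt v
  symm := ⟨fun _ _ h => Ne.symm h⟩
  loopless := ⟨fun _ h => h rfl⟩

lemma main_coloring (i0 s : ℕ) (k : ℕ) : ∀ (V : Type) [Fintype V] [DecidableEq V] (pt : V → ℕ)
    (_ : ((univ.filter (fun v => pt v ≠ i0)).image pt).card + 1 = k)
    (_ : ∀ u v w, pt u ≠ i0 → pt u = pt v → pt u = pt w → u ≠ v → w = u ∨ w = v)
    (_ : (univ.filter (fun v => pt v ≠ i0)).card + s + 2 ≤ 2 * k)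
    (_ : (univ.filter (fun v => pt v = i0)).card ≤ 2 * s + 1)
    (L : V → Finset ℕ) (_ : ∀ v, k ≤ (L v).card), ListColorable (fibreGraph pt) L := by
  induction k with
  | zero => intro V _ _ pt h1; omega
  | succ k ih =>
    intro V _ _ pt h1 h2 h3 h4 L hL
    apply kierstead_reduction (fibreGraph pt) (k + 1) L hL
    clear hL L
    intro L hL hU
    by_cases hdisj : ∀ u v, pt u ≠ i0 → pt u = pt v → u ≠ v → Disjoint (L u) (L v)
    · obtain ⟨c, hc, hc2⟩ := disjoint_case pt i0 (k + 1) s h1 h3 h4 L hL hU hdisj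
      exact ⟨c, hc, fun u w h => hc2 u w h⟩
    push Not at hdisj
    obtain ⟨u, v, hu, huv, hne, hd⟩ := hdisj
    obtain ⟨x, hxu, hxv⟩ := Finset.not_disjoint_iff.1 hd
    have hcol := ih {w // pt w ≠ pt u} (fun w => pt w.1)
      (by
        have e : ((univ.filter (fun w : {w // pt w ≠ pt u} => pt w.1 ≠ i0)).image
            (fun w => pt w.1)) =
            ((univ.filter (fun v => pt v ≠ i0)).image pt).erase (pt u) := by
          ext j
          simp only [mem_image, mem_filter, mem_univ, true_and, mem_erase]
          constructor
          · rintro ⟨w, hw, rfl⟩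
            exact ⟨w.2, w.1, hw, rfl⟩
          · rintro ⟨hj, w, hw, rfl⟩
            exact ⟨⟨w, hj⟩, hw, rfl⟩
        rw [e, Finset.card_erase_of_mem
          (mem_image.2 ⟨u, mem_filter.2 ⟨mem_univ _, hu⟩, rfl⟩)]
        have : 0 < ((univ.filter (fun v => pt v ≠ i0)).image pt).card :=
          Finset.card_pos.2 ⟨pt u, mem_image.2 ⟨u, mem_filter.2 ⟨mem_univ _, hu⟩, rfl⟩⟩
        omega)
      (by
        intro a b c ha hab hac hne
        have := h2 a.1 b.1 c.1 ha hab hac (fun h => hne (Subtype.ext h))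
        rcases this with h | h
        · exact Or.inl (Subtype.ext h)
        · exact Or.inr (Subtype.ext h))
      (by
        have e : (univ.filter (fun w : {w // pt w ≠ pt u} => pt w.1 ≠ i0)).map
            (Function.Embedding.subtype _) ⊆
            ((univ.filter (fun v => pt v ≠ i0)).erase u).erase v := by
          intro w hw
          obtain ⟨w', hw', rfl⟩ := mem_map.1 hw
          have hp := w'.2
          simp only [mem_filter, mem_univ, true_and, mem_erase] at hw' ⊢
          refine ⟨?_, ?_, hw'⟩
          · intro h
            apply hp
            exact (congrArg pt h).trans huv.symm
          · intro h
            apply hp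
            exact congrArg pt h
        have e2 := Finset.card_le_card e
        rw [Finset.card_map, Finset.card_erase_of_mem, Finset.card_erase_of_mem] at e2
        · have : 1 < (univ.filter (fun v => pt v ≠ i0)).card :=
            Finset.one_lt_card.2 ⟨u, by simp [hu], v, by simp [← huv, hu], hne⟩
          omega
        · simp [hu]
        · simp [← huv, hu, hne.symm])
      (by
        rw [← Finset.card_map (Function.Embedding.subtype _)]
        refine le_trans (Finset.card_le_card ?_) h4
        intro w hw
        obtain ⟨w', hw', rfl⟩ := mem_map.1 hw
        simp only [mem_filter, mem_univ, true_and] at hw' ⊢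
        exact hw')
      (fun w => (L w.1).erase x)
      (by
        intro w
        have := Finset.pred_card_le_card_erase (s := L w.1) (a := x)
        have := hL w.1
        omega)
    obtain ⟨c, hc, hcG⟩ := hcol
    refine ⟨fun w => if h : pt w ≠ pt u then c ⟨w, h⟩ else x, ?_, ?_⟩
    · intro w
      dsimp only
      split_ifs with h
      · exact mem_of_mem_erase (hc ⟨w, h⟩)
      · push Not at h
        rcases h2 u v w hu huv h.symm hne with rfl | rfl
        · exact hxu
        · exact hxv
    · intro a b hab
      dsimp only
      split_ifs with h h' h'
      · exact hcG (u := ⟨a, h⟩) (w := ⟨b, h'⟩) hab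
      · exact (mem_erase.1 (hc ⟨a, h⟩)).1
      · exact ((mem_erase.1 (hc ⟨b, h'⟩)).1).symm
      · push Not at h h'
        exact absurd (h.trans h'.symm) hab

theorem choiceNumber_Km_2xks1_1xs (k m s : ℕ) (hks : s + 1 ≤ k)
    (hm1 : 1 ≤ m) (hm : m ≤ 2 * s + 1) :
    IsLeast {n | Choosable (SimpleGraph.completeMultipartiteGraph
      (fun i : Fin k => Fin (if i.val = 0 then m
        else if i.val < k - s then 2 else 1))) n} k := by
  set F : Fin k → ℕ := fun i => if i.val = 0 then m
        else if i.val < k - s then 2 else 1 with hF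
  have hFpos : ∀ i, 0 < F i := by
    intro i
    simp only [hF]
    split_ifs <;> omega
  constructor
  · intro L hL
    have hW : (univ.filter (fun v : (Σ i : Fin k, Fin (F i)) => v.1.val ≠ 0)).card + s + 2
        = 2 * k := by
      have e : univ.filter (fun v : (Σ i : Fin k, Fin (F i)) => v.1.val ≠ 0)
          = (univ.filter (fun i : Fin k => i.val ≠ 0)).sigma (fun _ => univ) := by
        ext v; simp
      rw [e, Finset.card_sigma, Finset.sum_filter]
      have e2 : ∑ i : Fin k, (if i.val ≠ 0 then (univ : Finset (Fin (F i))).card else 0)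
          = ∑ i ∈ Finset.range k, (if i = 0 then 0 else if i < k - s then 2 else 1) := by
        rw [Finset.sum_range]
        apply Finset.sum_congr rfl
        intro i _
        rw [Finset.card_univ, Fintype.card_fin]
        simp only [hF]
        split_ifs <;> simp_all
      rw [e2]
      obtain ⟨t, rfl⟩ : ∃ t, k = (t + 1) + s := ⟨k - s - 1, by omega⟩
      rw [Finset.sum_range_add, Finset.sum_range_succ']
      have e3 : ∑ i ∈ Finset.range t,
          (if i + 1 = 0 then 0 else if i + 1 < t + 1 + s - s then 2 else 1) = t * 2 := by
        rw [Finset.sum_congr rfl (g := fun _ => 2)]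
        · simp
        · intro i hi
          rw [mem_range] at hi
          rw [if_neg (by omega), if_pos (by omega)]
      have e4 : ∑ i ∈ Finset.range s,
          (if t + 1 + i = 0 then 0 else if t + 1 + i < t + 1 + s - s then 2 else 1) = s := by
        rw [Finset.sum_congr rfl (g := fun _ => 1)]
        · simp
        · intro i hi
          rw [if_neg (by omega), if_neg (by omega)]
      rw [e3, e4, if_pos rfl]
      ring
    have hA : (univ.filter (fun v : (Σ i : Fin k, Fin (F i)) => v.1.val = 0)).card
        = m := by
      have e : univ.filter (fun v : (Σ i : Fin k, Fin (F i)) => v.1.val = 0)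
          = ({(⟨0, by omega⟩ : Fin k)} : Finset (Fin k)).sigma (fun _ => univ) := by
        ext v; simp [Fin.ext_iff]
      rw [e, Finset.card_sigma, Finset.sum_singleton, Finset.card_univ, Fintype.card_fin]
      simp [hF]
    obtain ⟨c, hc, hcG⟩ := main_coloring 0 s k (Σ i : Fin k, Fin (F i)) (fun v => v.1.val)
      (by
        have e : ((univ.filter (fun v : (Σ i : Fin k, Fin (F i)) => v.1.val ≠ 0)).image
          (fun v => v.1.val)) = (Finset.range k).erase 0 := by
          ext j
          simp only [mem_image, mem_filter, mem_univ, true_and, mem_erase, mem_range]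
          constructor
          · rintro ⟨w, hw, rfl⟩
            exact ⟨hw, w.1.2⟩
          · rintro ⟨h0, hj⟩
            exact ⟨⟨⟨j, hj⟩, ⟨0, hFpos _⟩⟩, h0, rfl⟩
        rw [e, Finset.card_erase_of_mem (by simp; omega), Finset.card_range]
        omega)
      (by
        rintro ⟨u, a⟩ ⟨v, b⟩ ⟨w, c⟩ h0 huv huw hne
        simp only at h0 huv huw
        obtain rfl := Fin.ext huv
        obtain rfl := Fin.ext huw
        have hle : F u ≤ 2 := by
          simp only [hF, h0, if_false]
          split_ifs <;> omega
        have hab : a.val ≠ b.val := fun h => hne (by rw [Fin.ext h])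
        have ha := a.2
        have hb := b.2
        have hc := c.2
        have : c.val = a.val ∨ c.val = b.val := by omega
        rcases this with h | h
        · left; rw [Fin.ext h]
        · right; rw [Fin.ext h])
      hW.le (by omega) L hL
    refine ⟨c, hc, ?_⟩
    intro u w huw
    apply hcG
    intro h
    exact huw (Fin.ext h)
  · intro n hn
    obtain ⟨c, hc, hcG⟩ := hn (fun _ => Finset.range n) (fun _ => by simp)
    have hinj : Function.Injective (fun i : Fin k => c ⟨i, ⟨0, hFpos i⟩⟩) := by
      intro i j hij
      by_contra hne
      exact hcG (u := ⟨i, ⟨0, hFpos i⟩⟩) (w := ⟨j, ⟨0, hFpos j⟩⟩) hne hij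
    have := Finset.card_le_card_of_injOn (s := (univ : Finset (Fin k))) (t := Finset.range n)
      (fun i : Fin k => c ⟨i, ⟨0, hFpos i⟩⟩) (fun i _ => hc _) hinj.injOn
    simpa using this
end

section
/- (Shen et al.) Let s ∈ {2, 3, 4} and let k be an integer with k ≥ s + 2. Then the complete k-partite graph K_{s+2,3,2*(k-s-2),1*s}, with one part of size s+2, one part of size 3, k−s−2 parts of size 2, and s parts of size 1, has choice number exactly k. -/
namespace Ohba

variable {V : Type*} [DecidableEq V]

/-- Hall's theorem relative to a finset. -/
lemma hall (T : Finset V) (L : V → Finset ℕ)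
    (h : ∀ U ⊆ T, U.card ≤ (U.biUnion L).card) :
    ∃ f : V → ℕ, (∀ v ∈ T, f v ∈ L v) ∧ ∀ u ∈ T, ∀ v ∈ T, f u = f v → u = v := by
  have := (Finset.all_card_le_biUnion_card_iff_exists_injective (fun v : T => L v.1)).1 (by
    intro s
    have h1 := h (s.map (Function.Embedding.subtype _)) (by
      intro x hx
      simp only [Finset.mem_map, Function.Embedding.coe_subtype] at hx
      obtain ⟨y, _, rfl⟩ := hx
      exact y.2)
    rw [Finset.card_map] at h1
    refine h1.trans (Finset.card_le_card ?_)
    intro x hx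
    simp only [Finset.mem_biUnion, Finset.mem_map, Function.Embedding.coe_subtype] at hx ⊢
    obtain ⟨_, ⟨y, hy, rfl⟩, hx⟩ := hx
    exact ⟨y, hy, hx⟩)
  obtain ⟨f, hf, hf2⟩ := this
  refine ⟨fun v => if h : v ∈ T then f ⟨v, h⟩ else 0, ?_, ?_⟩
  · intro v hv
    simp only [hv, dif_pos]
    exact hf2 ⟨v, hv⟩
  · intro u hu v hv huv
    simp only [hu, hv, dif_pos] at huv
    have := hf huv
    simpa using this

lemma greedy (T : Finset V) (L : V → Finset ℕ) (h : ∀ v ∈ T, T.card ≤ (L v).card) :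
    ∃ f : V → ℕ, (∀ v ∈ T, f v ∈ L v) ∧ ∀ u ∈ T, ∀ v ∈ T, f u = f v → u = v := by
  apply hall
  intro U hU
  rcases U.eq_empty_or_nonempty with rfl | ⟨x, hx⟩
  · simp
  · calc U.card ≤ T.card := Finset.card_le_card hU
      _ ≤ (L x).card := h x (hU hx)
      _ ≤ _ := Finset.card_le_card (Finset.subset_biUnion_of_mem L hx)

/-- A maximal set of maximal deficiency. -/
lemma split (W : Finset V) (L : V → Finset ℕ) :
    ∃ S ⊆ W, (S.biUnion L).card ≤ S.card ∧
      ((S.biUnion L).card < S.card ∨ ∀ U ⊆ W, U.card ≤ (U.biUnion L).card) ∧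
      ∀ c : ℕ, ∃ f : V → ℕ, (∀ v ∈ W, v ∉ S → f v ∈ L v ∧ f v ∉ S.biUnion L ∧ f v ≠ c) ∧
        ∀ u ∈ W, u ∉ S → ∀ v ∈ W, v ∉ S → f u = f v → u = v := by
  obtain ⟨S, hS, hmax⟩ := Finset.exists_max_image W.powerset
    (fun S => ((S.card : ℤ) - (S.biUnion L).card) * (W.card + 1) + S.card) ⟨∅, by simp⟩
  rw [Finset.mem_powerset] at hS
  have hSc := Finset.card_le_card hS
  refine ⟨S, hS, ?_, ?_, ?_⟩
  · have := hmax ∅ (by simp)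
    simp only [Finset.card_empty, Finset.biUnion_empty] at this
    by_contra hcon
    push Not at hcon
    have : ((S.card : ℤ) - (S.biUnion L).card) ≤ -1 := by omega
    have hW : (S.card : ℤ) ≤ W.card := by exact_mod_cast hSc
    nlinarith
  · by_contra hcon
    push Not at hcon
    obtain ⟨h1, U, hU, h2⟩ := hcon
    have h3 := hmax U (by simpa using hU)
    have hW : (S.card : ℤ) ≤ W.card := by exact_mod_cast hSc
    have h4 : ((S.card : ℤ) - (S.biUnion L).card) ≤ 0 := by omega
    have h5 : 1 ≤ ((U.card : ℤ) - (U.biUnion L).card) := by omega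
    have h6 : (0 : ℤ) ≤ U.card := by positivity
    nlinarith
  · intro c
    obtain ⟨f, hf1, hf2⟩ := hall (W \ S) (fun v => (L v \ S.biUnion L).erase c) (by
      intro U hU
      rcases U.eq_empty_or_nonempty with rfl | hne
      · simp
      have hdisj : Disjoint S U := by
        rw [Finset.disjoint_left]
        intro x hx hx'
        exact (Finset.mem_sdiff.1 (hU hx')).2 hx
      have h3 := hmax (S ∪ U) (by
        rw [Finset.mem_powerset]
        exact Finset.union_subset hS (hU.trans Finset.sdiff_subset))
      simp only [Finset.card_union_of_disjoint hdisj] at h3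
      have h4 : (S ∪ U).biUnion L = S.biUnion L ∪ (U.biUnion L \ S.biUnion L) := by
        ext x; simp only [Finset.mem_biUnion, Finset.mem_union, Finset.mem_sdiff]
        grind
      have h5 : ((S ∪ U).biUnion L).card =
          (S.biUnion L).card + (U.biUnion L \ S.biUnion L).card := by
        rw [h4, Finset.card_union_of_disjoint Finset.disjoint_sdiff]
      rw [h5] at h3
      have hU0 : 0 < U.card := hne.card_pos
      have h6 : U.card < (U.biUnion L \ S.biUnion L).card := by
        by_contra hcon
        push Not at hcon
        push_cast at h3
        have h7 : (0 : ℤ) ≤ (U.card : ℤ) - ((U.biUnion L \ S.biUnion L).card : ℤ) := by omega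
        have h8 : (0 : ℤ) < U.card := by exact_mod_cast hU0
        have h9 : (0 : ℤ) ≤ W.card := by positivity
        nlinarith
      have h7 : (U.biUnion L \ S.biUnion L).erase c ⊆
          U.biUnion (fun v => (L v \ S.biUnion L).erase c) := by
        intro x hx
        simp only [Finset.mem_biUnion, Finset.mem_erase, Finset.mem_sdiff] at hx ⊢
        grind
      have h8 := Finset.card_le_card h7
      have h9 := Finset.pred_card_le_card_erase (s := U.biUnion L \ S.biUnion L) (a := c)
      omega)
    refine ⟨f, ?_, ?_⟩
    · intro v hv hvS
      have := hf1 v (Finset.mem_sdiff.2 ⟨hv, hvS⟩)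
      simp only [Finset.mem_erase, Finset.mem_sdiff] at this
      tauto
    · intro u hu huS v hv hvS
      exact hf2 u (Finset.mem_sdiff.2 ⟨hu, huS⟩) v (Finset.mem_sdiff.2 ⟨hv, hvS⟩)

/-- Two colors different from `c` meet all lists on `A`. -/
lemma hitting (A : Finset V) (L : V → Finset ℕ) (k : ℕ) (hk : 4 ≤ k) (hA : A.card ≤ 6)
    (hAk : A.card ≤ k) (hL : ∀ v ∈ A, (L v).card = k)
    (hN : (A.biUnion L).card + 1 ≤ k + A.card)
    (hno : ∀ z, ∃ x ∈ A, z ∉ L x) (c : ℕ) :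
    ∃ d e, d ≠ c ∧ e ≠ c ∧ ∀ x ∈ A, d ∈ L x ∨ e ∈ L x := by
  set Λ := A.biUnion L with hΛ
  have hsub : ∀ x ∈ A, L x ⊆ Λ := fun x hx => Finset.subset_biUnion_of_mem L hx
  have hdc : ∑ d ∈ Λ, (A.filter (fun x => d ∉ L x)).card = A.card * (Λ.card - k) := by
    have h1 := Finset.sum_card_bipartiteAbove_eq_sum_card_bipartiteBelow
      (s := Λ) (t := A) (fun d x => d ∉ L x)
    simp only [Finset.bipartiteAbove, Finset.bipartiteBelow] at h1
    rw [h1, Finset.sum_const_nat (m := Λ.card - k)]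
    intro x hx
    have : Λ.filter (fun d => d ∉ L x) = Λ \ L x := by
      ext; simp
    rw [this, Finset.card_sdiff_of_subset (hsub x hx), hL x hx]
  obtain ⟨x0, hx0, -⟩ := hno c
  have hkN : k ≤ Λ.card := by
    rw [← hL x0 hx0]; exact Finset.card_le_card (hsub x0 hx0)
  obtain ⟨d, hdΛ, hdc', hd⟩ : ∃ d ∈ Λ, d ≠ c ∧ (A.filter (fun x => d ∉ L x)).card ≤ 2 := by
    by_contra hcon
    push Not at hcon
    have h1 : ∑ d ∈ Λ, (if d = c then 1 else 3) ≤
        ∑ d ∈ Λ, (A.filter (fun x => d ∉ L x)).card := by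
      apply Finset.sum_le_sum
      intro d hd
      split_ifs with h
      · obtain ⟨x, hx, hx'⟩ := hno d
        exact Finset.card_pos.2 ⟨x, by simp [hx, hx']⟩
      · exact hcon d hd h
    have h2 : 3 * Λ.card ≤ ∑ d ∈ Λ, (if d = c then 1 else 3) + 2 := by
      have h3 : ∑ d ∈ Λ, ((if d = c then 1 else 3) + (if d = c then 2 else 0)) = 3 * Λ.card := by
        rw [mul_comm]
        apply Finset.sum_const_nat
        intro d _
        split_ifs <;> rfl
      rw [Finset.sum_add_distrib] at h3
      have h4 : ∑ d ∈ Λ, (if d = c then 2 else 0) ≤ 2 := by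
        rw [Finset.sum_ite_eq']
        split_ifs <;> simp
      omega
    rw [hdc] at h1
    obtain ⟨t, ht⟩ := Nat.exists_eq_add_of_le hkN
    have h5 : 3 * (k + t) ≤ A.card * t + 2 := by
      have : Λ.card - k = t := by omega
      rw [this] at h1
      omega
    have ht' : t + 1 ≤ A.card := by omega
    generalize A.card = a at *
    interval_cases a <;> omega
  by_cases h2 : (A.filter (fun x => d ∉ L x)).card = 2
  · obtain ⟨x, y, hxy, hxyA⟩ := Finset.card_eq_two.1 h2
    have hx : x ∈ A ∧ d ∉ L x := by
      have : x ∈ A.filter (fun x => d ∉ L x) := by rw [hxyA]; simp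
      simpa using this
    have hy : y ∈ A ∧ d ∉ L y := by
      have : y ∈ A.filter (fun x => d ∉ L x) := by rw [hxyA]; simp
      simpa using this
    have h3 : (L x ∪ L y).card ≤ (Λ.erase d).card := by
      apply Finset.card_le_card
      intro z hz
      rw [Finset.mem_erase]
      rcases Finset.mem_union.1 hz with hz | hz
      · exact ⟨fun h => hx.2 (h ▸ hz), hsub x hx.1 hz⟩
      · exact ⟨fun h => hy.2 (h ▸ hz), hsub y hy.1 hz⟩
    rw [Finset.card_erase_of_mem hdΛ] at h3
    have h4 := Finset.card_union_add_card_inter (L x) (L y)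
    rw [hL x hx.1, hL y hy.1] at h4
    obtain ⟨e, he, hec⟩ := Finset.exists_mem_ne (s := L x ∩ L y) (by omega) c
    rw [Finset.mem_inter] at he
    refine ⟨d, e, hdc', hec, ?_⟩
    intro v hv
    by_cases hdv : d ∈ L v
    · exact Or.inl hdv
    · right
      have : v ∈ A.filter (fun x => d ∉ L x) := by simp [hv, hdv]
      rw [hxyA] at this
      simp only [Finset.mem_insert, Finset.mem_singleton] at this
      rcases this with rfl | rfl
      · exact he.1
      · exact he.2
  · have h1 : (A.filter (fun x => d ∉ L x)).card ≤ 1 := by omega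
    rw [Finset.card_le_one_iff] at h1
    obtain ⟨x, hx, hxd⟩ := hno d
    obtain ⟨e, he, hec⟩ := Finset.exists_mem_ne (s := L x) (by rw [hL x hx]; omega) c
    refine ⟨d, e, hdc', hec, ?_⟩
    intro v hv
    by_cases hdv : d ∈ L v
    · exact Or.inl hdv
    · right
      have : v = x := h1 (by simp [hv, hdv]) (by simp [hx, hxd])
      rw [this]; exact he

/-- If the regular vertices do not all share one list containing `c`, they can be colored
injectively avoiding three colors. -/
lemma hallReg (R : Finset V) (L : V → Finset ℕ) (k : ℕ) (hk : 4 ≤ k) (hR : R.card ≤ k - 2)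
    (hL : ∀ v ∈ R, (L v).card = k) (c d e : ℕ)
    (hnt : ¬ (R.card = k - 2 ∧ ∃ Γ : Finset ℕ, c ∈ Γ ∧ ∀ r ∈ R, L r = Γ)) :
    ∀ U ⊆ R, U.card ≤ (U.biUnion (fun v => L v \ {c, d, e})).card := by
  intro U hU
  by_contra hcon
  push Not at hcon
  apply hnt
  have hUc := Finset.card_le_card hU
  have h3 : ({c, d, e} : Finset ℕ).card ≤ 3 := Finset.card_le_three
  have key : ∀ r ∈ U, k - 3 ≤ (L r \ {c, d, e}).card ∧
      (L r \ {c, d, e}) ⊆ U.biUnion (fun v => L v \ {c, d, e}) := by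
    intro r hr
    have h1 := Finset.le_card_sdiff ({c, d, e} : Finset ℕ) (L r)
    rw [hL r (hU hr)] at h1
    exact ⟨by omega, Finset.subset_biUnion_of_mem (fun v => L v \ {c, d, e}) hr⟩
  have hne : U.Nonempty := by
    rw [← Finset.card_pos]; omega
  obtain ⟨r0, hr0⟩ := hne
  have h4 := (key r0 hr0).1.trans (Finset.card_le_card (key r0 hr0).2)
  have hUR : U = R := Finset.eq_of_subset_of_card_le hU (by omega)
  subst hUR
  refine ⟨by omega, U.biUnion (fun v => L v \ {c, d, e}) ∪ {c, d, e}, by simp, ?_⟩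
  intro r hr
  have h5 := key r hr
  have h6 := Finset.eq_of_subset_of_card_le h5.2 (by omega)
  have hsub : ({c, d, e} : Finset ℕ) ⊆ L r := by
    have h7 := Finset.card_sdiff_add_card_inter (L r) {c, d, e}
    rw [hL r hr] at h7
    have h8 : ({c, d, e} : Finset ℕ).card ≤ (L r ∩ {c, d, e}).card := by
      rw [h6] at h7
      omega
    have h9 := Finset.eq_of_subset_of_card_le (Finset.inter_subset_right) h8
    rw [← h9]
    exact Finset.inter_subset_left
  rw [← h6, Finset.sdiff_union_of_subset hsub]

lemma hallRegW (R : Finset V) (w : V) (hw : w ∉ R) (L : V → Finset ℕ) (k : ℕ) (hk : 4 ≤ k)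
    (hR : R.card ≤ k - 2)
    (hL : ∀ v ∈ R, (L v).card = k) (hLw : (L w).card = k) (c d e : ℕ) (hc : c ∉ L w)
    (hnt : ¬ (R.card = k - 2 ∧ ∃ Γ : Finset ℕ, c ∈ Γ ∧ ∀ r ∈ R, L r = Γ))
    (hnt2 : ¬ (R.card = k - 2 ∧ ∀ r ∈ R, L r ⊆ insert c (L w))) :
    ∀ U ⊆ insert w R, U.card ≤ (U.biUnion (fun v => L v \ {c, d, e})).card := by
  intro U hU
  by_cases hwU : w ∈ U
  swap
  · exact hallReg R L k hk hR hL c d e hnt U ((Finset.subset_insert_iff_of_notMem hwU).1 hU)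
  by_contra hcon
  push Not at hcon
  apply hnt2
  have hUc := Finset.card_le_card hU
  rw [Finset.card_insert_of_notMem hw] at hUc
  have hsw : L w \ {c, d, e} ⊆ U.biUnion (fun v => L v \ {c, d, e}) :=
    Finset.subset_biUnion_of_mem (fun v => L v \ {c, d, e}) hwU
  have hLw' : L w \ {c, d, e} = L w \ {d, e} := by
    ext x; simp only [Finset.mem_sdiff, Finset.mem_insert, Finset.mem_singleton]
    grind
  have h2 : ({d, e} : Finset ℕ).card ≤ 2 := Finset.card_le_two
  have h3 := Finset.card_sdiff_add_card_inter (L w) {d, e}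
  have h4 : (L w ∩ {d, e}).card ≤ ({d, e} : Finset ℕ).card :=
    Finset.card_le_card Finset.inter_subset_right
  have h5 := Finset.card_le_card hsw
  rw [hLw'] at h5
  have hUR : U = insert w R := Finset.eq_of_subset_of_card_le hU (by
    rw [Finset.card_insert_of_notMem hw]; omega)
  have h6 := Finset.eq_of_subset_of_card_le hsw (by rw [hLw']; omega)
  have hsub : ({d, e} : Finset ℕ) ⊆ L w := by
    have h9 := Finset.eq_of_subset_of_card_le
      (Finset.inter_subset_right (s₁ := L w) (s₂ := {d, e})) (by omega)
    rw [← h9]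
    exact Finset.inter_subset_left
  have hcU : U.card = R.card + 1 := by rw [hUR, Finset.card_insert_of_notMem hw]
  refine ⟨by omega, ?_⟩
  intro r hr x hx
  by_cases hxm : x ∈ ({c, d, e} : Finset ℕ)
  · simp only [Finset.mem_insert, Finset.mem_singleton] at hxm ⊢
    rcases hxm with h | h | h
    · exact Or.inl h
    · right; apply hsub; simp [h]
    · right; apply hsub; simp [h]
  · have : x ∈ L w \ {c, d, e} := by
      rw [h6, Finset.mem_biUnion]
      exact ⟨r, by rw [hUR]; simp [hr], Finset.mem_sdiff.2 ⟨hx, hxm⟩⟩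
    exact Finset.mem_insert_of_mem (Finset.mem_sdiff.1 this).1

/-- Avoid the few exchange lists. -/
lemma pairpick (A : Finset V) (L : V → Finset ℕ) (Γ F G : Finset ℕ) (hF : F ⊆ Γ)
    (hG : ∀ g ∈ G, g ∉ Γ) (h : A.card < F.card * G.card) (hL : ∀ v ∈ A, (L v).card = Γ.card) :
    ∃ f ∈ F, ∃ g ∈ G, ∀ v ∈ A, f ∉ L v → ∃ y ∈ L v, y ∉ Γ ∧ y ≠ g := by
  have h1 : ∃ f ∈ F, ∃ g ∈ G, ∀ v ∈ A, L v ≠ insert g (Γ.erase f) := by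
    by_contra hcon
    push Not at hcon
    have hc2 : ∀ p : ℕ × ℕ, ∃ v, p ∈ F ×ˢ G → v ∈ A ∧ L v = insert p.2 (Γ.erase p.1) := by
      intro p
      by_cases hp : p ∈ F ×ˢ G
      · obtain ⟨v, hv, hv2⟩ := hcon p.1 (Finset.mem_product.1 hp).1 p.2 (Finset.mem_product.1 hp).2
        exact ⟨v, fun _ => ⟨hv, hv2⟩⟩
      · have : A.Nonempty ∨ ¬ A.Nonempty := em _
        obtain ⟨q, hq⟩ : (F ×ˢ G).Nonempty := by
          rw [← Finset.card_pos, Finset.card_product]; omega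
        obtain ⟨v, hv, hv2⟩ := hcon q.1 (Finset.mem_product.1 hq).1 q.2 (Finset.mem_product.1 hq).2
        exact ⟨v, fun h => absurd h hp⟩
    choose φ hφ using hc2
    have hle : (F ×ˢ G).card ≤ A.card := by
      apply Finset.card_le_card_of_injOn φ
      · intro p hp
        exact (hφ p hp).1
      · intro p hp q hq hpq
        have h1 := (hφ p hp).2
        have h2 := (hφ q hq).2
        rw [hpq, h2] at h1
        have hp' := Finset.mem_product.1 hp
        have hq' := Finset.mem_product.1 hq
        have e1 : p.2 = q.2 := by
          have : p.2 ∈ insert q.2 (Γ.erase q.1) := by rw [h1]; simp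
          rw [Finset.mem_insert, Finset.mem_erase] at this
          rcases this with h | h
          · exact h
          · exact absurd h.2 (hG _ hp'.2)
        have e2 : p.1 = q.1 := by
          by_contra hne
          have h3 : p.1 ∈ insert q.2 (Γ.erase q.1) := by
            simp [hne, hF hp'.1]
          rw [h1, Finset.mem_insert, Finset.mem_erase] at h3
          rcases h3 with h | h
          · exact hG _ hp'.2 (h ▸ hF hp'.1)
          · exact h.1 rfl
        exact Prod.ext e2 e1
    rw [Finset.card_product] at hle
    omega
  obtain ⟨f, hf, g, hg, hfg⟩ := h1
  refine ⟨f, hf, g, hg, ?_⟩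
  intro v hv hfv
  by_contra hcon
  push Not at hcon
  apply hfg v hv
  apply Finset.eq_of_subset_of_card_le
  · intro y hy
    rw [Finset.mem_insert, Finset.mem_erase]
    by_cases hyΓ : y ∈ Γ
    · exact Or.inr ⟨fun h => hfv (h ▸ hy), hyΓ⟩
    · exact Or.inl (hcon y hy hyΓ)
  · rw [hL v hv, Finset.card_insert_of_notMem (by
      intro h; exact hG g hg (Finset.mem_of_mem_erase h)), Finset.card_erase_of_mem (hF hf)]
    have : 0 < Γ.card := Finset.card_pos.2 ⟨f, hF hf⟩
    omega

/-- The coloring of the critical set. -/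
lemma core_s12 (A R : Finset V) (w : V) (hw : w ∉ R) (L : V → Finset ℕ) (k : ℕ) (hk : 4 ≤ k)
    (hA : A.card ≤ 6) (hAk : A.card ≤ k) (hR : R.card ≤ k - 2)
    (hLA : ∀ v ∈ A, (L v).card = k) (hLR : ∀ v ∈ R, (L v).card = k) (hLw : (L w).card = k)
    (hN : (A.biUnion L).card + 1 ≤ k + A.card) (M : Finset ℕ) (hM : 2 ≤ M.card) :
    ∃ c ∈ M, ∃ gA gR : V → ℕ, ∃ gw ∈ L w,
      (∀ x ∈ A, gA x ∈ L x ∧ gA x ≠ c ∧ gA x ≠ gw) ∧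
      (∀ x ∈ R, gR x ∈ L x ∧ gR x ≠ c ∧ gR x ≠ gw) ∧
      (∀ x ∈ R, ∀ y ∈ R, gR x = gR y → x = y) ∧
      (∀ x ∈ A, ∀ y ∈ R, gA x ≠ gR y) := by
  by_cases hz : ∃ z, ∀ x ∈ A, z ∈ L x
  · -- a color common to all lists on `A`
    obtain ⟨z, hz⟩ := hz
    obtain ⟨c, hcM, hcz⟩ := Finset.exists_mem_ne (s := M) (by omega) z
    by_cases hcw : c ∈ L w
    · obtain ⟨g, hg1, hg2⟩ := greedy R (fun v => L v \ {c, z}) (by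
        intro v hv
        have h1 := Finset.le_card_sdiff ({c, z} : Finset ℕ) (L v)
        have h2 : ({c, z} : Finset ℕ).card ≤ 2 := Finset.card_le_two
        rw [hLR v hv] at h1
        show R.card ≤ (L v \ {c, z}).card
        omega)
      refine ⟨c, hcM, fun _ => z, g, c, hcw, ?_, ?_, hg2, ?_⟩
      · intro x hx; exact ⟨hz x hx, hcz.symm, hcz.symm⟩
      · intro x hx
        have := hg1 x hx
        simp only [Finset.mem_sdiff, Finset.mem_insert, Finset.mem_singleton] at this
        tauto
      · intro x hx y hy
        have := hg1 y hy
        simp only [Finset.mem_sdiff, Finset.mem_insert, Finset.mem_singleton] at this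
        grind
    · obtain ⟨g, hg1, hg2⟩ := greedy R (fun v => L v \ {c, z}) (by
        intro v hv
        have h1 := Finset.le_card_sdiff ({c, z} : Finset ℕ) (L v)
        have h2 : ({c, z} : Finset ℕ).card ≤ 2 := Finset.card_le_two
        rw [hLR v hv] at h1
        show R.card ≤ (L v \ {c, z}).card
        omega)
      obtain ⟨gw, hgw⟩ : (L w \ insert z (R.image g)).Nonempty := by
        rw [← Finset.card_pos]
        have h1 := Finset.le_card_sdiff (insert z (R.image g)) (L w)
        have h2 := Finset.card_insert_le z (R.image g)
        have h3 := Finset.card_image_le (s := R) (f := g)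
        omega
      simp only [Finset.mem_sdiff, Finset.mem_insert, Finset.mem_image, not_or, not_exists,
        not_and] at hgw
      refine ⟨c, hcM, fun _ => z, g, gw, hgw.1, ?_, ?_, hg2, ?_⟩
      · intro x hx; exact ⟨hz x hx, hcz.symm, fun h => hgw.2.1 h.symm⟩
      · intro x hx
        have := hg1 x hx
        simp only [Finset.mem_sdiff, Finset.mem_insert, Finset.mem_singleton] at this
        have := hgw.2.2 x hx
        tauto
      · intro x hx y hy
        have := hg1 y hy
        simp only [Finset.mem_sdiff, Finset.mem_insert, Finset.mem_singleton] at this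
        grind
  push Not at hz
  -- all lists equal to a fixed one, helper coloring of `R`
  have hΓcol : ∀ Γ : Finset ℕ, Γ.card = k → ∀ c ∈ Γ, ∀ f ∈ Γ, f ≠ c → (∀ r ∈ R, L r = Γ) →
      ∃ g : V → ℕ, (∀ v ∈ R, g v ∈ (Γ.erase c).erase f) ∧
        ∀ u ∈ R, ∀ v ∈ R, g u = g v → u = v := by
    intro Γ hΓ c hc f hf hfc hRΓ
    apply greedy R (fun _ => (Γ.erase c).erase f)
    intro v hv
    rw [Finset.card_erase_of_mem (Finset.mem_erase.2 ⟨hfc, hf⟩), Finset.card_erase_of_mem hc, hΓ]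
    omega
  by_cases h1 : ∃ c ∈ M, c ∈ L w
  · obtain ⟨c, hcM, hcw⟩ := h1
    by_cases ht : R.card = k - 2 ∧ ∃ Γ : Finset ℕ, c ∈ Γ ∧ ∀ r ∈ R, L r = Γ
    · obtain ⟨hRc, Γ, hcΓ, hRΓ⟩ := ht
      have hΓ : Γ.card = k := by
        obtain ⟨r, hr⟩ : R.Nonempty := by rw [← Finset.card_pos]; omega
        rw [← hRΓ r hr, hLR r hr]
      obtain ⟨f, hf, hfc⟩ := Finset.exists_mem_ne (s := Γ) (by omega) c
      obtain ⟨g, hg1, hg2⟩ := hΓcol Γ hΓ c hcΓ f hf hfc hRΓ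
      have hy : ∀ x, ∃ y, x ∈ A → y ∈ L x ∧ (y = f ∨ y ∉ Γ) := by
        intro x
        by_cases hx : x ∈ A
        · by_cases hfx : f ∈ L x
          · exact ⟨f, fun _ => ⟨hfx, Or.inl rfl⟩⟩
          · have : ¬ L x ⊆ Γ := by
              intro h
              have := Finset.eq_of_subset_of_card_le h (by rw [hΓ, hLA x hx])
              exact hfx (this ▸ hf)
            obtain ⟨y, hy, hy2⟩ := Finset.not_subset.1 this
            exact ⟨y, fun _ => ⟨hy, Or.inr hy2⟩⟩
        · exact ⟨0, fun h => absurd h hx⟩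
      choose gA hgA using hy
      simp only [Finset.mem_erase] at hg1
      refine ⟨c, hcM, gA, g, c, hcw, ?_, ?_, hg2, ?_⟩
      · intro x hx; have := hgA x hx; grind
      · intro x hx; have := hg1 x hx; have := hRΓ x hx; grind
      · intro x hx y hy; have := hgA x hx; have := hg1 y hy; grind
    · obtain ⟨d, e, hd, he, hde⟩ := hitting A L k hk hA hAk hLA hN hz c
      obtain ⟨g, hg1, hg2⟩ := hall R _ (hallReg R L k hk hR hLR c d e ht)
      simp only [Finset.mem_sdiff, Finset.mem_insert, Finset.mem_singleton, not_or] at hg1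
      refine ⟨c, hcM, fun x => if d ∈ L x then d else e, g, c, hcw, ?_, ?_, hg2, ?_⟩
      · intro x hx; have := hde x hx; grind
      · intro x hx; have := hg1 x hx; grind
      · intro x hx y hy; have := hg1 y hy; grind
  push Not at h1
  -- an untroubled color
  by_cases hun : ∃ c ∈ M, ¬ (R.card = k - 2 ∧ ∃ Γ : Finset ℕ, c ∈ Γ ∧ ∀ r ∈ R, L r = Γ) ∧
      ¬ (R.card = k - 2 ∧ ∀ r ∈ R, L r ⊆ insert c (L w))
  · obtain ⟨c, hcM, ht1, ht2⟩ := hun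
    obtain ⟨d, e, hd, he, hde⟩ := hitting A L k hk hA hAk hLA hN hz c
    obtain ⟨g, hg1, hg2⟩ := hall (insert w R) _
      (hallRegW R w hw L k hk hR hLR hLw c d e (h1 c hcM) ht1 ht2)
    simp only [Finset.mem_sdiff, Finset.mem_insert, Finset.mem_singleton, not_or] at hg1 hg2
    have hgw := hg1 w (Or.inl rfl)
    refine ⟨c, hcM, fun x => if d ∈ L x then d else e, g, g w, hgw.1, ?_, ?_, ?_, ?_⟩
    · intro x hx; have := hde x hx; grind
    · intro x hx
      have h2 := hg1 x (Or.inr hx)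
      refine ⟨h2.1, h2.2.1, fun h => ?_⟩
      have := hg2 x (Or.inr hx) w (Or.inl rfl) h
      exact hw (this ▸ hx)
    · intro x hx y hy; exact hg2 x (Or.inr hx) y (Or.inr hy)
    · intro x hx y hy; have := hg1 y (Or.inr hy); grind
  push Not at hun
  obtain ⟨c, hcM, c', hcM', hcc⟩ := Finset.one_lt_card.1 (show 1 < M.card by omega)
  have hcw := h1 c hcM
  have hcw' := h1 c' hcM'
  have hRc : R.card = k - 2 := by
    by_contra h
    exact h (hun c hcM (fun h' => absurd h' h)).1
  obtain ⟨r0, hr0⟩ : R.Nonempty := by rw [← Finset.card_pos]; omega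
  have hcases : (∀ r ∈ R, L r = L w) ∨ (∃ Γ : Finset ℕ, c ∈ Γ ∧ c' ∈ Γ ∧ ∀ r ∈ R, L r = Γ) := by
    by_cases ha : ∃ Γ : Finset ℕ, c ∈ Γ ∧ ∀ r ∈ R, L r = Γ
    · obtain ⟨Γ, hcΓ, hΓ⟩ := ha
      right
      refine ⟨Γ, hcΓ, ?_, hΓ⟩
      by_contra hc'
      have h2 := (hun c' hcM' (by
        intro _ Γ' hc'' 
        by_contra hcon
        push Not at hcon
        have := hcon r0 hr0
        rw [hΓ r0 hr0] at this
        exact hc' (this ▸ hc''))).2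
      have h3 := h2 r0 hr0
      rw [hΓ r0 hr0] at h3
      have := h3 hcΓ
      rw [Finset.mem_insert] at this
      tauto
    · have h2 := (hun c hcM (by
        intro _ Γ' hc''
        by_contra hcon
        push Not at hcon
        exact ha ⟨Γ', hc'', hcon⟩)).2
      left
      by_cases hb : ∃ Γ : Finset ℕ, c' ∈ Γ ∧ ∀ r ∈ R, L r = Γ
      · obtain ⟨Γ, hcΓ, hΓ⟩ := hb
        have h3 := h2 r0 hr0
        rw [hΓ r0 hr0] at h3
        have := h3 hcΓ
        rw [Finset.mem_insert] at this
        rcases this with h | h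
        · exact absurd h.symm hcc
        · exact absurd h hcw'
      · have h3 := (hun c' hcM' (by
          intro _ Γ' hc''
          by_contra hcon
          push Not at hcon
          exact hb ⟨Γ', hc'', hcon⟩)).2
        intro r hr
        apply Finset.eq_of_subset_of_card_le
        · intro x hx
          have e1 := h2 r hr hx
          have e2 := h3 r hr hx
          rw [Finset.mem_insert] at e1 e2
          grind
        · rw [hLR r hr, hLw]
  rcases hcases with hRw | ⟨Γ, hcΓ, hcΓ', hRΓ⟩
  · obtain ⟨f, hf, c0, hc0, hpick⟩ := pairpick A L (L w) (L w) {c, c'} (Finset.Subset.refl _)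
      (by intro g hg; simp only [Finset.mem_insert, Finset.mem_singleton] at hg
          rcases hg with rfl | rfl <;> assumption)
      (by rw [Finset.card_pair hcc, hLw]; omega) (by intro v hv; rw [hLA v hv, hLw])
    have hc0M : c0 ∈ M := by
      simp only [Finset.mem_insert, Finset.mem_singleton] at hc0
      rcases hc0 with rfl | rfl <;> assumption
    have hc0w := h1 c0 hc0M
    obtain ⟨g, hg1, hg2⟩ := greedy (insert w R) (fun _ => (L w).erase f) (by
      intro v hv
      rw [Finset.card_erase_of_mem hf, Finset.card_insert_of_notMem hw]; omega)
    simp only [Finset.mem_erase, Finset.mem_insert] at hg1 hg2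
    have hy : ∀ x, ∃ y, x ∈ A → y ∈ L x ∧ (y = f ∨ y ∉ L w ∧ y ≠ c0) := by
      intro x
      by_cases hx : x ∈ A
      · by_cases hfx : f ∈ L x
        · exact ⟨f, fun _ => ⟨hfx, Or.inl rfl⟩⟩
        · obtain ⟨y, hy, hy2⟩ := hpick x hx hfx
          exact ⟨y, fun _ => ⟨hy, Or.inr hy2⟩⟩
      · exact ⟨0, fun h => absurd h hx⟩
    choose gA hgA using hy
    have hgw := hg1 w (Or.inl rfl)
    refine ⟨c0, hc0M, gA, g, g w, hgw.2, ?_, ?_, ?_, ?_⟩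
    · intro x hx; have := hgA x hx; grind
    · intro x hx
      have h2 := hg1 x (Or.inr hx)
      refine ⟨by rw [hRw x hx]; exact h2.2, fun h => hc0w (h ▸ h2.2), fun h => ?_⟩
      have := hg2 x (Or.inr hx) w (Or.inl rfl) h
      exact hw (this ▸ hx)
    · intro x hx y hy; exact hg2 x (Or.inr hx) y (Or.inr hy)
    · intro x hx y hy; have := hgA x hx; have := hg1 y (Or.inr hy); grind
  · have hΓ : Γ.card = k := by rw [← hRΓ r0 hr0, hLR r0 hr0]
    have h2 : 2 ≤ (L w \ Γ).card := by
      have e1 := Finset.card_sdiff_add_card_inter (L w) Γ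
      have e2 : ((L w ∩ Γ) ∪ {c, c'}).card ≤ Γ.card := by
        apply Finset.card_le_card
        intro x hx
        simp only [Finset.mem_union, Finset.mem_inter, Finset.mem_insert,
          Finset.mem_singleton] at hx
        grind
      rw [Finset.card_union_of_disjoint (by
        rw [Finset.disjoint_left]
        intro x hx hx'
        simp only [Finset.mem_inter, Finset.mem_insert, Finset.mem_singleton] at hx hx'
        grind), Finset.card_pair hcc] at e2
      omega
    obtain ⟨f, hf, g0, hg0, hpick⟩ := pairpick A L Γ (Γ.erase c) (L w \ Γ)
      (Finset.erase_subset _ _)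
      (by intro g hg; exact (Finset.mem_sdiff.1 hg).2)
      (by rw [Finset.card_erase_of_mem hcΓ, hΓ]
          calc A.card ≤ k := hAk
            _ < (k - 1) * 2 := by omega
            _ ≤ _ := Nat.mul_le_mul_left _ h2)
      (by intro v hv; rw [hLA v hv, hΓ])
    rw [Finset.mem_erase] at hf
    rw [Finset.mem_sdiff] at hg0
    obtain ⟨g, hg1, hg2⟩ := hΓcol Γ hΓ c hcΓ f hf.2 hf.1 hRΓ
    simp only [Finset.mem_erase] at hg1
    have hy : ∀ x, ∃ y, x ∈ A → y ∈ L x ∧ (y = f ∨ y ∉ Γ ∧ y ≠ g0) := by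
      intro x
      by_cases hx : x ∈ A
      · by_cases hfx : f ∈ L x
        · exact ⟨f, fun _ => ⟨hfx, Or.inl rfl⟩⟩
        · obtain ⟨y, hy, hy2⟩ := hpick x hx hfx
          exact ⟨y, fun _ => ⟨hy, Or.inr hy2⟩⟩
      · exact ⟨0, fun h => absurd h hx⟩
    choose gA hgA using hy
    refine ⟨c, hcM, gA, g, g0, hg0.1, ?_, ?_, hg2, ?_⟩
    · intro x hx; have := hgA x hx; grind
    · intro x hx; have := hg1 x hx; have := hRΓ x hx; grind
    · intro x hx y hy; have := hgA x hx; have := hg1 y hy; grind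

/-- List colorability of the complete multipartite graph on `W` with parts given by `part`. -/
def Col (W : Finset V) (part : V → ℕ) (L : V → Finset ℕ) : Prop :=
  ∃ f : V → ℕ, (∀ v ∈ W, f v ∈ L v) ∧ ∀ x ∈ W, ∀ y ∈ W, part x ≠ part y → f x ≠ f y

lemma mid (W : Finset V) (part : V → ℕ) (L : V → Finset ℕ) (k : ℕ) (hk : 4 ≤ k)
    (hA : (W.filter (fun x => part x = 0)).card ≤ 6)
    (hAk : (W.filter (fun x => part x = 0)).card ≤ k)
    (u v w : V) (hu : u ∈ W) (hv : v ∈ W) (hw : w ∈ W) (huv : u ≠ v)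
    (hB : ∀ x ∈ W, part x = 1 ↔ (x = u ∨ x = v ∨ x = w))
    (J : Finset ℕ) (hJ : J.card ≤ k - 2) (hJW : ∀ x ∈ W, part x = 0 ∨ part x = 1 ∨ part x ∈ J)
    (hdis : ∀ x ∈ W, ∀ y ∈ W, x ≠ y → part x = part y → part x ≠ 0 → part x ≠ 1 →
      Disjoint (L x) (L y))
    (hW : W.card ≤ 2 * k + 1) (hL : ∀ x ∈ W, (L x).card = k)
    (hM : 2 ≤ (L u ∩ L v).card) : Col W part L := by
  obtain ⟨S, hS, hdef, -, hext⟩ := split (W \ {u, v}) L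
  have hSW : S ⊆ W := hS.trans Finset.sdiff_subset
  have hSuv : ∀ x ∈ S, x ≠ u ∧ x ≠ v := by
    intro x hx
    have := hS hx
    simp only [Finset.mem_sdiff, Finset.mem_insert, Finset.mem_singleton, not_or] at this
    exact this.2
  have hSc : S.card ≤ 2 * k - 1 := by
    have h1 := Finset.card_le_card hS
    rw [Finset.card_sdiff_of_subset (by
      intro x hx; simp only [Finset.mem_insert, Finset.mem_singleton] at hx
      rcases hx with rfl | rfl <;> assumption), Finset.card_pair huv] at h1
    omega
  set A0 := S.filter (fun x => part x = 0) with hA0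
  set R := S.filter (fun x => part x ≠ 0 ∧ part x ≠ 1) with hRdef
  have hA0W : A0.card ≤ (W.filter (fun x => part x = 0)).card :=
    Finset.card_le_card (Finset.filter_subset_filter _ hSW)
  have hRJ : R.card ≤ J.card := by
    apply Finset.card_le_card_of_injOn part
    · intro x hx
      have hx' := Finset.mem_filter.1 hx
      have := hJW x (hSW hx'.1)
      have := hx'.2
      simp only [Finset.mem_coe]
      tauto
    · intro x hx y hy hxy
      by_contra hne
      have hx' := Finset.mem_filter.1 hx
      have hy' := Finset.mem_filter.1 hy
      have hd := hdis x (hSW hx'.1) y (hSW hy'.1) hne hxy hx'.2.1 hx'.2.2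
      have h2 : (L x ∪ L y).card ≤ (S.biUnion L).card :=
        Finset.card_le_card (Finset.union_subset (Finset.subset_biUnion_of_mem L hx'.1)
          (Finset.subset_biUnion_of_mem L hy'.1))
      rw [Finset.card_union_of_disjoint hd, hL x (hSW hx'.1), hL y (hSW hy'.1)] at h2
      omega
  have hwR : w ∉ R := by
    intro h
    have := (Finset.mem_filter.1 h).2.2
    exact this ((hB w hw).2 (by simp))
  have hScard : S.card ≤ A0.card + R.card + 1 := by
    have h1 : S ⊆ A0 ∪ R ∪ {w} := by
      intro x hx
      simp only [hA0, hRdef, Finset.mem_union, Finset.mem_filter, Finset.mem_singleton]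
      have := hB x (hSW hx)
      have := hSuv x hx
      tauto
    calc S.card ≤ _ := Finset.card_le_card h1
      _ ≤ (A0 ∪ R).card + ({w} : Finset V).card := Finset.card_union_le _ _
      _ ≤ _ := by
        have := Finset.card_union_le A0 R
        simp only [Finset.card_singleton]
        omega
  have hΛ : (A0.biUnion L).card ≤ (S.biUnion L).card :=
    Finset.card_le_card (Finset.biUnion_subset_biUnion_of_subset_left L (Finset.filter_subset _ _))
  obtain ⟨c, hcM, gA, gR, gw, hgw, h1, h2, h3, h4⟩ := core_s12 A0 R w hwR L k hk
    (by omega) (by omega) (by omega)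
    (fun x hx => hL x (hSW (Finset.mem_filter.1 hx).1))
    (fun x hx => hL x (hSW (Finset.mem_filter.1 hx).1)) (hL w hw) (by omega) (L u ∩ L v) hM
  rw [Finset.mem_inter] at hcM
  obtain ⟨h, hh1, hh2⟩ := hext c
  have mA : ∀ x ∈ S, part x = 0 → x ∈ A0 := fun x hx hp => Finset.mem_filter.2 ⟨hx, hp⟩
  have mR : ∀ x ∈ S, part x ≠ 0 → part x ≠ 1 → x ∈ R :=
    fun x hx hp hq => Finset.mem_filter.2 ⟨hx, hp, hq⟩
  have mW : ∀ x ∈ W, x ≠ u → x ≠ v → x ∈ W \ {u, v} := by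
    intro x hx hxu hxv
    simp [hx, hxu, hxv]
  have pu : part u = 1 := (hB u hu).2 (by simp)
  have pv : part v = 1 := (hB v hv).2 (by simp)
  have mB : ∀ x ∈ S, part x = 1 → x = w := by
    intro x hx hp
    have := (hB x (hSW hx)).1 hp
    have := hSuv x hx
    tauto
  set g : V → ℕ := fun x => if part x = 0 then gA x else if part x = 1 then gw else gR x with hg
  have hgL : ∀ x ∈ S, g x ∈ L x := by
    intro x hx
    simp only [hg]
    split_ifs with ha hb
    · exact (h1 x (mA x hx ha)).1
    · rw [mB x hx hb]; exact hgw
    · exact (h2 x (mR x hx ha hb)).1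
  have hgc : ∀ x ∈ S, part x ≠ 1 → g x ≠ c := by
    intro x hx hp
    simp only [hg]
    split_ifs with ha
    · exact (h1 x (mA x hx ha)).2.1
    · exact (h2 x (mR x hx ha hp)).2.1
  have hgp : ∀ x ∈ S, ∀ y ∈ S, part x ≠ part y → g x ≠ g y := by
    intro x hx y hy hxy
    simp only [hg]
    split_ifs with ha hb hc' hd he hf hi hj
    · omega
    · exact (h1 x (mA x hx ha)).2.2
    · exact h4 x (mA x hx ha) y (mR y hy hb hc')
    · exact (h1 y (mA y hy he)).2.2.symm
    · omega
    · exact (h2 y (mR y hy he hf)).2.2.symm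
    · exact (h4 y (mA y hy hi) x (mR x hx ha hd)).symm
    · exact (h2 x (mR x hx ha hd)).2.2
    · intro heq
      have := h3 x (mR x hx ha hd) y (mR y hy hi hj) heq
      exact hxy (by rw [this])
  refine ⟨fun x => if x = u ∨ x = v then c else if x ∈ S then g x else h x, ?_, ?_⟩
  · intro x hx
    dsimp only
    split_ifs with ha hb
    · rcases ha with rfl | rfl
      · exact hcM.1
      · exact hcM.2
    · exact hgL x hb
    · push Not at ha
      exact (hh1 x (mW x hx ha.1 ha.2) hb).1
  · intro x hx y hy hxy
    have p1 : ∀ x, x = u ∨ x = v → part x = 1 := by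
      rintro x (rfl | rfl) <;> assumption
    have gS : ∀ x ∈ S, g x ∈ S.biUnion L := fun x hx => Finset.mem_biUnion.2 ⟨x, hx, hgL x hx⟩
    dsimp only
    by_cases hx1 : x = u ∨ x = v
    · rw [if_pos hx1]
      by_cases hy1 : y = u ∨ y = v
      · exact absurd ((p1 x hx1).trans (p1 y hy1).symm) hxy
      rw [if_neg hy1]
      push Not at hy1
      split_ifs with hyS
      · exact (hgc y hyS (by rw [← p1 x hx1]; exact hxy.symm)).symm
      · exact (hh1 y (mW y hy hy1.1 hy1.2) hyS).2.2.symm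
    · rw [if_neg hx1]
      push Not at hx1
      by_cases hy1 : y = u ∨ y = v
      · rw [if_pos hy1]
        split_ifs with hxS
        · exact hgc x hxS (by rw [← p1 y hy1]; exact hxy)
        · exact (hh1 x (mW x hx hx1.1 hx1.2) hxS).2.2
      · rw [if_neg hy1]
        push Not at hy1
        split_ifs with hxS hyS hyS
        · exact hgp x hxS y hyS hxy
        · intro heq
          exact (hh1 y (mW y hy hy1.1 hy1.2) hyS).2.1 (heq ▸ gS x hxS)
        · intro heq
          exact (hh1 x (mW x hx hx1.1 hx1.2) hxS).2.1 (heq ▸ gS y hyS)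
        · intro heq
          have := hh2 x (mW x hx hx1.1 hx1.2) hxS y (mW y hy hy1.1 hy1.2) hyS heq
          exact hxy (by rw [this])

/-- The case of few colors in total. -/
lemma mid2 (W : Finset V) (part : V → ℕ) (L : V → Finset ℕ) (k : ℕ) (hk : 4 ≤ k)
    (hA : (W.filter (fun x => part x = 0)).card ≤ 6)
    (hAk : (W.filter (fun x => part x = 0)).card ≤ k)
    (hB : (W.filter (fun x => part x = 1)).card = 3)
    (J : Finset ℕ) (hJ : J.card ≤ k - 2) (hJW : ∀ x ∈ W, part x = 0 ∨ part x = 1 ∨ part x ∈ J)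
    (hdis : ∀ x ∈ W, ∀ y ∈ W, x ≠ y → part x = part y → part x ≠ 0 → part x ≠ 1 →
      Disjoint (L x) (L y))
    (hW : W.card ≤ 2 * k + 1) (hL : ∀ x ∈ W, (L x).card = k)
    (hC : (W.biUnion L).card ≤ 2 * k) : Col W part L := by
  obtain ⟨b0, b1, b2, h01, h02, h12, hBe⟩ := Finset.card_eq_three.1 hB
  have hBm : ∀ x, (x ∈ W ∧ part x = 1) ↔ (x = b0 ∨ x = b1 ∨ x = b2) := by
    intro x
    have : x ∈ W.filter (fun x => part x = 1) ↔ x ∈ ({b0, b1, b2} : Finset V) := by rw [hBe]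
    simpa using this
  have w0 := ((hBm b0).2 (by simp)).1
  have w1 := ((hBm b1).2 (by simp)).1
  have w2 := ((hBm b2).2 (by simp)).1
  have hBm' : ∀ x ∈ W, part x = 1 ↔ (x = b0 ∨ x = b1 ∨ x = b2) := by
    intro x hx
    have := hBm x
    tauto
  have e1 := Finset.card_union_add_card_inter (L b0) (L b1)
  have e2 := Finset.card_union_add_card_inter (L b0 ∪ L b1) (L b2)
  have e3 : (L b0 ∪ L b1 ∪ L b2).card ≤ (W.biUnion L).card :=
    Finset.card_le_card (Finset.union_subset (Finset.union_subset
      (Finset.subset_biUnion_of_mem L w0) (Finset.subset_biUnion_of_mem L w1))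
      (Finset.subset_biUnion_of_mem L w2))
  have e4 : ((L b0 ∪ L b1) ∩ L b2).card ≤ (L b0 ∩ L b2).card + (L b1 ∩ L b2).card := by
    rw [Finset.union_inter_distrib_right]
    exact Finset.card_union_le _ _
  rw [hL b0 w0, hL b1 w1] at e1
  rw [hL b2 w2] at e2
  have : 2 ≤ (L b0 ∩ L b1).card ∨ 2 ≤ (L b0 ∩ L b2).card ∨ 2 ≤ (L b1 ∩ L b2).card := by omega
  rcases this with h | h | h
  · exact mid W part L k hk hA hAk b0 b1 b2 w0 w1 w2 h01 hBm' J hJ hJW hdis hW hL h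
  · exact mid W part L k hk hA hAk b0 b2 b1 w0 w2 w1 h02
      (by intro x hx; have := hBm' x hx; tauto) J hJ hJW hdis hW hL h
  · exact mid W part L k hk hA hAk b1 b2 b0 w1 w2 w0 h12
      (by intro x hx; have := hBm' x hx; tauto) J hJ hJW hdis hW hL h

/-- Reduction to few colors (Kierstead). -/
lemma kierstead (W : Finset V) (part : V → ℕ) (k : ℕ) (hW : W.card ≤ 2 * k + 1)
    (H : ∀ L : V → Finset ℕ, (∀ x ∈ W, (L x).card = k) → (W.biUnion L).card ≤ 2 * k →
      Col W part L) (L : V → Finset ℕ) (hL : ∀ x ∈ W, (L x).card = k) : Col W part L := by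
  obtain ⟨S, hS, -, hdef, hext⟩ := split W L
  rcases hdef with hdef | hdef
  · obtain ⟨s0, hs0⟩ : S.Nonempty := by rw [← Finset.card_pos]; omega
    have hSc := Finset.card_le_card hS
    obtain ⟨g, hg1, hg2⟩ := H (fun x => if x ∈ S then L x else L s0) (by
      intro x hx
      split_ifs
      · exact hL x hx
      · exact hL s0 (hS hs0)) (by
      have : W.biUnion (fun x => if x ∈ S then L x else L s0) ⊆ S.biUnion L := by
        intro c hc
        rw [Finset.mem_biUnion] at hc ⊢
        obtain ⟨x, hx, hc⟩ := hc
        split_ifs at hc with h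
        · exact ⟨x, h, hc⟩
        · exact ⟨s0, hs0, hc⟩
      have := Finset.card_le_card this
      omega)
    obtain ⟨h, hh1, hh2⟩ := hext 0
    have hgL : ∀ x ∈ S, g x ∈ L x := by
      intro x hx
      have := hg1 x (hS hx)
      simp only [hx, if_true] at this
      exact this
    have gS : ∀ x ∈ S, g x ∈ S.biUnion L := fun x hx => Finset.mem_biUnion.2 ⟨x, hx, hgL x hx⟩
    refine ⟨fun x => if x ∈ S then g x else h x, ?_, ?_⟩
    · intro x hx
      dsimp only
      split_ifs with hxS
      · exact hgL x hxS
      · exact (hh1 x hx hxS).1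
    · intro x hx y hy hxy
      dsimp only
      split_ifs with hxS hyS hyS
      · exact hg2 x hx y hy hxy
      · intro heq
        exact (hh1 y hy hyS).2.1 (heq ▸ gS x hxS)
      · intro heq
        exact (hh1 x hx hxS).2.1 (heq ▸ gS y hyS)
      · intro heq
        have := hh2 x hx hxS y hy hyS heq
        exact hxy (by rw [this])
  · obtain ⟨f, hf1, hf2⟩ := hall W L hdef
    refine ⟨f, hf1, ?_⟩
    intro x hx y hy hxy heq
    exact hxy (by rw [hf2 x hx y hy heq])

/-- Main upper bound, by induction on the number of parts of size two. -/
lemma upper_s12 (s : ℕ) (hs2 : 2 ≤ s) (hs4 : s ≤ 4) (m : ℕ) :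
    ∀ (W : Finset V) (part : V → ℕ) (P Q : Finset ℕ), P.card = m → Q.card = s →
    (∀ x ∈ W, part x = 0 ∨ part x = 1 ∨ part x ∈ P ∨ part x ∈ Q) → 0 ∉ P → 1 ∉ P →
    (W.filter (fun x => part x = 0)).card ≤ s + 2 →
    (W.filter (fun x => part x = 1)).card = 3 →
    (∀ i ∈ P, (W.filter (fun x => part x = i)).card ≤ 2) →
    (∀ i ∈ Q, (W.filter (fun x => part x = i)).card ≤ 1) →
    ∀ L : V → Finset ℕ, (∀ x ∈ W, m + s + 2 ≤ (L x).card) → Col W part L := by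
  induction m using Nat.strong_induction_on with
  | _ m ih =>
  intro W part P Q hP hQ hpart h0 h1 hA hB hPc hQc L0 hL0
  have hex : ∀ x, ∃ T : Finset ℕ, x ∈ W → T ⊆ L0 x ∧ T.card = m + s + 2 := by
    intro x
    by_cases hx : x ∈ W
    · obtain ⟨T, hT⟩ := Finset.exists_subset_card_eq (hL0 x hx)
      exact ⟨T, fun _ => hT⟩
    · exact ⟨∅, fun h => absurd h hx⟩
  choose L1 hL1 using hex
  suffices hcol : Col W part L1 by
    obtain ⟨f, hf1, hf2⟩ := hcol
    exact ⟨f, fun v hv => (hL1 v hv).1 (hf1 v hv), hf2⟩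
  have hWc : W.card ≤ 2 * (m + s + 2) + 1 := by
    have hsub : W ⊆ (W.filter (fun x => part x = 0)) ∪ (W.filter (fun x => part x = 1)) ∪
        (P.biUnion fun i => W.filter (fun x => part x = i)) ∪
        (Q.biUnion fun i => W.filter (fun x => part x = i)) := by
      intro x hx
      simp only [Finset.mem_union, Finset.mem_filter, Finset.mem_biUnion]
      rcases hpart x hx with h | h | h | h
      · exact Or.inl (Or.inl (Or.inl ⟨hx, h⟩))
      · exact Or.inl (Or.inl (Or.inr ⟨hx, h⟩))
      · exact Or.inl (Or.inr ⟨_, h, hx, rfl⟩)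
      · exact Or.inr ⟨_, h, hx, rfl⟩
    have a1 := Finset.card_le_card hsub
    have a2 := Finset.card_union_le ((W.filter (fun x => part x = 0)) ∪
        (W.filter (fun x => part x = 1)) ∪
        (P.biUnion fun i => W.filter (fun x => part x = i)))
        (Q.biUnion fun i => W.filter (fun x => part x = i))
    have a3 := Finset.card_union_le ((W.filter (fun x => part x = 0)) ∪
        (W.filter (fun x => part x = 1)))
        (P.biUnion fun i => W.filter (fun x => part x = i))
    have a4 := Finset.card_union_le (W.filter (fun x => part x = 0))
        (W.filter (fun x => part x = 1))
    have a5 := Finset.card_biUnion_le_card_mul P _ 2 hPc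
    have a6 := Finset.card_biUnion_le_card_mul Q _ 1 hQc
    rw [hP] at a5
    rw [hQ] at a6
    omega
  refine kierstead W part (m + s + 2) hWc ?_ L1 (fun x hx => (hL1 x hx).2)
  intro L hL hC
  by_cases hcom : ∃ x ∈ W, ∃ y ∈ W, x ≠ y ∧ part x = part y ∧ part x ≠ 0 ∧ part x ≠ 1 ∧
      ∃ z, z ∈ L x ∧ z ∈ L y
  · obtain ⟨x, hx, y, hy, hne, hxy, hx0, hx1, z, hzx, hzy⟩ := hcom
    have hpair : ∀ i, part x = i → ({x, y} : Finset V) ⊆ W.filter (fun v => part v = i) := by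
      intro i hi v hv
      simp only [Finset.mem_insert, Finset.mem_singleton] at hv
      rw [Finset.mem_filter]
      rcases hv with rfl | rfl
      · exact ⟨hx, hi⟩
      · exact ⟨hy, hxy ▸ hi⟩
    have hxQ : part x ∉ Q := by
      intro h
      have b1 := hQc _ h
      have b2 := Finset.card_le_card (hpair _ rfl)
      rw [Finset.card_pair hne] at b2
      omega
    have hxP : part x ∈ P := by
      have := hpart x hx
      tauto
    have hfib : ∀ v ∈ W, part v = part x → v = x ∨ v = y := by
      intro v hv hvx
      have he : ({x, y} : Finset V) = W.filter (fun v => part v = part x) :=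
        Finset.eq_of_subset_of_card_le (hpair _ rfl) (by
          rw [Finset.card_pair hne]; exact hPc _ hxP)
      have : v ∈ ({x, y} : Finset V) := by
        rw [he, Finset.mem_filter]; exact ⟨hv, hvx⟩
      simpa using this
    have hm : 0 < m := by rw [← hP]; exact Finset.card_pos.2 ⟨_, hxP⟩
    have hle : ∀ i, ((W.filter (fun v => part v ≠ part x)).filter (fun v => part v = i)).card ≤
        (W.filter (fun v => part v = i)).card := fun i =>
      Finset.card_le_card (Finset.filter_subset_filter _ (Finset.filter_subset _ _))
    obtain ⟨f, hf1, hf2⟩ := ih (m - 1) (by omega) (W.filter (fun v => part v ≠ part x)) part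
      (P.erase (part x)) Q (by rw [Finset.card_erase_of_mem hxP, hP]) hQ
      (by
        intro v hv
        rw [Finset.mem_filter] at hv
        have := hpart v hv.1
        have := hv.2
        rw [Finset.mem_erase]
        tauto)
      (fun h => h0 (Finset.mem_of_mem_erase h)) (fun h => h1 (Finset.mem_of_mem_erase h))
      ((hle 0).trans hA)
      (by
        rw [← hB, Finset.filter_filter]
        congr 1
        apply Finset.filter_congr
        intro v hv
        constructor
        · exact fun h => h.2
        · intro h
          refine ⟨?_, h⟩
          rw [h]
          exact fun h => hx1 h.symm)
      (fun i hi => (hle i).trans (hPc i (Finset.mem_of_mem_erase hi)))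
      (fun i hi => (hle i).trans (hQc i hi))
      (fun v => (L v).erase z) (by
        intro v hv
        have c1 := Finset.pred_card_le_card_erase (s := L v) (a := z)
        rw [hL v (Finset.mem_filter.1 hv).1] at c1
        omega)
    refine ⟨fun v => if part v = part x then z else f v, ?_, ?_⟩
    · intro v hv
      dsimp only
      split_ifs with h
      · rcases hfib v hv h with rfl | rfl
        · exact hzx
        · exact hzy
      · exact Finset.mem_of_mem_erase (hf1 v (Finset.mem_filter.2 ⟨hv, h⟩))
    · intro v hv w hw hvw
      dsimp only
      split_ifs with h h' h'
      · exact absurd (h.trans h'.symm) hvw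
      · exact (Finset.ne_of_mem_erase (hf1 w (Finset.mem_filter.2 ⟨hw, h'⟩))).symm
      · exact Finset.ne_of_mem_erase (hf1 v (Finset.mem_filter.2 ⟨hv, h⟩))
      · exact hf2 v (Finset.mem_filter.2 ⟨hv, h⟩) w (Finset.mem_filter.2 ⟨hw, h'⟩) hvw
  · refine mid2 W part L (m + s + 2) (by omega) (by omega) (by omega) hB (P ∪ Q) ?_ ?_ ?_ hWc hL hC
    · have := Finset.card_union_le P Q
      omega
    · intro x hx
      rw [Finset.mem_union]
      exact hpart x hx
    · intro x hx y hy hne hxy hx0 hx1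
      rw [Finset.disjoint_left]
      intro z hz hz'
      exact hcom ⟨x, hx, y, hy, hne, hxy, hx0, hx1, z, hz, hz'⟩

/-- Cardinality of a part. -/
lemma fiber {k : ℕ} (d : Fin k → ℕ) (i : Fin k) :
    ((Finset.univ : Finset (Σ i : Fin k, Fin (d i))).filter
      (fun v => v.1.val = i.val)).card = d i := by
  have h : (Finset.univ : Finset (Σ i : Fin k, Fin (d i))).filter (fun v => v.1.val = i.val) =
      (Finset.univ : Finset (Fin (d i))).map (Function.Embedding.sigmaMk i) := by
    ext ⟨j, x⟩
    simp only [Finset.mem_filter, Finset.mem_univ, true_and, Finset.mem_map,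
      Function.Embedding.sigmaMk_apply]
    constructor
    · intro hj
      have : j = i := Fin.ext hj
      subst this
      exact ⟨x, rfl⟩
    · rintro ⟨a, ha⟩
      cases ha
      rfl
  rw [h, Finset.card_map, Finset.card_fin]

end Ohba

/-- Shen et al.: `Ch(K_{s+2,3,2*(k-s-2),1*s}) = k` for `s ∈ {2, 3, 4}` and `k ≥ s + 2`. -/
theorem choiceNumber_Ks2_3_2xks2_1xs (k s : ℕ) (hs : s ∈ ({2, 3, 4} : Set ℕ))
    (hk : s + 2 ≤ k) :
    IsLeast {n | Choosable (SimpleGraph.completeMultipartiteGraph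
      (fun i : Fin k => Fin (if i.val = 0 then s + 2 else if i.val = 1 then 3
        else if i.val < k - s then 2 else 1))) n} k := by
  have hs' : 2 ≤ s ∧ s ≤ 4 := by
    simp only [Set.mem_insert_iff, Set.mem_singleton_iff] at hs
    omega
  constructor
  · intro L hL
    obtain ⟨f, hf1, hf2⟩ := Ohba.upper_s12 s hs'.1 hs'.2 (k - s - 2) Finset.univ
      (fun v : (Σ i : Fin k, Fin (if i.val = 0 then s + 2 else if i.val = 1 then 3
        else if i.val < k - s then 2 else 1)) => v.1.val)
      (Finset.Ico 2 (k - s)) (Finset.Ico (k - s) k) (by simp) (by simp; omega)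
      (by
        intro x _
        have := x.1.isLt
        simp only [Finset.mem_Ico]
        omega) (by simp) (by simp)
      (by
        rw [Ohba.fiber _ ⟨0, by omega⟩]
        simp)
      (by
        rw [Ohba.fiber _ ⟨1, by omega⟩]
        simp)
      (by
        intro i hi
        rw [Finset.mem_Ico] at hi
        rw [Ohba.fiber _ ⟨i, by omega⟩]
        simp only
        split_ifs <;> omega)
      (by
        intro i hi
        rw [Finset.mem_Ico] at hi
        rw [Ohba.fiber _ ⟨i, by omega⟩]
        simp only
        split_ifs <;> omega)
      L (by
        intro x _
        have := hL x
        omega)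
    refine ⟨f, fun v => hf1 v (Finset.mem_univ v), ?_⟩
    intro u w huw
    apply hf2 u (Finset.mem_univ u) w (Finset.mem_univ w)
    intro h
    exact huw (Fin.ext h)
  · intro n hn
    obtain ⟨c, hc1, hc2⟩ := hn (fun _ => Finset.range n) (by simp)
    have hpos : ∀ i : Fin k, 0 < (if i.val = 0 then s + 2 else if i.val = 1 then 3
        else if i.val < k - s then 2 else 1) := by
      intro i
      split_ifs <;> omega
    have := Finset.card_le_card_of_injOn (s := (Finset.univ : Finset (Fin k)))
      (t := Finset.range n) (fun i => c ⟨i, ⟨0, hpos i⟩⟩) (fun i _ => hc1 _) (by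
        intro i _ j _ hij
        by_contra hne
        exact hc2 (u := ⟨i, ⟨0, hpos i⟩⟩) (w := ⟨j, ⟨0, hpos j⟩⟩) hne hij)
    simpa using this
end
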